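/- arXiv:2112.10533 — 3 statements merged into one kernel-verified Lean document; each statement's English description precedes it below -/
import Mathlib

section
/- Let n, d ≥ 1 and let f ∈ ℝ[x₁,…,xₙ] be a form of degree 2d that is a sum of squares of forms of degree d. Let F be a nonempty face of the Gram spectrahedron Gram(f), let G be a point of the relative interior of F, and let U = U_G be the image of G. Then dim F = (dim U)(dim U + 1)/2 − dim U². -/
open MvPolynomial Matrix

/-- A face of a convex set `S`: a convex subset `F ⊆ S` such that whenever a point
of `F` lies in the open segment between two points of `S`, both endpoints lie in `F`. -/
def IsFace {E : Type*} [AddCommGroup E] [Module ℝ E] (S F : Set E) : Prop :=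
  F ⊆ S ∧ Convex ℝ F ∧ ∀ x ∈ S, ∀ y ∈ S, ∀ t : ℝ, 0 < t → t < 1 →
    t • x + (1 - t) • y ∈ F → x ∈ F ∧ y ∈ F

namespace GramFace

/-- Full-rank factorization of a positive semidefinite matrix. -/
lemma exists_factor {N : ℕ} (G : Matrix (Fin N) (Fin N) ℝ) (hG : G.PosSemidef) :
    ∃ (r : ℕ) (B : Matrix (Fin N) (Fin r) ℝ) (L : Matrix (Fin r) (Fin N) ℝ),
      G = B * Bᵀ ∧ L * B = 1 := by
  classical
  have hH := hG.1
  set E : Matrix (Fin N) (Fin N) ℝ := (hH.eigenvectorUnitary : Matrix (Fin N) (Fin N) ℝ) with hE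
  set ev := hH.eigenvalues with hev
  have hpos : ∀ k, 0 ≤ ev k := hG.eigenvalues_nonneg
  have hEE : Eᵀ * E = 1 := by
    have := (Matrix.mem_unitaryGroup_iff').1 hH.eigenvectorUnitary.2
    simpa [Matrix.star_eq_conjTranspose, Matrix.conjTranspose_eq_transpose_of_trivial] using this
  have hsp : G = E * diagonal ev * Eᵀ := by
    have := hH.spectral_theorem
    rw [Unitary.conjStarAlgAut_apply] at this
    simpa [Matrix.star_eq_conjTranspose, Matrix.conjTranspose_eq_transpose_of_trivial,
      Function.comp_def] using this
  let e := (Fintype.equivFin {k // ev k ≠ 0})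
  refine ⟨Fintype.card {k // ev k ≠ 0},
    Matrix.of fun i k => E i (e.symm k) * √(ev (e.symm k)),
    Matrix.of fun k i => E i (e.symm k) / √(ev (e.symm k)), ?_, ?_⟩
  · ext i j
    have h1 : G i j = ∑ k, E i k * ev k * E j k := by
      conv_lhs => rw [hsp]
      simp [Matrix.mul_apply, Matrix.diagonal_apply]
    rw [h1, Matrix.mul_apply]
    simp only [Matrix.of_apply, Matrix.transpose_apply]
    rw [e.symm.sum_comp (fun k : {k // ev k ≠ 0} =>
      E i k * √(ev k) * (E j k * √(ev k)))]
    have h2 : ∀ k, E i k * ev k * E j k = E i k * √(ev k) * (E j k * √(ev k)) := fun k => by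
      have := Real.mul_self_sqrt (hpos k)
      calc E i k * ev k * E j k = E i k * (√(ev k) * √(ev k)) * E j k := by rw [this]
        _ = _ := by ring
    simp only [h2]
    symm
    rw [← Finset.sum_filter_of_ne (p := fun k => ev k ≠ 0)]
    · exact (Finset.sum_subtype (Finset.univ.filter fun k => ev k ≠ 0) (by simp)
        (fun k => E i k * √(ev k) * (E j k * √(ev k)))).symm
    · intro k _ hk h0
      exact hk (by simp [h0])
  · ext k l
    have h1 : ∑ i, E i (e.symm k) * E i (e.symm l) = (1 : Matrix (Fin N) (Fin N) ℝ) (e.symm k) (e.symm l) := by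
      rw [← hEE, Matrix.mul_apply]; rfl
    have h2 : √(ev (e.symm k)) ≠ 0 := by
      have := (e.symm k).2
      exact (Real.sqrt_pos.2 (lt_of_le_of_ne (hpos _) this.symm)).ne'
    simp only [Matrix.mul_apply, Matrix.of_apply]
    calc _ = (∑ i, E i (e.symm k) * E i (e.symm l)) * (√(ev (e.symm l)) / √(ev (e.symm k))) := by
            rw [Finset.sum_mul]; refine Finset.sum_congr rfl fun i _ => by ring
      _ = _ := by
        rw [h1]
        by_cases hkl : k = l
        · subst hkl; simp [h2]
        · have : ((e.symm k : Fin N)) ≠ e.symm l := fun h => hkl (e.symm.injective (Subtype.ext h))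
          simp [hkl, this]

lemma exists_eps {r : ℕ} (A : Matrix (Fin r) (Fin r) ℝ) (hA : Aᵀ = A) :
    ∃ ε : ℝ, 0 < ε ∧ (1 + ε • A).PosSemidef ∧ (1 + (-ε) • A).PosSemidef := by
  set c : ℝ := ∑ k, ∑ l, |A k l| with hc
  have hc0 : 0 ≤ c := Finset.sum_nonneg fun _ _ => Finset.sum_nonneg fun _ _ => abs_nonneg _
  have key : ∀ x : Fin r → ℝ, |x ⬝ᵥ A *ᵥ x| ≤ c * (x ⬝ᵥ x) := by
    intro x
    have hx : ∀ k, x k ^ 2 ≤ x ⬝ᵥ x := fun k => by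
      have := Finset.single_le_sum (f := fun k => x k * x k) (fun i _ => mul_self_nonneg _)
        (Finset.mem_univ k)
      simpa [dotProduct, sq] using this
    have : x ⬝ᵥ A *ᵥ x = ∑ k, ∑ l, x k * (A k l * x l) := by
      simp [dotProduct, Matrix.mulVec, Finset.mul_sum]
    rw [this, hc, Finset.sum_mul]
    refine (Finset.abs_sum_le_sum_abs _ _).trans (Finset.sum_le_sum fun k _ => ?_)
    rw [Finset.sum_mul]
    refine (Finset.abs_sum_le_sum_abs _ _).trans (Finset.sum_le_sum fun l _ => ?_)
    have h2 : |x k * x l| ≤ x ⬝ᵥ x := by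
      rw [abs_le]; constructor <;> nlinarith [hx k, hx l, sq_nonneg (x k + x l), sq_nonneg (x k - x l)]
    calc |x k * (A k l * x l)| = |A k l| * |x k * x l| := by rw [← abs_mul]; ring_nf
      _ ≤ _ := mul_le_mul_of_nonneg_left h2 (abs_nonneg _)
  have main : ∀ t : ℝ, |t| ≤ 1 / (c + 1) → (1 + t • A).PosSemidef := by
    intro t ht
    refine Matrix.PosSemidef.of_dotProduct_mulVec_nonneg ?_ fun x => ?_
    · rw [Matrix.IsHermitian, Matrix.conjTranspose_eq_transpose_of_trivial]
      simp [hA]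
    · have hxx : 0 ≤ x ⬝ᵥ x := Finset.sum_nonneg fun i _ => mul_self_nonneg _
      have h1 : |t * (x ⬝ᵥ A *ᵥ x)| ≤ x ⬝ᵥ x := by
        rw [abs_mul]
        calc _ ≤ 1 / (c + 1) * (c * (x ⬝ᵥ x)) :=
              mul_le_mul ht (key x) (abs_nonneg _) (by positivity)
          _ = c / (c + 1) * (x ⬝ᵥ x) := by ring
          _ ≤ 1 * (x ⬝ᵥ x) := by
            refine mul_le_mul_of_nonneg_right ?_ hxx
            rw [div_le_one (by positivity)]; linarith
          _ = _ := one_mul _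
      have h2 : star x ⬝ᵥ (1 + t • A) *ᵥ x = x ⬝ᵥ x + t * (x ⬝ᵥ A *ᵥ x) := by
        simp [Matrix.add_mulVec, Matrix.smul_mulVec, dotProduct_add, dotProduct_smul]
      rw [h2]
      linarith [(abs_le.1 h1).1]
  refine ⟨1 / (c + 1), by positivity, main _ ?_, main _ ?_⟩
  · rw [abs_of_pos (by positivity)]
  · rw [abs_neg, abs_of_pos (by positivity)]

lemma exists_back {N : ℕ} {F : Set (Matrix (Fin N) (Fin N) ℝ)}
    {G G' : Matrix (Fin N) (Fin N) ℝ} (hG : G ∈ intrinsicInterior ℝ F) (hG' : G' ∈ F) :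
    ∃ ε : ℝ, 0 < ε ∧ G - ε • (G' - G) ∈ F := by
  obtain ⟨y, hy, rfl⟩ := mem_intrinsicInterior.1 hG
  have hmem : ∀ t : ℝ, AffineMap.lineMap (y : Matrix (Fin N) (Fin N) ℝ) G' t ∈ affineSpan ℝ F :=
    fun t => AffineMap.lineMap_mem t y.2 (subset_affineSpan ℝ F hG')
  have hlin : ∀ t : ℝ, AffineMap.lineMap (y : Matrix (Fin N) (Fin N) ℝ) G' t
      = t • (G' - y) + y := fun t => by
    simp [AffineMap.lineMap_apply]
  let φ : ℝ → affineSpan ℝ F := fun t => ⟨AffineMap.lineMap (y : Matrix (Fin N) (Fin N) ℝ) G' t, hmem t⟩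
  have hφ : Continuous φ := by
    refine Continuous.subtype_mk ?_ _
    refine Continuous.congr (f := fun t : ℝ => t • (G' - (y : Matrix (Fin N) (Fin N) ℝ)) + y)
      (by fun_prop) fun t => (hlin t).symm
  have h0 : φ 0 = y := by ext1; simp [φ]
  have hev : ∀ᶠ t in nhds (0 : ℝ), φ t ∈ interior ((↑) ⁻¹' F : Set (affineSpan ℝ F)) :=
    hφ.continuousAt.eventually_mem (by rw [h0]; exact isOpen_interior.mem_nhds hy)
  obtain ⟨δ, hδ, h⟩ := Metric.eventually_nhds_iff.1 hev
  refine ⟨δ / 2, by positivity, ?_⟩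
  have h1 := interior_subset (h (y := -(δ / 2)) (by
    rw [Real.dist_eq, sub_zero, abs_neg, abs_of_pos (by positivity)]; linarith))
  have h2 : AffineMap.lineMap (y : Matrix (Fin N) (Fin N) ℝ) G' (-(δ / 2)) ∈ F := h1
  rw [hlin] at h2
  convert h2 using 1
  rw [neg_smul]; abel

/-- If `G = B Bᵀ`, and `G - ε (G' - G)` is positive semidefinite, then `G'` factors through `B`. -/
lemma factor_of_psd {N r : ℕ} {G G' : Matrix (Fin N) (Fin N) ℝ}
    {B : Matrix (Fin N) (Fin r) ℝ} {L : Matrix (Fin r) (Fin N) ℝ}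
    (hGB : G = B * Bᵀ) (hLB : L * B = 1) (hG' : G'.PosSemidef) {ε : ℝ} (hε : 0 < ε)
    (hb : (G - ε • (G' - G)).PosSemidef) : G' = B * (L * G' * Lᵀ) * Bᵀ := by
  have hker : ∀ x, G *ᵥ x = 0 → G' *ᵥ x = 0 := by
    intro x hx
    have h1 := hb.dotProduct_mulVec_nonneg x
    have h2 := hG'.dotProduct_mulVec_nonneg x
    rw [← hG'.dotProduct_mulVec_zero_iff]
    have h3 : (G - ε • (G' - G)) *ᵥ x = - ε • (G' *ᵥ x) := by
      simp [Matrix.sub_mulVec, Matrix.smul_mulVec, hx]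
    rw [h3, dotProduct_smul, smul_eq_mul] at h1
    nlinarith
  have hBL : Bᵀ * Lᵀ = 1 := by rw [← Matrix.transpose_mul, hLB, Matrix.transpose_one]
  have hz : G * (1 - Lᵀ * Bᵀ) = 0 := by
    rw [hGB, Matrix.mul_sub, Matrix.mul_one, Matrix.mul_assoc, ← Matrix.mul_assoc Bᵀ, hBL,
      Matrix.one_mul, sub_self]
  have hz' : G' * (1 - Lᵀ * Bᵀ) = 0 := by
    refine Matrix.ext_of_mulVec_single fun j => ?_
    rw [← Matrix.mulVec_mulVec, hker, Matrix.zero_mulVec]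
    rw [Matrix.mulVec_mulVec, hz, Matrix.zero_mulVec]
  have e1 : G' = G' * (Lᵀ * Bᵀ) := by
    rw [Matrix.mul_sub, Matrix.mul_one, sub_eq_zero] at hz'; exact hz'
  have hs : G'ᵀ = G' := by
    have := hG'.1
    rwa [Matrix.IsHermitian, Matrix.conjTranspose_eq_transpose_of_trivial] at this
  have e2 : G' = (B * L) * G' := by
    have := congrArg Matrix.transpose e1
    simpa [Matrix.transpose_mul, hs] using this
  calc G' = (B * L) * G' := e2
    _ = (B * L) * (G' * (Lᵀ * Bᵀ)) := by rw [← e1]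
    _ = _ := by simp only [Matrix.mul_assoc]

/-- The Gram map. -/
noncomputable def mu {n N : ℕ} (m : Fin N → MvPolynomial (Fin n) ℝ) :
    Matrix (Fin N) (Fin N) ℝ →ₗ[ℝ] MvPolynomial (Fin n) ℝ where
  toFun G := ∑ i, ∑ j, MvPolynomial.C (G i j) * (m i * m j)
  map_add' G H := by
    simp [Finset.sum_add_distrib, add_mul]
  map_smul' c G := by
    simp [Finset.mul_sum, MvPolynomial.smul_eq_C_mul, mul_assoc]

/-- Parametrization of the symmetric matrices factoring through `B`. -/
noncomputable def psi {N r : ℕ} (B : Matrix (Fin N) (Fin r) ℝ) :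
    (Sym2 (Fin r) → ℝ) →ₗ[ℝ] Matrix (Fin N) (Fin N) ℝ where
  toFun a := B * (Matrix.of fun k l => a s(k, l)) * Bᵀ
  map_add' a b := by
    rw [← Matrix.add_mul, ← Matrix.mul_add]; rfl
  map_smul' c a := by
    rw [RingHom.id_apply, ← Matrix.smul_mul, ← Matrix.mul_smul]; rfl

lemma psi_inj {N r : ℕ} {B : Matrix (Fin N) (Fin r) ℝ} {L : Matrix (Fin r) (Fin N) ℝ}
    (hLB : L * B = 1) : Function.Injective (psi B) := by
  intro a b h
  have hBL : Bᵀ * Lᵀ = 1 := by rw [← Matrix.transpose_mul, hLB, Matrix.transpose_one]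
  have key : ∀ A : Matrix (Fin r) (Fin r) ℝ, L * (B * A * Bᵀ) * Lᵀ = A := fun A => by
    calc L * (B * A * Bᵀ) * Lᵀ = (L * B) * A * (Bᵀ * Lᵀ) := by simp only [Matrix.mul_assoc]
      _ = A := by rw [hLB, hBL, Matrix.one_mul, Matrix.mul_one]
  have h' : (Matrix.of fun k l => a s(k, l)) = (Matrix.of fun k l => b s(k, l)) := by
    rw [← key (Matrix.of fun k l => a s(k, l)), ← key (Matrix.of fun k l => b s(k, l))]
    exact congrArg (fun X => L * X * Lᵀ) h
  ext z
  induction z using Sym2.ind with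
  | _ k l => exact congrFun (congrFun h' k) l

lemma psi_of_symm {N r : ℕ} (B : Matrix (Fin N) (Fin r) ℝ) (A : Matrix (Fin r) (Fin r) ℝ)
    (hA : Aᵀ = A) : ∃ a, psi B a = B * A * Bᵀ := by
  refine ⟨Sym2.lift ⟨fun k l => A k l, fun k l => congrFun (congrFun hA l) k⟩, ?_⟩
  simp only [psi, LinearMap.coe_mk, AddHom.coe_mk, Sym2.lift_mk]
  rfl

lemma sum_factor {R : Type*} [CommRing R] {N r : ℕ} (b : Fin N → Fin r → R)
    (a : Fin r → Fin r → R) (m : Fin N → R) :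
    ∑ i, ∑ j, (∑ l, (∑ k, b i k * a k l) * b j l) * (m i * m j)
      = ∑ k, ∑ l, a k l * ((∑ i, b i k * m i) * (∑ j, b j l * m j)) := by
  trans ∑ i, ∑ j, ∑ k, ∑ l, a k l * (b i k * m i * (b j l * m j))
  · refine Finset.sum_congr rfl fun i _ => Finset.sum_congr rfl fun j _ => ?_
    rw [Finset.sum_comm, Finset.sum_mul]
    refine Finset.sum_congr rfl fun l _ => ?_
    rw [Finset.sum_mul, Finset.sum_mul]
    refine Finset.sum_congr rfl fun k _ => ?_
    ring
  · calc _ = ∑ i, ∑ k, ∑ l, ∑ j, a k l * (b i k * m i * (b j l * m j)) := by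
          refine Finset.sum_congr rfl fun i _ => ?_
          rw [Finset.sum_comm]
          refine Finset.sum_congr rfl fun k _ => ?_
          rw [Finset.sum_comm]
      _ = ∑ k, ∑ l, ∑ i, ∑ j, a k l * (b i k * m i * (b j l * m j)) := by
          rw [Finset.sum_comm]
          refine Finset.sum_congr rfl fun k _ => ?_
          rw [Finset.sum_comm]
      _ = _ := by
          refine Finset.sum_congr rfl fun k _ => Finset.sum_congr rfl fun l _ => ?_
          rw [Finset.sum_mul_sum]
          simp only [Finset.mul_sum]

lemma mu_factor {n N r : ℕ} (m : Fin N → MvPolynomial (Fin n) ℝ)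
    (B : Matrix (Fin N) (Fin r) ℝ) (A : Matrix (Fin r) (Fin r) ℝ) :
    mu m (B * A * Bᵀ) = ∑ k, ∑ l, A k l • ((∑ i, B i k • m i) * (∑ j, B j l • m j)) := by
  simp only [mu, LinearMap.coe_mk, AddHom.coe_mk, Matrix.mul_apply, Matrix.transpose_apply,
    MvPolynomial.smul_eq_C_mul, map_sum, map_mul]
  exact sum_factor (fun i k => C (B i k)) (fun k l => C (A k l)) m

lemma linInd {n d N : ℕ} (m : Fin N → MvPolynomial (Fin n) ℝ)
    (hm_inj : Function.Injective m)
    (hm_mono : ∀ k, ∃ s : Fin n →₀ ℕ,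
      (s.sum fun _ e => e) = d ∧ m k = monomial s (1 : ℝ)) : LinearIndependent ℝ m := by
  choose s hs hms using hm_mono
  have hsi : Function.Injective s := fun i j h => hm_inj (by rw [hms, hms, h])
  have := (MvPolynomial.basisMonomials (Fin n) ℝ).linearIndependent.comp s hsi
  have h : m = (MvPolynomial.basisMonomials (Fin n) ℝ) ∘ s := by
    funext k
    simp [hms]
  rw [h]
  exact this

lemma linInd_u {n N r : ℕ} {m : Fin N → MvPolynomial (Fin n) ℝ} (hm : LinearIndependent ℝ m)
    {B : Matrix (Fin N) (Fin r) ℝ} {L : Matrix (Fin r) (Fin N) ℝ} (hLB : L * B = 1) :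
    LinearIndependent ℝ (fun k => ∑ i, B i k • m i) := by
  rw [Fintype.linearIndependent_iff] at hm ⊢
  intro g hg
  have h1 : ∑ i, (B *ᵥ g) i • m i = 0 := by
    rw [← hg]
    simp only [Matrix.mulVec, dotProduct, Finset.sum_smul, Finset.smul_sum, smul_smul]
    rw [Finset.sum_comm]
    simp only [mul_comm]
  have h2 : B *ᵥ g = 0 := funext (hm _ h1)
  have h3 : g = 0 := by
    rw [← Matrix.one_mulVec g, ← hLB, ← Matrix.mulVec_mulVec, h2, Matrix.mulVec_zero]
  exact fun i => congrFun h3 i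

lemma U_eq {n N r : ℕ} (m : Fin N → MvPolynomial (Fin n) ℝ) {G : Matrix (Fin N) (Fin N) ℝ}
    {B : Matrix (Fin N) (Fin r) ℝ} {L : Matrix (Fin r) (Fin N) ℝ}
    (hGB : G = B * Bᵀ) (hLB : L * B = 1) :
    Submodule.span ℝ {p | ∃ c : Fin N → ℝ, p = ∑ i, ∑ j, (G i j * c j) • m i}
      = Submodule.span ℝ (Set.range fun k => ∑ i, B i k • m i) := by
  have hBL : Bᵀ * Lᵀ = 1 := by rw [← Matrix.transpose_mul, hLB, Matrix.transpose_one]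
  have hp : ∀ c : Fin N → ℝ, ∑ i, ∑ j, (G i j * c j) • m i = ∑ i, (G *ᵥ c) i • m i := fun c => by
    simp only [Matrix.mulVec, dotProduct, Finset.sum_smul]
  have hq : ∀ g : Fin r → ℝ, ∑ i, (B *ᵥ g) i • m i = ∑ k, g k • ∑ i, B i k • m i := fun g => by
    simp only [Matrix.mulVec, dotProduct, Finset.sum_smul, Finset.smul_sum, smul_smul]
    rw [Finset.sum_comm]
    simp only [mul_comm]
  apply le_antisymm
  · rw [Submodule.span_le]
    rintro p ⟨c, rfl⟩
    rw [hp, hGB, ← Matrix.mulVec_mulVec, hq]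
    exact Submodule.sum_mem _ fun k _ => Submodule.smul_mem _ _ (Submodule.subset_span ⟨k, rfl⟩)
  · rw [Submodule.span_le]
    rintro p ⟨k, rfl⟩
    refine Submodule.subset_span ⟨Lᵀ *ᵥ Pi.single k 1, ?_⟩
    rw [hp, hGB, Matrix.mulVec_mulVec, Matrix.mul_assoc, hBL, Matrix.mul_one]
    simp

lemma U2_eq {n r : ℕ} (u : Fin r → MvPolynomial (Fin n) ℝ)
    (Φ : (Sym2 (Fin r) → ℝ) →ₗ[ℝ] MvPolynomial (Fin n) ℝ)
    (hΦ : ∀ a, Φ a = ∑ k, ∑ l, a s(k, l) • (u k * u l))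
    (U : Submodule ℝ (MvPolynomial (Fin n) ℝ)) (hU : U = Submodule.span ℝ (Set.range u)) :
    Submodule.span ℝ {r | ∃ p ∈ U, ∃ q ∈ U, r = p * q} = LinearMap.range Φ := by
  have hu : ∀ k, u k ∈ U := fun k => by rw [hU]; exact Submodule.subset_span ⟨k, rfl⟩
  apply le_antisymm
  · rw [Submodule.span_le]
    rintro _ ⟨p, hp, q, hq, rfl⟩
    rw [hU, Submodule.mem_span_range_iff_exists_fun] at hp hq
    obtain ⟨a, rfl⟩ := hp
    obtain ⟨b, rfl⟩ := hq
    refine ⟨Sym2.lift ⟨fun k l => (a k * b l + a l * b k) / 2, fun k l => by ring⟩, ?_⟩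
    rw [hΦ]
    simp only [Sym2.lift_mk]
    have e1 : (∑ k, a k • u k) * (∑ l, b l • u l) = ∑ k, ∑ l, (a k * b l) • (u k * u l) := by
      rw [Finset.sum_mul_sum]
      refine Finset.sum_congr rfl fun k _ => Finset.sum_congr rfl fun l _ => ?_
      rw [smul_mul_smul_comm]
    have e2 : ∑ k, ∑ l, (a l * b k) • (u k * u l) = ∑ k, ∑ l, (a k * b l) • (u k * u l) := by
      rw [Finset.sum_comm]
      refine Finset.sum_congr rfl fun k _ => Finset.sum_congr rfl fun l _ => ?_
      rw [mul_comm (u l)]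
    have e3 : ∑ k, ∑ l, ((a k * b l + a l * b k) / 2) • (u k * u l)
        = (1 / 2 : ℝ) • (∑ k, ∑ l, (a k * b l) • (u k * u l)
          + ∑ k, ∑ l, (a l * b k) • (u k * u l)) := by
      simp only [← Finset.sum_add_distrib, Finset.smul_sum]
      refine Finset.sum_congr rfl fun k _ => Finset.sum_congr rfl fun l _ => ?_
      rw [← add_smul, smul_smul]
      congr 1
      ring
    rw [e3, e2, e1, ← two_smul ℝ, smul_smul]
    norm_num
  · rintro _ ⟨a, rfl⟩
    rw [hΦ]
    exact Submodule.sum_mem _ fun k _ => Submodule.sum_mem _ fun l _ =>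
      Submodule.smul_mem _ _ (Submodule.subset_span ⟨_, hu k, _, hu l, rfl⟩)

end GramFace

/-- The dimension of a face `F` of the Gram spectrahedron of `f` equals
`dim U (dim U + 1)/2 - dim U²`, where `U` is the image of any relative interior
point `G` of `F`. -/
theorem dim_face_of_gram_spectrahedron
    (n d N : ℕ) (hn : 1 ≤ n) (hd : 1 ≤ d)
    -- `m` enumerates the monomial basis of `ℝ[x₁,…,xₙ]_d`
    (m : Fin N → MvPolynomial (Fin n) ℝ)
    (hm_inj : Function.Injective m)
    (hm_mono : ∀ k, ∃ s : Fin n →₀ ℕ,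
      (s.sum fun _ e => e) = d ∧ m k = monomial s (1 : ℝ))
    (hm_surj : ∀ s : Fin n →₀ ℕ, (s.sum fun _ e => e) = d →
      ∃ k, m k = monomial s (1 : ℝ))
    -- `f` is a form of degree `2d` that is a sum of squares of forms of degree `d`
    (f : MvPolynomial (Fin n) ℝ) (hf : f.IsHomogeneous (2 * d))
    (hsos : ∃ (r : ℕ) (p : Fin r → MvPolynomial (Fin n) ℝ),
      (∀ i, (p i).IsHomogeneous d) ∧ f = ∑ i, p i ^ 2)
    -- the Gram spectrahedron of `f`
    (Gram : Set (Matrix (Fin N) (Fin N) ℝ))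
    (hGram : Gram = {G | G.PosSemidef ∧
      (∑ i, ∑ j, MvPolynomial.C (G i j) * (m i * m j)) = f})
    -- a nonempty face `F` and a relative interior point `G` of `F`
    (F : Set (Matrix (Fin N) (Fin N) ℝ)) (hF : IsFace Gram F) (hFne : F.Nonempty)
    (G : Matrix (Fin N) (Fin N) ℝ) (hG : G ∈ intrinsicInterior ℝ F)
    -- `U` is the image of `G`
    (U : Submodule ℝ (MvPolynomial (Fin n) ℝ))
    (hU : U = Submodule.span ℝ
      {p | ∃ c : Fin N → ℝ, p = ∑ i, ∑ j, (G i j * c j) • m i})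
    -- `U²` is the span of all products of two elements of `U`
    (U2 : Submodule ℝ (MvPolynomial (Fin n) ℝ))
    (hU2 : U2 = Submodule.span ℝ {r | ∃ p ∈ U, ∃ q ∈ U, r = p * q}) :
    Module.finrank ℝ (vectorSpan ℝ F) =
      Module.finrank ℝ U * (Module.finrank ℝ U + 1) / 2 - Module.finrank ℝ U2 := by
  have hFG : ∀ H ∈ F, H.PosSemidef ∧ GramFace.mu m H = f := fun H hH => by
    have := hF.1 hH
    rw [hGram] at this
    exact this
  have hGF : G ∈ F := intrinsicInterior_subset hG
  obtain ⟨r, B, L, hGB, hLB⟩ := GramFace.exists_factor G (hFG G hGF).1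
  have hBL : Bᵀ * Lᵀ = 1 := by rw [← Matrix.transpose_mul, hLB, Matrix.transpose_one]
  set Φ := (GramFace.mu m).comp (GramFace.psi B) with hΦdef
  have hΦ : ∀ a, Φ a = ∑ k, ∑ l, a s(k, l) • ((∑ i, B i k • m i) * (∑ j, B j l • m j)) :=
    fun a => GramFace.mu_factor m B (Matrix.of fun k l => a s(k, l))
  have hU' : U = Submodule.span ℝ (Set.range fun k => ∑ i, B i k • m i) := by
    rw [hU, GramFace.U_eq m hGB hLB]
  have hUr : Module.finrank ℝ U = r := by
    rw [hU', finrank_span_eq_card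
      (GramFace.linInd_u (GramFace.linInd m hm_inj hm_mono) hLB), Fintype.card_fin]
  have hU2' : U2 = LinearMap.range Φ := by
    rw [hU2, GramFace.U2_eq _ Φ hΦ U hU']
  have hV : vectorSpan ℝ F = (LinearMap.ker Φ).map (GramFace.psi B) := by
    apply le_antisymm
    · rw [vectorSpan_eq_span_vsub_set_right ℝ hGF, Submodule.span_le]
      rintro _ ⟨H, hH, rfl⟩
      obtain ⟨ε, hε, hb⟩ := GramFace.exists_back hG hH
      have hfac := GramFace.factor_of_psd hGB hLB (hFG H hH).1 hε (hFG _ hb).1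
      have hs : Hᵀ = H := by
        have := (hFG H hH).1.1
        rwa [Matrix.IsHermitian, Matrix.conjTranspose_eq_transpose_of_trivial] at this
      obtain ⟨a, ha⟩ := GramFace.psi_of_symm B (L * H * Lᵀ - 1) (by
        simp [Matrix.transpose_mul, hs, Matrix.mul_assoc])
      have ha' : GramFace.psi B a = H - G := by
        rw [ha, Matrix.mul_sub, Matrix.sub_mul, ← hfac, Matrix.mul_one, ← hGB]
      refine ⟨a, ?_, ha'⟩
      change Φ a = 0
      rw [hΦdef, LinearMap.comp_apply, ha', map_sub, (hFG H hH).2, (hFG G hGF).2, sub_self]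
    · rintro _ ⟨a, ha, rfl⟩
      have ha0 : GramFace.mu m (GramFace.psi B a) = 0 := ha
      obtain ⟨ε, hε, hp1, hp2⟩ := GramFace.exists_eps (Matrix.of fun k l => a s(k, l)) (by
        ext k l
        simp [Sym2.eq_swap])
      have hmem : ∀ t : ℝ, (1 + t • (Matrix.of fun k l => a s(k, l))).PosSemidef →
          G + t • GramFace.psi B a ∈ Gram := by
        intro t ht
        rw [hGram]
        refine ⟨?_, ?_⟩
        · have := ht.mul_mul_conjTranspose_same B
          rw [Matrix.conjTranspose_eq_transpose_of_trivial, Matrix.mul_add, Matrix.add_mul,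
            Matrix.mul_one, ← hGB, Matrix.mul_smul, Matrix.smul_mul] at this
          exact this
        · change GramFace.mu m (G + t • GramFace.psi B a) = f
          rw [map_add, map_smul, ha0, smul_zero, add_zero, (hFG G hGF).2]
      have hx := (hF.2.2 _ (hmem ε hp1) _ (hmem (-ε) hp2) (1 / 2) (by norm_num) (by norm_num) (by
        convert hGF using 1
        module)).1
      have hd := vsub_mem_vectorSpan ℝ hx hGF
      rw [vsub_eq_sub, add_sub_cancel_left] at hd
      have := Submodule.smul_mem _ ε⁻¹ hd
      rwa [smul_smul, inv_mul_cancel₀ hε.ne', one_smul] at this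
  have hVr : Module.finrank ℝ (vectorSpan ℝ F) = Module.finrank ℝ (LinearMap.ker Φ) := by
    rw [hV]
    exact (Submodule.equivMapOfInjective _ (GramFace.psi_inj hLB) _).symm.finrank_eq
  have hrk := LinearMap.finrank_range_add_finrank_ker Φ
  rw [Module.finrank_fintype_fun_eq_card, Sym2.card, Fintype.card_fin, Nat.choose_two_right,
    ← hU2', ← hVr, Nat.add_sub_cancel, mul_comm] at hrk
  rw [hUr, ← hrk, Nat.add_sub_cancel_left]
end

section
/- Every psd ternary quartic is a sum of three squares of quadratic forms: if f ∈ ℝ[x,y,z] is homogeneous of degree 4 with f(a) ≥ 0 for all a ∈ ℝ³, then there exist homogeneous polynomials p₁, p₂, p₃ ∈ ℝ[x,y,z] of degree 2 with f = p₁² + p₂² + p₃². -/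
open MvPolynomial
open scoped Matrix
set_option linter.unnecessarySeqFocus false

namespace Hilbert3

/-- Coefficients `(x², y², z², xy, xz, yz)` of a quadratic form, evaluated. -/
def ev2 {R : Type*} [CommRing R] (p : Fin 6 → R) (x : Fin 3 → R) : R :=
  p 0 * x 0 ^ 2 + p 1 * x 1 ^ 2 + p 2 * x 2 ^ 2 + p 3 * (x 0 * x 1) + p 4 * (x 0 * x 2)
    + p 5 * (x 1 * x 2)

/-- Complex homogeneous polynomial functions of degree `n` on `ℂ³`. -/
inductive IsForm : ℕ → ((Fin 3 → ℂ) → ℂ) → Prop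
  | const (c : ℂ) : IsForm 0 (fun _ => c)
  | step {n : ℕ} {F : (Fin 3 → ℂ) → ℂ} (l : (Fin 3 → ℂ) →ₗ[ℂ] ℂ) :
      IsForm n F → IsForm (n + 1) (fun v => l v * F v)
  | add {n : ℕ} {F G : (Fin 3 → ℂ) → ℂ} :
      IsForm n F → IsForm n G → IsForm n (fun v => F v + G v)

theorem IsForm.smul {n : ℕ} {F : (Fin 3 → ℂ) → ℂ} (c : ℂ) (h : IsForm n F) :
    IsForm n (fun v => c * F v) := by
  induction h with
  | const d => exact IsForm.const (c * d)
  | step l _ ih =>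
    have := IsForm.step l ih
    convert this using 2
    ring
  | add _ _ ih1 ih2 =>
    have := IsForm.add ih1 ih2
    convert this using 2
    ring

theorem IsForm.zero (n : ℕ) : IsForm n (fun _ => 0) := by
  induction n with
  | zero => exact IsForm.const 0
  | succ n ih => simpa using IsForm.step 0 ih

theorem IsForm.lin (l : (Fin 3 → ℂ) →ₗ[ℂ] ℂ) : IsForm 1 (fun v => l v) := by
  simpa using IsForm.step l (IsForm.const 1)

theorem IsForm.mul {m n : ℕ} {F G : (Fin 3 → ℂ) → ℂ} (hF : IsForm m F) (hG : IsForm n G) :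
    IsForm (m + n) (fun v => F v * G v) := by
  induction hF with
  | const c => simpa using hG.smul c
  | @step k F l _ ih =>
    have := IsForm.step l ih
    rw [show k + 1 + n = k + n + 1 by ring]
    convert this using 2
    ring
  | add _ _ ih1 ih2 =>
    have := IsForm.add ih1 ih2
    convert this using 2
    ring

theorem IsForm.mul' {m n k : ℕ} {F G : (Fin 3 → ℂ) → ℂ} (hF : IsForm m F) (hG : IsForm n G)
    (h : m + n = k) : IsForm k (fun v => F v * G v) := h ▸ hF.mul hG

theorem IsForm.sub {n : ℕ} {F G : (Fin 3 → ℂ) → ℂ} (hF : IsForm n F) (hG : IsForm n G) :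
    IsForm n (fun v => F v - G v) := by
  have := hF.add (hG.smul (-1))
  convert this using 2
  ring

theorem IsForm.comp {n : ℕ} {F : (Fin 3 → ℂ) → ℂ} (hF : IsForm n F)
    (A : (Fin 3 → ℂ) →ₗ[ℂ] (Fin 3 → ℂ)) : IsForm n (fun v => F (A v)) := by
  induction hF with
  | const c => exact IsForm.const c
  | step l _ ih => exact IsForm.step (l.comp A) ih
  | add _ _ ih1 ih2 => exact IsForm.add ih1 ih2

theorem IsForm.hom {n : ℕ} {F : (Fin 3 → ℂ) → ℂ} (hF : IsForm n F) (c : ℂ) (v : Fin 3 → ℂ) :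
    F (c • v) = c ^ n * F v := by
  induction hF with
  | const d => simp
  | step l _ ih => simp only [ih, map_smul, smul_eq_mul]; ring
  | add _ _ ih1 ih2 => simp only [ih1, ih2]; ring

theorem IsForm.pow (l : (Fin 3 → ℂ) →ₗ[ℂ] ℂ) (n : ℕ) : IsForm n (fun v => l v ^ n) := by
  induction n with
  | zero => simpa using IsForm.const 1
  | succ n ih =>
    have := IsForm.step l ih
    convert this using 2
    ring

theorem IsForm.div_aux {n : ℕ} {F : (Fin 3 → ℂ) → ℂ} (hF : IsForm n F)
    (l : (Fin 3 → ℂ) →ₗ[ℂ] ℂ) (e : Fin 3 → ℂ) :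
    ∃ G, (n = 0 → G = fun _ => 0) ∧ (∀ m, n = m + 1 → IsForm m G) ∧
      ∀ v, F v - F (v - l v • e) = l v * G v := by
  induction hF with
  | const c => exact ⟨fun _ => 0, fun _ => rfl, fun m h => by omega, fun v => by simp⟩
  | @step n F k hF ih =>
    obtain ⟨G, h0, h1, h2⟩ := ih
    refine ⟨fun v => k e * F v + (k - k e • l) v * G v, fun h => by omega, fun m hm => ?_, ?_⟩
    · obtain rfl : n = m := by omega
      refine IsForm.add (hF.smul _) ?_
      rcases Nat.eq_zero_or_eq_succ_pred n with h | h
      · subst h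
        rw [h0 rfl]; simpa using IsForm.zero 0
      · rw [h]; exact IsForm.step _ (h1 _ h)
    · intro v
      have := h2 v
      simp only [map_sub, map_smul, smul_eq_mul, LinearMap.sub_apply, LinearMap.smul_apply]
      linear_combination (k v - l v * k e) * this
  | @add n F F' _ _ ih1 ih2 =>
    obtain ⟨G, h0, h1, h2⟩ := ih1
    obtain ⟨G', h0', h1', h2'⟩ := ih2
    refine ⟨fun v => G v + G' v, fun h => by rw [h0 h, h0' h]; simp,
      fun m hm => (h1 m hm).add (h1' m hm), fun v => ?_⟩
    linear_combination h2 v + h2' v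

theorem IsForm.div {n : ℕ} {F : (Fin 3 → ℂ) → ℂ} (hF : IsForm (n + 1) F)
    (l : (Fin 3 → ℂ) →ₗ[ℂ] ℂ) (e : Fin 3 → ℂ) :
    ∃ G, IsForm n G ∧ ∀ v, F v - F (v - l v • e) = l v * G v := by
  obtain ⟨G, _, h1, h2⟩ := hF.div_aux l e
  exact ⟨G, h1 n rfl, h2⟩

theorem isForm_ev2 (p : Fin 6 → ℂ) : IsForm 2 (ev2 p) := by
  let X : Fin 3 → ((Fin 3 → ℂ) →ₗ[ℂ] ℂ) := fun i => LinearMap.proj i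
  have hX : ∀ i j (c : ℂ), IsForm 2 (fun v => c * (X i v * X j v)) := fun i j c =>
    (((IsForm.lin (X i)).mul (IsForm.lin (X j))).smul c)
  have := (((((hX 0 0 (p 0)).add (hX 1 1 (p 1))).add (hX 2 2 (p 2))).add (hX 0 1 (p 3))).add
    (hX 0 2 (p 4))).add (hX 1 2 (p 5))
  convert this using 1
  funext v
  simp only [ev2, X, LinearMap.proj_apply]
  ring

/-- adapted coordinates for a nonzero functional -/
structure Coord (l : (Fin 3 → ℂ) →ₗ[ℂ] ℂ) where
  u : Fin 3 → ℂ
  w : Fin 3 → ℂ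
  e : Fin 3 → ℂ
  s : (Fin 3 → ℂ) →ₗ[ℂ] ℂ
  t : (Fin 3 → ℂ) →ₗ[ℂ] ℂ
  lu : l u = 0
  lw : l w = 0
  le : l e = 1
  su : s u = 1
  sw : s w = 0
  tu : t u = 0
  tw : t w = 1
  dec : ∀ x, x = s x • u + t x • w + l x • e

theorem lin_apply (l : (Fin 3 → ℂ) →ₗ[ℂ] ℂ) (x : Fin 3 → ℂ) :
    l x = x 0 * l (Pi.single 0 1) + x 1 * l (Pi.single 1 1) + x 2 * l (Pi.single 2 1) := by
  have : x = x 0 • Pi.single 0 1 + x 1 • Pi.single 1 1 + x 2 • Pi.single 2 1 := by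
    funext i; fin_cases i <;> simp
  conv_lhs => rw [this]
  simp only [map_add, map_smul, smul_eq_mul]

theorem exists_coord (l : (Fin 3 → ℂ) →ₗ[ℂ] ℂ) (hl : l ≠ 0) : Nonempty (Coord l) := by
  set a := l (Pi.single 0 1) with ha
  set b := l (Pi.single 1 1) with hb
  set c := l (Pi.single 2 1) with hc
  have hx : ∀ x, l x = x 0 * a + x 1 * b + x 2 * c := lin_apply l
  have hne : a ≠ 0 ∨ b ≠ 0 ∨ c ≠ 0 := by
    by_contra! h
    apply hl
    ext1 i
    obtain ⟨h1, h2, h3⟩ := h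
    ext; simp only [LinearMap.comp_apply, LinearMap.zero_apply]
    rw [hx]; simp [h1, h2, h3]
  rcases hne with h | h | h
  · refine ⟨⟨![-b / a, 1, 0], ![-c / a, 0, 1], ![1 / a, 0, 0], LinearMap.proj 1, LinearMap.proj 2,
      ?_, ?_, ?_, ?_, ?_, ?_, ?_, ?_⟩⟩
    any_goals simp [hx, h]
    intro x; funext i; fin_cases i <;> simp <;> field_simp <;> ring
  · refine ⟨⟨![1, -a / b, 0], ![0, -c / b, 1], ![0, 1 / b, 0], LinearMap.proj 0, LinearMap.proj 2,
      ?_, ?_, ?_, ?_, ?_, ?_, ?_, ?_⟩⟩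
    any_goals simp [hx, h]
    intro x; funext i; fin_cases i <;> simp <;> field_simp <;> ring
  · refine ⟨⟨![1, 0, -a / c], ![0, 1, -b / c], ![0, 0, 1 / c], LinearMap.proj 0, LinearMap.proj 1,
      ?_, ?_, ?_, ?_, ?_, ?_, ?_, ?_⟩⟩
    any_goals simp [hx, h]
    intro x; funext i; fin_cases i <;> simp <;> field_simp <;> ring

theorem binary_factor (a b c : ℂ) : ∃ a1 b1 a2 b2 : ℂ, ∀ s t : ℂ,
    a * s ^ 2 + b * s * t + c * t ^ 2 = (a1 * s + b1 * t) * (a2 * s + b2 * t) := by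
  by_cases ha : a = 0
  · exact ⟨0, 1, b, c, fun s t => by rw [ha]; ring⟩
  · obtain ⟨d, hd⟩ := IsAlgClosed.exists_eq_mul_self (b ^ 2 - 4 * a * c)
    refine ⟨a, (b + d) / 2, 1, (b - d) / (2 * a), fun s t => ?_⟩
    field_simp
    linear_combination (-t ^ 2) * hd

theorem ev2_line (p : Fin 6 → ℂ) (u w : Fin 3 → ℂ) : ∃ a1 b1 a2 b2 : ℂ, ∀ s t : ℂ,
    ev2 p (s • u + t • w) = (a1 * s + b1 * t) * (a2 * s + b2 * t) := by
  obtain ⟨a1, b1, a2, b2, h⟩ := binary_factor (ev2 p u) (2 * p 0 * u 0 * w 0 + 2 * p 1 * u 1 * w 1 +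
    2 * p 2 * u 2 * w 2 + p 3 * (u 0 * w 1 + u 1 * w 0) + p 4 * (u 0 * w 2 + u 2 * w 0)
    + p 5 * (u 1 * w 2 + u 2 * w 1)) (ev2 p w)
  refine ⟨a1, b1, a2, b2, fun s t => ?_⟩
  rw [← h]
  simp only [ev2, Pi.add_apply, Pi.smul_apply, smul_eq_mul]
  ring

/-- a nonzero quadratic form has a zero on any line -/
theorem ev2_zero_line (p : Fin 6 → ℂ) {l : (Fin 3 → ℂ) →ₗ[ℂ] ℂ} (C : Coord l) :
    ∃ x, x ≠ 0 ∧ l x = 0 ∧ ev2 p x = 0 := by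
  obtain ⟨a1, b1, a2, b2, h⟩ := ev2_line p C.u C.w
  by_cases hz : a1 = 0 ∧ b1 = 0
  · refine ⟨C.u, fun h0 => ?_, C.lu, ?_⟩
    · have := C.su; rw [h0] at this; simp at this
    · have := h 1 0; simpa [hz.1, hz.2] using this
  · refine ⟨b1 • C.u + (-a1) • C.w, fun h0 => hz ?_, by simp [C.lu, C.lw], ?_⟩
    · have h1 := congrArg C.s h0
      have h2 := congrArg C.t h0
      simp [C.su, C.sw, C.tu, C.tw] at h1 h2
      exact ⟨h2, h1⟩
    · rw [h]; ring

theorem point_lemma {l : (Fin 3 → ℂ) →ₗ[ℂ] ℂ} (C : Coord l) (a b : ℂ) (hab : ¬ (a = 0 ∧ b = 0))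
    {p F : (Fin 3 → ℂ) → ℂ} {n : ℕ} (hp : IsForm 2 p) (hF : IsForm (n + 2) F)
    (hy : p (b • C.u + (-a) • C.w) ≠ 0) :
    ∃ q G, IsForm n q ∧ IsForm (n + 1) G ∧
      ∀ x, l x = 0 → F x = p x * q x + (a * C.s x + b * C.t x) * G x := by
  set y := b • C.u + (-a) • C.w with hyd
  have sy : C.s y = b := by simp [hyd, C.su, C.sw]
  have ty : C.t y = -a := by simp [hyd, C.tu, C.tw]
  -- a functional with k y = 1 and a vector with m e = 1
  obtain ⟨k, e, hk, hle, hme⟩ : ∃ (k : (Fin 3 → ℂ) →ₗ[ℂ] ℂ) (e : Fin 3 → ℂ), k y = 1 ∧ l e = 0 ∧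
      a * C.s e + b * C.t e = 1 := by
    by_cases ha : a = 0
    · have hb : b ≠ 0 := fun hb => hab ⟨ha, hb⟩
      exact ⟨(1 / b) • C.s, (1 / b) • C.w, by simp [sy, hb], by simp [C.lw],
        by simp [C.tw, C.sw, hb]⟩
    · exact ⟨(-1 / a) • C.t, (1 / a) • C.u, by simp [ty, ha], by simp [C.lu],
        by simp [C.tu, C.su, ha]⟩
  let m : (Fin 3 → ℂ) →ₗ[ℂ] ℂ := a • C.s + b • C.t
  have hm : ∀ x, m x = a * C.s x + b * C.t x := fun x => by simp [m]
  let q : (Fin 3 → ℂ) → ℂ := fun v => (F y / p y) * k v ^ n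
  have hq : IsForm n q := (IsForm.pow k n).smul _
  have hD : IsForm (n + 1 + 1) (fun v => F v - p v * q v) :=
    hF.sub (hp.mul' hq (by ring))
  obtain ⟨G, hG, hG2⟩ := hD.div m e
  refine ⟨q, G, hq, hG, fun x hx => ?_⟩
  have h := hG2 x
  -- the projected vector is a multiple of y
  set z := x - m x • e with hz
  have hlz : l z = 0 := by simp [hz, hx, hle]
  have hmz : a * C.s z + b * C.t z = 0 := by
    rw [← hm, hz, map_sub, map_smul, hm e, hme]; simp
  obtain ⟨c, hc⟩ : ∃ c : ℂ, z = c • y := by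
    have hd := C.dec z
    rw [hlz, zero_smul, add_zero] at hd
    by_cases ha : a = 0
    · have hb : b ≠ 0 := fun hb => hab ⟨ha, hb⟩
      have ht : C.t z = 0 := by
        rw [ha] at hmz; simpa [hb] using hmz
      refine ⟨C.s z / b, ?_⟩
      rw [hd, ht, hyd, ha]
      simp [C.su, smul_smul, hb]
    · refine ⟨-C.t z / a, ?_⟩
      have hs : C.s z = -C.t z / a * b := by field_simp; linear_combination hmz
      have ht : C.t z = -C.t z / a * (-a) := by field_simp
      rw [hyd, smul_add, smul_smul, smul_smul, ← hs, ← ht]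
      exact hd
  have hFz : F z - p z * q z = 0 := by
    rw [hc, hF.hom, hp.hom, hq.hom]
    simp only [q, hk]
    field_simp
    ring
  rw [hFz, sub_zero, hm] at h
  linear_combination h

theorem line_lemma {l : (Fin 3 → ℂ) →ₗ[ℂ] ℂ} (C : Coord l) (p2 p3 : Fin 6 → ℂ)
    (h : ∀ x, x ≠ 0 → l x = 0 → ev2 p2 x = 0 → ev2 p3 x ≠ 0) {n : ℕ} {F : (Fin 3 → ℂ) → ℂ}
    (hF : IsForm (n + 3) F) :
    ∃ q2 q3, IsForm (n + 1) q2 ∧ IsForm (n + 1) q3 ∧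
      ∀ x, l x = 0 → F x = ev2 p2 x * q2 x + ev2 p3 x * q3 x := by
  obtain ⟨a1, b1, a2, b2, hf⟩ := ev2_line p2 C.u C.w
  obtain ⟨x0, hx0, hlx0, hpx0⟩ := ev2_zero_line p3 C
  have hfac : ∀ x, l x = 0 →
      ev2 p2 x = (a1 * C.s x + b1 * C.t x) * (a2 * C.s x + b2 * C.t x) := by
    intro x hx
    have := C.dec x
    rw [hx, zero_smul, add_zero] at this
    conv_lhs => rw [this]
    exact hf _ _
  have h1 : ¬ (a1 = 0 ∧ b1 = 0) := fun hz => h x0 hx0 hlx0 (by rw [hfac _ hlx0, hz.1, hz.2]; ring) hpx0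
  have h2 : ¬ (a2 = 0 ∧ b2 = 0) := fun hz => h x0 hx0 hlx0 (by rw [hfac _ hlx0, hz.1, hz.2]; ring) hpx0
  have key : ∀ a b : ℂ, ¬ (a = 0 ∧ b = 0) →
      ev2 p2 (b • C.u + (-a) • C.w) = 0 → ev2 p3 (b • C.u + (-a) • C.w) ≠ 0 := by
    intro a b hab h0
    refine h _ (fun h0 => hab ?_) (by simp [C.lu, C.lw]) h0
    have h1 := congrArg C.s h0
    have h2 := congrArg C.t h0
    simp [C.su, C.sw, C.tu, C.tw] at h1 h2
    exact ⟨h2, h1⟩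
  obtain ⟨q, G, hq, hG, e1⟩ := point_lemma C a1 b1 h1 (isForm_ev2 p3) (n := n + 1) hF
    (key _ _ h1 (by rw [hf]; ring))
  obtain ⟨q', H, hq', hH, e2⟩ := point_lemma C a2 b2 h2 (isForm_ev2 p3) (n := n) hG
    (key _ _ h2 (by rw [hf]; ring))
  refine ⟨H, fun v => q v + (a1 • C.s + b1 • C.t) v * q' v, hH, hq.add (IsForm.step _ hq'), ?_⟩
  intro x hx
  rw [e1 x hx, e2 x hx, hfac x hx]
  simp
  ring

/-- Gram matrix (doubled). -/
def gram (p : Fin 6 → ℂ) : Matrix (Fin 3) (Fin 3) ℂ :=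
  !![2 * p 0, p 3, p 4; p 3, 2 * p 1, p 5; p 4, p 5, 2 * p 2]

theorem singular_factor (p : Fin 6 → ℂ) (v : Fin 3 → ℂ) (hv : v ≠ 0) (h : gram p *ᵥ v = 0) :
    ∃ l m : (Fin 3 → ℂ) →ₗ[ℂ] ℂ, ∀ x, ev2 p x = l x * m x := by
  obtain ⟨i, hi⟩ : ∃ i, v i ≠ 0 := by
    by_contra! h0; exact hv (funext h0)
  let k : (Fin 3 → ℂ) →ₗ[ℂ] ℂ := (1 / v i) • LinearMap.proj i
  have hkv : k v = 1 := by simp [k, hi]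
  have hk : k ≠ 0 := fun h0 => by rw [h0] at hkv; simp at hkv
  obtain ⟨C⟩ := exists_coord k hk
  obtain ⟨a1, b1, a2, b2, hf⟩ := ev2_line p C.u C.w
  have h0 := congrFun h 0
  have h1 := congrFun h 1
  have h2 := congrFun h 2
  simp [gram, Matrix.mulVec, dotProduct, Fin.sum_univ_three] at h0 h1 h2
  have hinv : ∀ x, ev2 p x = ev2 p (x - k x • v) := by
    intro x
    simp only [ev2, Pi.sub_apply, Pi.smul_apply, smul_eq_mul]
    linear_combination (k x * x 0 - k x ^ 2 * v 0 / 2) * h0 + (k x * x 1 - k x ^ 2 * v 1 / 2) * h1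
      + (k x * x 2 - k x ^ 2 * v 2 / 2) * h2
  let π : (Fin 3 → ℂ) →ₗ[ℂ] (Fin 3 → ℂ) := LinearMap.id - k.smulRight v
  have hπ : ∀ x, π x = x - k x • v := fun x => by simp [π]
  refine ⟨(a1 • C.s + b1 • C.t) ∘ₗ π, (a2 • C.s + b2 • C.t) ∘ₗ π, fun x => ?_⟩
  rw [hinv, ← hπ]
  have hd := C.dec (π x)
  have : k (π x) = 0 := by rw [hπ]; simp [hkv]
  rw [this, zero_smul, add_zero] at hd
  conv_lhs => rw [hd]
  rw [hf]
  simp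

theorem pencil (p q : Fin 6 → ℂ) : ∃ v, v ≠ 0 ∧
    (gram q *ᵥ v = 0 ∨ ∃ μ : ℂ, gram (p - μ • q) *ᵥ v = 0) := by
  by_cases hq : (gram q).det = 0
  · obtain ⟨v, hv, h⟩ := Matrix.exists_mulVec_eq_zero_iff.2 hq
    exact ⟨v, hv, Or.inl h⟩
  · have hu : IsUnit (gram q).det := isUnit_iff_ne_zero.2 hq
    obtain ⟨μ, hμ⟩ := Module.End.exists_eigenvalue (Matrix.toLin' ((gram q)⁻¹ * gram p))
    obtain ⟨v, hv⟩ := hμ.exists_hasEigenvector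
    refine ⟨v, hv.2, Or.inr ⟨μ, ?_⟩⟩
    have h1 := hv.apply_eq_smul
    rw [Matrix.toLin'_apply] at h1
    have h2 : gram p *ᵥ v = μ • (gram q *ᵥ v) := by
      have := congrArg (fun w => gram q *ᵥ w) h1
      simp only [Matrix.mulVec_mulVec] at this
      rw [← mul_assoc, Matrix.mul_nonsing_inv _ hu, one_mul, Matrix.mulVec_smul] at this
      exact this
    have h3 : gram (p - μ • q) = gram p - μ • gram q := by
      ext i j; fin_cases i <;> fin_cases j <;> simp [gram] <;> ring
    rw [h3, Matrix.sub_mulVec, Matrix.smul_mulVec, h2, sub_self]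

theorem exists_coord_any : ∃ l : (Fin 3 → ℂ) →ₗ[ℂ] ℂ, l ≠ 0 := by
  refine ⟨LinearMap.proj 0, fun h => ?_⟩
  have := congrArg (fun l => l (fun _ => (1 : ℂ))) h
  simp at this

/-- Core case: first form splits. -/
theorem common_zero_of_split (p q : Fin 6 → ℂ) (l m : (Fin 3 → ℂ) →ₗ[ℂ] ℂ)
    (h : ∀ x, ev2 p x = l x * m x) : ∃ x, x ≠ 0 ∧ ev2 p x = 0 ∧ ev2 q x = 0 := by
  by_cases hl : l = 0
  · obtain ⟨k, hk⟩ := exists_coord_any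
    obtain ⟨C⟩ := exists_coord k hk
    obtain ⟨x, hx, _, h2⟩ := ev2_zero_line q C
    exact ⟨x, hx, by rw [h, hl]; simp, h2⟩
  · obtain ⟨C⟩ := exists_coord l hl
    obtain ⟨x, hx, h1, h2⟩ := ev2_zero_line q C
    exact ⟨x, hx, by rw [h, h1, zero_mul], h2⟩

theorem ev2_sub_smul (p q : Fin 6 → ℂ) (μ : ℂ) (x : Fin 3 → ℂ) :
    ev2 (p - μ • q) x = ev2 p x - μ * ev2 q x := by
  simp [ev2]; ring

theorem common_zero_two (p q : Fin 6 → ℂ) : ∃ x, x ≠ 0 ∧ ev2 p x = 0 ∧ ev2 q x = 0 := by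
  obtain ⟨v, hv, h | ⟨μ, h⟩⟩ := pencil p q
  · obtain ⟨l, m, hlm⟩ := singular_factor q v hv h
    obtain ⟨x, hx, h1, h2⟩ := common_zero_of_split q p l m hlm
    exact ⟨x, hx, h2, h1⟩
  · obtain ⟨l, m, hlm⟩ := singular_factor _ v hv h
    obtain ⟨x, hx, h1, h2⟩ := common_zero_of_split _ q l m hlm
    refine ⟨x, hx, ?_, h2⟩
    rw [ev2_sub_smul, h2] at h1
    simpa using h1

theorem macaulay_split (p1 p2 p3 : Fin 6 → ℂ) (l m : (Fin 3 → ℂ) →ₗ[ℂ] ℂ)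
    (hlm : ∀ x, ev2 p1 x = l x * m x)
    (h : ∀ x, x ≠ 0 → ev2 p1 x = 0 → ev2 p2 x = 0 → ev2 p3 x ≠ 0) {F : (Fin 3 → ℂ) → ℂ}
    (hF : IsForm 4 F) :
    ∃ q1 q2 q3, IsForm 2 q1 ∧ IsForm 2 q2 ∧ IsForm 2 q3 ∧
      ∀ x, F x = ev2 p1 x * q1 x + ev2 p2 x * q2 x + ev2 p3 x * q3 x := by
  obtain ⟨x0, hx0, h20, h30⟩ := common_zero_two p2 p3
  have hl : l ≠ 0 := fun h0 => h x0 hx0 (by rw [hlm, h0]; simp) h20 h30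
  have hm : m ≠ 0 := fun h0 => h x0 hx0 (by rw [hlm, h0]; simp) h20 h30
  obtain ⟨C⟩ := exists_coord l hl
  obtain ⟨D⟩ := exists_coord m hm
  obtain ⟨q2, q3, hq2, hq3, e1⟩ := line_lemma C p2 p3
    (fun x hx hlx => h x hx (by rw [hlm, hlx, zero_mul])) (n := 1) hF
  have hF1 : IsForm (3 + 1) (fun v => F v - (ev2 p2 v * q2 v + ev2 p3 v * q3 v)) :=
    hF.sub (((isForm_ev2 p2).mul' hq2 rfl).add ((isForm_ev2 p3).mul' hq3 rfl))
  obtain ⟨G, hG, e2⟩ := hF1.div l C.e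
  obtain ⟨r2, r3, hr2, hr3, e3⟩ := line_lemma D p2 p3
    (fun x hx hlx => h x hx (by rw [hlm, hlx, mul_zero])) (n := 0) hG
  have hG1 : IsForm (2 + 1) (fun v => G v - (ev2 p2 v * r2 v + ev2 p3 v * r3 v)) :=
    hG.sub (((isForm_ev2 p2).mul' hr2 rfl).add ((isForm_ev2 p3).mul' hr3 rfl))
  obtain ⟨H, hH, e4⟩ := hG1.div m D.e
  refine ⟨H, fun v => q2 v + l v * r2 v, fun v => q3 v + l v * r3 v, hH,
    hq2.add (IsForm.step l hr2), hq3.add (IsForm.step l hr3), fun x => ?_⟩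
  have a1 := e1 (x - l x • C.e) (by simp [C.le])
  have a2 := e2 x
  have a3 := e3 (x - m x • D.e) (by simp [D.le])
  have a4 := e4 x
  rw [hlm]
  linear_combination a1 + a2 + l x * a3 + l x * a4

theorem macaulay (p1 p2 p3 : Fin 6 → ℂ)
    (h : ∀ x, x ≠ 0 → ev2 p1 x = 0 → ev2 p2 x = 0 → ev2 p3 x ≠ 0) {F : (Fin 3 → ℂ) → ℂ}
    (hF : IsForm 4 F) :
    ∃ q1 q2 q3, IsForm 2 q1 ∧ IsForm 2 q2 ∧ IsForm 2 q3 ∧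
      ∀ x, F x = ev2 p1 x * q1 x + ev2 p2 x * q2 x + ev2 p3 x * q3 x := by
  obtain ⟨v, hv, hs | ⟨μ, hs⟩⟩ := pencil p1 p2
  · obtain ⟨l, m, hlm⟩ := singular_factor p2 v hv hs
    obtain ⟨q1, q2, q3, h1, h2, h3, e⟩ := macaulay_split p2 p1 p3 l m hlm
      (fun x hx a b => h x hx b a) hF
    exact ⟨q2, q1, q3, h2, h1, h3, fun x => by rw [e]; ring⟩
  · obtain ⟨l, m, hlm⟩ := singular_factor _ v hv hs
    obtain ⟨q1, q2, q3, h1, h2, h3, e⟩ := macaulay_split _ p2 p3 l m hlm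
      (fun x hx a b => h x hx (by rw [ev2_sub_smul, b] at a; simpa using a) b) hF
    refine ⟨q1, fun v => q2 v - μ * q1 v, q3, h1, h2.sub (h1.smul μ), h3, fun x => ?_⟩
    rw [e, ev2_sub_smul]; ring

/-- Quartic form from its 15 coefficients. -/
def ev4 {R : Type*} [CommRing R] (c : Fin 15 → R) (x : Fin 3 → R) : R :=
  c 0 * x 0 ^ 4 + c 1 * x 1 ^ 4 + c 2 * x 2 ^ 4 + c 3 * (x 0 ^ 3 * x 1) + c 4 * (x 0 ^ 3 * x 2)
  + c 5 * (x 1 ^ 3 * x 0) + c 6 * (x 1 ^ 3 * x 2) + c 7 * (x 2 ^ 3 * x 0) + c 8 * (x 2 ^ 3 * x 1)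
  + c 9 * (x 0 ^ 2 * x 1 ^ 2) + c 10 * (x 0 ^ 2 * x 2 ^ 2) + c 11 * (x 1 ^ 2 * x 2 ^ 2)
  + c 12 * (x 0 ^ 2 * x 1 * x 2) + c 13 * (x 0 * x 1 ^ 2 * x 2) + c 14 * (x 0 * x 1 * x 2 ^ 2)

/-- Product of two quadratic forms, on coefficients. -/
def mul2 (p q : Fin 6 → ℝ) : Fin 15 → ℝ :=
  ![p 0 * q 0, p 1 * q 1, p 2 * q 2, p 0 * q 3 + p 3 * q 0, p 0 * q 4 + p 4 * q 0,
    p 1 * q 3 + p 3 * q 1, p 1 * q 5 + p 5 * q 1, p 2 * q 4 + p 4 * q 2, p 2 * q 5 + p 5 * q 2,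
    p 0 * q 1 + p 1 * q 0 + p 3 * q 3, p 0 * q 2 + p 2 * q 0 + p 4 * q 4,
    p 1 * q 2 + p 2 * q 1 + p 5 * q 5, p 0 * q 5 + p 5 * q 0 + p 3 * q 4 + p 4 * q 3,
    p 1 * q 4 + p 4 * q 1 + p 3 * q 5 + p 5 * q 3, p 2 * q 3 + p 3 * q 2 + p 4 * q 5 + p 5 * q 4]

theorem ev4_mul2 (p q : Fin 6 → ℝ) (x : Fin 3 → ℝ) : ev4 (mul2 p q) x = ev2 p x * ev2 q x := by
  simp [ev4, mul2, ev2]; ring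

theorem ev4_add (c d : Fin 15 → ℝ) (x : Fin 3 → ℝ) : ev4 (c + d) x = ev4 c x + ev4 d x := by
  simp [ev4]; ring

theorem ev4_smul (r : ℝ) (c : Fin 15 → ℝ) (x : Fin 3 → ℝ) : ev4 (r • c) x = r * ev4 c x := by
  simp [ev4]; ring

theorem ev4_zero_inj (c : Fin 15 → ℝ) (h : ∀ x, ev4 c x = 0) : c = 0 := by
  have a1 := h ![1, 0, 0]
  have a2 := h ![0, 1, 0]
  have a3 := h ![0, 0, 1]
  have b1 := h ![1, 1, 0]
  have b2 := h ![1, -1, 0]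
  have b3 := h ![1, 2, 0]
  have c1 := h ![1, 0, 1]
  have c2 := h ![1, 0, -1]
  have c3 := h ![1, 0, 2]
  have d1 := h ![0, 1, 1]
  have d2 := h ![0, 1, -1]
  have d3 := h ![0, 1, 2]
  have e1 := h ![1, 1, 1]
  have e2 := h ![1, 1, -1]
  have e3 := h ![1, -1, 1]
  simp only [ev4, Matrix.cons_val] at a1 a2 a3 b1 b2 b3 c1 c2 c3 d1 d2 d3 e1 e2 e3
  ring_nf at a1 a2 a3 b1 b2 b3 c1 c2 c3 d1 d2 d3 e1 e2 e3
  have f3 : c 3 = 0 := by linarith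
  have f4 : c 4 = 0 := by linarith
  have f5 : c 5 = 0 := by linarith
  have f6 : c 6 = 0 := by linarith
  have f7 : c 7 = 0 := by linarith
  have f8 : c 8 = 0 := by linarith
  have f9 : c 9 = 0 := by linarith
  have f10 : c 10 = 0 := by linarith
  have f11 : c 11 = 0 := by linarith
  have f12 : c 12 = 0 := by linarith
  have f13 : c 13 = 0 := by linarith
  have f14 : c 14 = 0 := by linarith
  funext i
  fin_cases i <;> simp <;> assumption

theorem ev4_inj (c d : Fin 15 → ℝ) (h : ∀ x, ev4 c x = ev4 d x) : c = d := by
  have : c - d = 0 := ev4_zero_inj _ fun x => by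
    have h1 := h x
    have : ev4 (c - d) x = ev4 c x - ev4 d x := by simp [ev4]; ring
    rw [this, h1, sub_self]
  exact sub_eq_zero.1 this

theorem IsForm.exists_ev2 {n : ℕ} {F : (Fin 3 → ℂ) → ℂ} (h : IsForm n F) :
    (n = 0 → ∃ c : ℂ, ∀ x, F x = c) ∧ (n = 1 → ∃ l : (Fin 3 → ℂ) →ₗ[ℂ] ℂ, ∀ x, F x = l x) ∧
    (n = 2 → ∃ p, ∀ x, F x = ev2 p x) := by
  induction h with
  | const c => exact ⟨fun _ => ⟨c, fun _ => rfl⟩, by omega, by omega⟩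
  | @step n F l h ih =>
    obtain ⟨h0, h1, -⟩ := ih
    refine ⟨by omega, fun hn => ?_, fun hn => ?_⟩
    · obtain ⟨c, hc⟩ := h0 (by omega)
      exact ⟨c • l, fun x => by simp [hc, mul_comm]⟩
    · obtain ⟨m, hm⟩ := h1 (by omega)
      refine ⟨![l (Pi.single 0 1) * m (Pi.single 0 1), l (Pi.single 1 1) * m (Pi.single 1 1),
        l (Pi.single 2 1) * m (Pi.single 2 1),
        l (Pi.single 0 1) * m (Pi.single 1 1) + l (Pi.single 1 1) * m (Pi.single 0 1),
        l (Pi.single 0 1) * m (Pi.single 2 1) + l (Pi.single 2 1) * m (Pi.single 0 1),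
        l (Pi.single 1 1) * m (Pi.single 2 1) + l (Pi.single 2 1) * m (Pi.single 1 1)],
        fun x => ?_⟩
      beta_reduce
      rw [hm, lin_apply l x, lin_apply m x]
      simp only [ev2, Matrix.cons_val]
      ring
  | @add n F G _ _ ih1 ih2 =>
    obtain ⟨h0, h1, h2⟩ := ih1
    obtain ⟨k0, k1, k2⟩ := ih2
    refine ⟨fun hn => ?_, fun hn => ?_, fun hn => ?_⟩
    · obtain ⟨c, hc⟩ := h0 hn
      obtain ⟨d, hd⟩ := k0 hn
      exact ⟨c + d, fun x => by beta_reduce; rw [hc, hd]⟩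
    · obtain ⟨c, hc⟩ := h1 hn
      obtain ⟨d, hd⟩ := k1 hn
      exact ⟨c + d, fun x => by beta_reduce; rw [hc, hd]; rfl⟩
    · obtain ⟨c, hc⟩ := h2 hn
      obtain ⟨d, hd⟩ := k2 hn
      exact ⟨c + d, fun x => by beta_reduce; rw [hc, hd]; simp only [ev2, Pi.add_apply]; ring⟩

theorem isForm_ev4 (c : Fin 15 → ℂ) : IsForm 4 (ev4 c) := by
  let X : Fin 3 → ((Fin 3 → ℂ) →ₗ[ℂ] ℂ) := fun i => LinearMap.proj i
  have hX : ∀ i j k l (c : ℂ), IsForm 4 (fun v => c * (X i v * (X j v * (X k v * X l v)))) :=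
    fun i j k l c => (IsForm.step _ (IsForm.step _ (IsForm.step _ (IsForm.lin (X l))))).smul c
  have := ((((((((((((((hX 0 0 0 0 (c 0)).add (hX 1 1 1 1 (c 1))).add (hX 2 2 2 2 (c 2))).add
    (hX 0 0 0 1 (c 3))).add (hX 0 0 0 2 (c 4))).add (hX 1 1 1 0 (c 5))).add
    (hX 1 1 1 2 (c 6))).add (hX 2 2 2 0 (c 7))).add (hX 2 2 2 1 (c 8))).add
    (hX 0 0 1 1 (c 9))).add (hX 0 0 2 2 (c 10))).add (hX 1 1 2 2 (c 11))).add
    (hX 0 0 1 2 (c 12))).add (hX 0 1 1 2 (c 13))).add (hX 0 1 2 2 (c 14))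
  convert this using 1
  funext v
  simp only [ev4, X, LinearMap.proj_apply]
  ring

/-- complexified coefficients -/
def cx {n : ℕ} (p : Fin n → ℝ) : Fin n → ℂ := fun i => (p i : ℂ)

theorem real_surj (p1 p2 p3 : Fin 6 → ℝ)
    (h : ∀ x : Fin 3 → ℂ, x ≠ 0 → ev2 (cx p1) x = 0 → ev2 (cx p2) x = 0 → ev2 (cx p3) x ≠ 0)
    (F : Fin 15 → ℝ) :
    ∃ q1 q2 q3, F = mul2 p1 q1 + mul2 p2 q2 + mul2 p3 q3 := by
  obtain ⟨q1, q2, q3, h1, h2, h3, e⟩ := macaulay _ _ _ h (isForm_ev4 (cx F))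
  obtain ⟨r1, e1⟩ := h1.exists_ev2.2.2 rfl
  obtain ⟨r2, e2⟩ := h2.exists_ev2.2.2 rfl
  obtain ⟨r3, e3⟩ := h3.exists_ev2.2.2 rfl
  refine ⟨fun i => (r1 i).re, fun i => (r2 i).re, fun i => (r3 i).re, ev4_inj _ _ fun x => ?_⟩
  have hx := e (cx x)
  rw [e1, e2, e3] at hx
  have c4 : ev4 (cx F) (cx x) = ((ev4 F x : ℝ) : ℂ) := by simp [ev4, cx]
  have c2 : ∀ p : Fin 6 → ℝ, ev2 (cx p) (cx x) = ((ev2 p x : ℝ) : ℂ) := fun p => by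
    simp [ev2, cx]
  have cr : ∀ r : Fin 6 → ℂ, (ev2 r (cx x)).re = ev2 (fun i => (r i).re) x := fun r => by
    simp only [ev2, cx, ← Complex.ofReal_pow, ← Complex.ofReal_mul, Complex.add_re,
      Complex.re_mul_ofReal]
  rw [c4, c2, c2, c2] at hx
  have := congrArg Complex.re hx
  simp only [Complex.add_re, Complex.re_ofReal_mul, Complex.ofReal_re, cr] at this
  rw [ev4_add, ev4_add, ev4_mul2, ev4_mul2, ev4_mul2, this]

/-! ### The bad set -/

def badl (a : Fin 14 → ℝ) : Fin 6 → ℝ :=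
  ![a 0 ^ 2, a 1 ^ 2, 1, 2 * a 0 * a 1, 2 * a 0, 2 * a 1]
def badq (a : Fin 14 → ℝ) : Fin 6 → ℝ := ![1, a 3, 0, a 2, 0, 0]
def badm (a : Fin 14 → ℝ) : Fin 6 → ℝ :=
  ![a 0 * a 5, a 1 * a 6, 0, a 0 * a 6 + a 1 * a 5, a 5, a 6]
def badQ (a : Fin 14 → ℝ) : Fin 6 → ℝ := ![a 7, a 8, a 9, a 10, a 11, a 12]

/-- the quartics `l² Q + l q L + c q²` -/
def bad (a : Fin 14 → ℝ) : Fin 15 → ℝ :=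
  mul2 (badl a) (badQ a) + mul2 (badq a) (badm a) + a 4 • mul2 (badq a) (badq a)

/-- cyclic permutation of variables -/
def cyc (c : Fin 15 → ℝ) : Fin 15 → ℝ :=
  ![c 2, c 0, c 1, c 7, c 8, c 4, c 3, c 6, c 5, c 10, c 11, c 9, c 14, c 12, c 13]

theorem ev4_cyc (c : Fin 15 → ℝ) (x : Fin 3 → ℝ) : ev4 (cyc c) x = ev4 c ![x 1, x 2, x 0] := by
  simp [ev4, cyc]; ring

def unc (p : Fin 6 → ℝ) : Fin 6 → ℝ := ![p 1, p 2, p 0, p 5, p 3, p 4]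

theorem ev2_unc (p : Fin 6 → ℝ) (x : Fin 3 → ℝ) : ev2 (unc p) ![x 1, x 2, x 0] = ev2 p x := by
  simp [ev2, unc]; ring

theorem ev2_unc_cx (p : Fin 6 → ℝ) (x : Fin 3 → ℂ) :
    ev2 (cx (unc p)) ![x 1, x 2, x 0] = ev2 (cx p) x := by
  simp [ev2, unc, cx]; ring

def phi (p : Fin 3 → Fin 6 → ℝ) : Fin 15 → ℝ :=
  mul2 (p 0) (p 0) + mul2 (p 1) (p 1) + mul2 (p 2) (p 2)

theorem ev4_phi (p : Fin 3 → Fin 6 → ℝ) (x : Fin 3 → ℝ) :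
    ev4 (phi p) x = ev2 (p 0) x ^ 2 + ev2 (p 1) x ^ 2 + ev2 (p 2) x ^ 2 := by
  simp only [phi, ev4_add, ev4_mul2]; ring

theorem phi_unc (p : Fin 3 → Fin 6 → ℝ) : phi p = cyc (phi (fun i => unc (p i))) := by
  apply ev4_inj
  intro x
  rw [ev4_cyc, ev4_phi, ev4_phi, ev2_unc, ev2_unc, ev2_unc]

theorem ev2_cx_re_im (p : Fin 6 → ℝ) (w : Fin 3 → ℂ) (h : ev2 (cx p) w = 0) :
    (p 0 * ((w 0).re ^ 2 - (w 0).im ^ 2) + p 1 * ((w 1).re ^ 2 - (w 1).im ^ 2)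
      + p 2 * ((w 2).re ^ 2 - (w 2).im ^ 2) + p 3 * ((w 0).re * (w 1).re - (w 0).im * (w 1).im)
      + p 4 * ((w 0).re * (w 2).re - (w 0).im * (w 2).im)
      + p 5 * ((w 1).re * (w 2).re - (w 1).im * (w 2).im) = 0) ∧
    (p 0 * (2 * (w 0).re * (w 0).im) + p 1 * (2 * (w 1).re * (w 1).im)
      + p 2 * (2 * (w 2).re * (w 2).im) + p 3 * ((w 0).re * (w 1).im + (w 0).im * (w 1).re)
      + p 4 * ((w 0).re * (w 2).im + (w 0).im * (w 2).re)
      + p 5 * ((w 1).re * (w 2).im + (w 1).im * (w 2).re) = 0) := by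
  have h1 := congrArg Complex.re h
  have h2 := congrArg Complex.im h
  simp only [ev2, cx, Complex.add_re, Complex.add_im,
    Complex.ofReal_re, Complex.ofReal_im, pow_two, Complex.mul_re, Complex.mul_im, Complex.zero_re, Complex.zero_im] at h1 h2
  constructor
  · linear_combination h1
  · linear_combination h2

theorem chart_aux (p : Fin 6 → ℝ) (u v : Fin 3 → ℝ) (al be : ℝ)
    (hD : u 0 * v 1 - u 1 * v 0 ≠ 0)
    (hu : u 2 = -al * u 0 - be * u 1) (hv : v 2 = -al * v 0 - be * v 1)
    (h1 : p 0 * (u 0 ^ 2 - v 0 ^ 2) + p 1 * (u 1 ^ 2 - v 1 ^ 2)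
      + p 2 * (u 2 ^ 2 - v 2 ^ 2) + p 3 * (u 0 * u 1 - v 0 * v 1)
      + p 4 * (u 0 * u 2 - v 0 * v 2) + p 5 * (u 1 * u 2 - v 1 * v 2) = 0)
    (h2 : p 0 * (2 * u 0 * v 0) + p 1 * (2 * u 1 * v 1)
      + p 2 * (2 * u 2 * v 2) + p 3 * (u 0 * v 1 + v 0 * u 1)
      + p 4 * (u 0 * v 2 + v 0 * u 2) + p 5 * (u 1 * v 2 + v 1 * u 2) = 0) :
    ∀ x : Fin 3 → ℝ, ev2 p x = (al * x 0 + be * x 1 + x 2) *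
        ((p 4 - p 2 * al) * x 0 + (p 5 - p 2 * be) * x 1 + p 2 * x 2)
      + (p 0 + p 2 * al ^ 2 - p 4 * al) * (x 0 ^ 2
        + (-2 * (u 0 * u 1 + v 0 * v 1) / (u 1 ^ 2 + v 1 ^ 2)) * (x 0 * x 1)
        + ((u 0 ^ 2 + v 0 ^ 2) / (u 1 ^ 2 + v 1 ^ 2)) * x 1 ^ 2) := by
  have hN : u 1 ^ 2 + v 1 ^ 2 ≠ 0 := by
    intro h0
    have a : u 1 = 0 := by nlinarith [sq_nonneg (u 1), sq_nonneg (v 1)]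
    have b : v 1 = 0 := by nlinarith [sq_nonneg (u 1), sq_nonneg (v 1)]
    apply hD; rw [a, b]; ring
  set A := p 0 + p 2 * al ^ 2 - p 4 * al with hA
  set B := p 3 + 2 * p 2 * al * be - p 4 * be - p 5 * al with hB
  set C := p 1 + p 2 * be ^ 2 - p 5 * be with hC
  have e1 : A * (u 0 ^ 2 - v 0 ^ 2) + B * (u 0 * u 1 - v 0 * v 1) + C * (u 1 ^ 2 - v 1 ^ 2) = 0 := by
    rw [hu, hv] at h1; rw [hA, hB, hC]; linear_combination h1
  have e2 : A * (2 * u 0 * v 0) + B * (u 0 * v 1 + v 0 * u 1) + C * (2 * u 1 * v 1) = 0 := by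
    rw [hu, hv] at h2; rw [hA, hB, hC]; linear_combination h2
  have b1 : B * (u 1 ^ 2 + v 1 ^ 2) = A * (-2 * (u 0 * u 1 + v 0 * v 1)) := by
    have : (u 0 * v 1 - u 1 * v 0) *
        (B * (u 1 ^ 2 + v 1 ^ 2) - A * (-2 * (u 0 * u 1 + v 0 * v 1))) = 0 := by
      linear_combination (-(u 1 ^ 2 - v 1 ^ 2)) * e2 + (2 * u 1 * v 1) * e1
    rcases mul_eq_zero.1 this with h | h
    · exact absurd h hD
    · linarith
  have c1 : C * (u 1 ^ 2 + v 1 ^ 2) = A * (u 0 ^ 2 + v 0 ^ 2) := by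
    have : (u 1 ^ 2 + v 1 ^ 2) * (C * (u 1 ^ 2 + v 1 ^ 2) - A * (u 0 ^ 2 + v 0 ^ 2)) = 0 := by
      linear_combination (u 1 ^ 2 - v 1 ^ 2) * e1 + (2 * u 1 * v 1) * e2
        - (u 0 * u 1 + v 0 * v 1) * b1
    rcases mul_eq_zero.1 this with h | h
    · exact absurd h hN
    · linarith
  have b2 : A * (-2 * (u 0 * u 1 + v 0 * v 1) / (u 1 ^ 2 + v 1 ^ 2)) = B := by
    field_simp; linear_combination -b1
  have c2 : A * ((u 0 ^ 2 + v 0 ^ 2) / (u 1 ^ 2 + v 1 ^ 2)) = C := by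
    field_simp; linear_combination -c1
  intro x
  have : A * (x 0 ^ 2
        + (-2 * (u 0 * u 1 + v 0 * v 1) / (u 1 ^ 2 + v 1 ^ 2)) * (x 0 * x 1)
        + ((u 0 ^ 2 + v 0 ^ 2) / (u 1 ^ 2 + v 1 ^ 2)) * x 1 ^ 2)
      = A * x 0 ^ 2 + B * (x 0 * x 1) + C * x 1 ^ 2 := by
    linear_combination (x 0 * x 1) * b2 + x 1 ^ 2 * c2
  rw [this, hA, hB, hC, ev2]
  ring

theorem chart_lemma (p : Fin 3 → Fin 6 → ℝ) (w : Fin 3 → ℂ)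
    (hw : ∀ i, ev2 (cx (p i)) w = 0)
    (hD : (w 0).re * (w 1).im - (w 1).re * (w 0).im ≠ 0) : ∃ a, phi p = bad a := by
  set u : Fin 3 → ℝ := fun i => (w i).re with hu
  set v : Fin 3 → ℝ := fun i => (w i).im with hv
  have hD' : u 0 * v 1 - u 1 * v 0 ≠ 0 := hD
  -- Cramer
  obtain ⟨al, be, h1, h2⟩ : ∃ al be : ℝ, u 2 = -al * u 0 - be * u 1 ∧ v 2 = -al * v 0 - be * v 1 := by
    refine ⟨(u 1 * v 2 - u 2 * v 1) / (u 0 * v 1 - u 1 * v 0),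
      (u 2 * v 0 - u 0 * v 2) / (u 0 * v 1 - u 1 * v 0), ?_, ?_⟩
    · linear_combination (-u 2) * (div_self hD')
    · linear_combination (-v 2) * (div_self hD')
  have key := fun i => chart_aux (p i) u v al be hD' h1 h2 (ev2_cx_re_im _ _ (hw i)).1
    (ev2_cx_re_im _ _ (hw i)).2
  set s := (-2 * (u 0 * u 1 + v 0 * v 1) / (u 1 ^ 2 + v 1 ^ 2))
  set t := ((u 0 ^ 2 + v 0 ^ 2) / (u 1 ^ 2 + v 1 ^ 2))
  let A : Fin 3 → ℝ := fun i => p i 0 + p i 2 * al ^ 2 - p i 4 * al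
  let L0 : Fin 3 → ℝ := fun i => p i 4 - p i 2 * al
  let L1 : Fin 3 → ℝ := fun i => p i 5 - p i 2 * be
  let L2 : Fin 3 → ℝ := fun i => p i 2
  have key' : ∀ i x, ev2 (p i) x = (al * x 0 + be * x 1 + x 2) *
      (L0 i * x 0 + L1 i * x 1 + L2 i * x 2) + A i * (x 0 ^ 2 + s * (x 0 * x 1) + t * x 1 ^ 2) := key
  clear_value A L0 L1 L2 s t
  let M0 := 2 * (A 0 * L0 0 + A 1 * L0 1 + A 2 * L0 2)
  let M1 := 2 * (A 0 * L1 0 + A 1 * L1 1 + A 2 * L1 2)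
  let M2 := 2 * (A 0 * L2 0 + A 1 * L2 1 + A 2 * L2 2)
  refine ⟨![al, be, s, t, A 0 ^ 2 + A 1 ^ 2 + A 2 ^ 2, M0 - M2 * al, M1 - M2 * be,
    L0 0 ^ 2 + L0 1 ^ 2 + L0 2 ^ 2 + M2, L1 0 ^ 2 + L1 1 ^ 2 + L1 2 ^ 2 + M2 * t,
    L2 0 ^ 2 + L2 1 ^ 2 + L2 2 ^ 2,
    2 * (L0 0 * L1 0 + L0 1 * L1 1 + L0 2 * L1 2) + M2 * s,
    2 * (L0 0 * L2 0 + L0 1 * L2 1 + L0 2 * L2 2),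
    2 * (L1 0 * L2 0 + L1 1 * L2 1 + L1 2 * L2 2), 0], ev4_inj _ _ fun x => ?_⟩
  rw [ev4_phi, key', key', key', bad, ev4_add, ev4_add, ev4_smul, ev4_mul2, ev4_mul2, ev4_mul2]
  simp only [ev2, badl, badq, badm, badQ, Matrix.cons_val, M0, M1, M2]
  ring

theorem real_zero_of_dep (p : Fin 6 → ℝ) (w : Fin 3 → ℂ) (h : ev2 (cx p) w = 0) (y : Fin 3 → ℝ)
    (c d : ℝ) (hcd : ¬ (c = 0 ∧ d = 0)) (h1 : ∀ i, (w i).re = c * y i)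
    (h2 : ∀ i, (w i).im = d * y i) : ev2 p y = 0 := by
  obtain ⟨a, b⟩ := ev2_cx_re_im _ _ h
  simp only [h1, h2] at a b
  have a' : (c ^ 2 - d ^ 2) * ev2 p y = 0 := by rw [ev2]; linear_combination a
  have b' : (c * d) * ev2 p y = 0 := by rw [ev2]; linear_combination b / 2
  by_contra h0
  have a2 := (mul_eq_zero.1 a').resolve_right h0
  have b2 := (mul_eq_zero.1 b').resolve_right h0
  apply hcd
  rcases mul_eq_zero.1 b2 with h | h
  · rw [h] at a2; exact ⟨h, by nlinarith⟩
  · rw [h] at a2; exact ⟨by nlinarith, h⟩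

theorem exists_minor (w : Fin 3 → ℂ) (hw : w ≠ 0)
    (m1 : (w 0).re * (w 1).im - (w 1).re * (w 0).im = 0)
    (m2 : (w 1).re * (w 2).im - (w 2).re * (w 1).im = 0)
    (m3 : (w 2).re * (w 0).im - (w 0).re * (w 2).im = 0) :
    ∃ (y : Fin 3 → ℝ) (c d : ℝ), y ≠ 0 ∧ ¬ (c = 0 ∧ d = 0) ∧ (∀ i, (w i).re = c * y i) ∧
      ∀ i, (w i).im = d * y i := by
  have hall : ∀ i j, (w i).re * (w j).im = (w j).re * (w i).im := by
    intro i j; fin_cases i <;> fin_cases j <;> simp <;> linarith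
  by_cases hr : ∃ i, (w i).re ≠ 0
  · obtain ⟨i, hi⟩ := hr
    refine ⟨fun j => (w j).re, 1, (w i).im / (w i).re, fun h => hi (congrFun h i), by simp,
      by simp, fun j => ?_⟩
    field_simp
    linarith [hall i j]
  · push Not at hr
    refine ⟨fun j => (w j).im, 0, 1, fun h => hw ?_, by simp, by simpa using hr, by simp⟩
    funext i
    exact Complex.ext (hr i) (congrFun h i)

theorem bad_of_common_zero (p : Fin 3 → Fin 6 → ℝ) (w : Fin 3 → ℂ) (hw0 : w ≠ 0)
    (hw : ∀ i, ev2 (cx (p i)) w = 0) (hpos : ∀ x, x ≠ 0 → 0 < ev4 (phi p) x) :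
    ∃ a, phi p = bad a ∨ phi p = cyc (bad a) ∨ phi p = cyc (cyc (bad a)) := by
  by_cases m1 : (w 0).re * (w 1).im - (w 1).re * (w 0).im = 0
  swap
  · obtain ⟨a, ha⟩ := chart_lemma p w hw m1
    exact ⟨a, Or.inl ha⟩
  by_cases m2 : (w 1).re * (w 2).im - (w 2).re * (w 1).im = 0
  swap
  · obtain ⟨a, ha⟩ := chart_lemma (fun i => unc (p i)) ![w 1, w 2, w 0]
      (fun i => by rw [ev2_unc_cx]; exact hw i) m2
    exact ⟨a, Or.inr (Or.inl (by rw [phi_unc, ha]))⟩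
  by_cases m3 : (w 2).re * (w 0).im - (w 0).re * (w 2).im = 0
  swap
  · obtain ⟨a, ha⟩ := chart_lemma (fun i => unc (unc (p i))) ![w 2, w 0, w 1]
      (fun i => by
        have := ev2_unc_cx (unc (p i)) ![w 1, w 2, w 0]
        exact this.trans ((ev2_unc_cx (p i) w).trans (hw i))) m3
    exact ⟨a, Or.inr (Or.inr (by rw [phi_unc, phi_unc, ha]))⟩
  obtain ⟨y, c, d, hy, hcd, h1, h2⟩ := exists_minor w hw0 m1 m2 m3
  have h := hpos y hy
  rw [ev4_phi] at h
  simp only [real_zero_of_dep _ _ (hw _) y c d hcd h1 h2] at h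
  norm_num at h

/-! ### Topology -/

theorem phi_contDiff : ContDiff ℝ 1 phi := by
  rw [contDiff_pi]
  intro i
  fin_cases i <;> simp [phi, mul2] <;> fun_prop

theorem phi_line (p h : Fin 3 → Fin 6 → ℝ) (t : ℝ) :
    phi (p + t • h) = phi p + t • ((2 : ℝ) • (mul2 (p 0) (h 0) + mul2 (p 1) (h 1)
      + mul2 (p 2) (h 2))) + t ^ 2 • phi h := by
  have hl : ∀ (a b : Fin 6 → ℝ) (x : Fin 3 → ℝ), ev2 (a + t • b) x = ev2 a x + t * ev2 b x := by
    intro a b x; simp [ev2]; ring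
  apply ev4_inj
  intro x
  simp only [ev4_add, ev4_smul, ev4_phi, ev4_mul2, Pi.add_apply, Pi.smul_apply, hl]
  ring

theorem phi_open (p : Fin 3 → Fin 6 → ℝ)
    (h : ∀ x : Fin 3 → ℂ, x ≠ 0 → ¬ ∀ i, ev2 (cx (p i)) x = 0) :
    Set.range phi ∈ nhds (phi p) := by
  have hs : HasStrictFDerivAt phi (fderiv ℝ phi p) p :=
    phi_contDiff.contDiffAt.hasStrictFDerivAt (by norm_num)
  have hd : ∀ k, fderiv ℝ phi p k = (2 : ℝ) • (mul2 (p 0) (k 0) + mul2 (p 1) (k 1)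
      + mul2 (p 2) (k 2)) := by
    intro k
    have h1 := hs.hasFDerivAt.hasLineDerivAt k
    rw [HasLineDerivAt] at h1
    simp only [phi_line] at h1
    set D := (2 : ℝ) • (mul2 (p 0) (k 0) + mul2 (p 1) (k 1) + mul2 (p 2) (k 2))
    have h2 : HasDerivAt (fun t : ℝ => phi p + t • D + t ^ 2 • phi k) D 0 := by
      have a := ((hasDerivAt_id (0 : ℝ)).smul_const D).const_add (phi p)
      have b := (hasDerivAt_pow 2 (0 : ℝ)).smul_const (phi k)
      have c := a.add b
      simp at c
      exact c
    exact h1.unique h2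
  have hsurj : (fderiv ℝ phi p).range = ⊤ := by
    rw [LinearMap.range_eq_top]
    intro F
    obtain ⟨q1, q2, q3, e⟩ := real_surj (p 0) (p 1) (p 2) (fun x hx a b c => h x hx (fun i => by
      fin_cases i <;> assumption)) ((1 / 2 : ℝ) • F)
    refine ⟨![q1, q2, q3], ?_⟩
    have := hd ![q1, q2, q3]
    simp only [Matrix.cons_val] at this
    rw [← e] at this
    simpa using this
  rw [← hs.map_nhds_eq_of_surj hsurj]
  exact Filter.range_mem_map

theorem phi_bound (p : Fin 3 → Fin 6 → ℝ) (i : Fin 3) (j : Fin 6) :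
    p i j ^ 2 ≤ phi p 0 + phi p 1 + phi p 2 + (phi p 9 + phi p 0 + phi p 1)
      + (phi p 10 + phi p 0 + phi p 2) + (phi p 11 + phi p 1 + phi p 2) := by
  have key : ∑ i, ∑ j, p i j ^ 2 ≤ phi p 0 + phi p 1 + phi p 2 + (phi p 9 + phi p 0 + phi p 1)
      + (phi p 10 + phi p 0 + phi p 2) + (phi p 11 + phi p 1 + phi p 2) := by
    simp only [Fin.sum_univ_three, Fin.sum_univ_six, phi, mul2, Pi.add_apply, Matrix.cons_val]
    linarith [sq_nonneg (p 0 0 + p 0 1), sq_nonneg (p 0 0 + p 0 2), sq_nonneg (p 0 1 + p 0 2),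
      sq_nonneg (p 1 0 + p 1 1), sq_nonneg (p 1 0 + p 1 2), sq_nonneg (p 1 1 + p 1 2),
      sq_nonneg (p 2 0 + p 2 1), sq_nonneg (p 2 0 + p 2 2), sq_nonneg (p 2 1 + p 2 2)]
  refine le_trans ?_ key
  calc p i j ^ 2 ≤ ∑ j, p i j ^ 2 :=
        Finset.single_le_sum (f := fun j => p i j ^ 2) (fun _ _ => sq_nonneg _) (Finset.mem_univ j)
    _ ≤ _ := Finset.single_le_sum (f := fun i => ∑ j, p i j ^ 2)
        (fun _ _ => Finset.sum_nonneg fun _ _ => sq_nonneg _) (Finset.mem_univ i)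

theorem phi_bound_norm (p : Fin 3 → Fin 6 → ℝ) : ‖p‖ ≤ 12 * ‖phi p‖ + 1 := by
  have hn : ∀ k, phi p k ≤ ‖phi p‖ := fun k => (le_abs_self _).trans (norm_le_pi_norm (phi p) k)
  have h0 : 0 ≤ ‖phi p‖ := norm_nonneg _
  rw [pi_norm_le_iff_of_nonneg (by positivity)]
  intro i
  rw [pi_norm_le_iff_of_nonneg (by positivity)]
  intro j
  rw [Real.norm_eq_abs]
  apply abs_le_of_sq_le_sq _ (by positivity)
  have := phi_bound p i j
  nlinarith [hn 0, hn 1, hn 2, hn 9, hn 10, hn 11]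

theorem phi_closed : IsClosed (Set.range phi) := by
  apply IsSeqClosed.isClosed
  intro f g hf hg
  choose p hp using hf
  obtain ⟨R, hR⟩ := (Metric.isBounded_range_of_tendsto f hg).exists_norm_le
  have hb : ∀ n, p n ∈ Metric.closedBall (0 : Fin 3 → Fin 6 → ℝ) (12 * R + 1) := by
    intro n
    rw [mem_closedBall_zero_iff]
    have := phi_bound_norm (p n)
    rw [hp] at this
    linarith [hR (f n) ⟨n, rfl⟩]
  obtain ⟨q, -, k, hk, hq⟩ := (isCompact_closedBall _ _).tendsto_subseq hb
  refine ⟨q, ?_⟩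
  have h1 := (phi_contDiff.continuous.tendsto q).comp hq
  have h2 := hg.comp hk.tendsto_atTop
  refine tendsto_nhds_unique h1 ?_
  convert h2 using 1
  funext n
  simp [hp]

theorem bad_contDiff : ContDiff ℝ 1 bad := by
  rw [contDiff_pi]
  intro i
  fin_cases i <;> simp [bad, mul2, badl, badq, badm, badQ] <;> fun_prop

theorem cyc_contDiff : ContDiff ℝ 1 cyc := by
  rw [contDiff_pi]
  intro i
  fin_cases i <;> simp [cyc] <;> fun_prop

theorem bad_smul (r s : ℝ) (a : Fin 14 → ℝ) : ∃ a', r • bad a = bad a' ∧ a' 13 = s := by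
  refine ⟨![a 0, a 1, a 2, a 3, r * a 4, r * a 5, r * a 6, r * a 7, r * a 8, r * a 9, r * a 10,
    r * a 11, r * a 12, s], ?_, rfl⟩
  funext i
  fin_cases i <;> simp [bad, mul2, badl, badq, badm, badQ] <;> ring

theorem cyc_smul (r : ℝ) (c : Fin 15 → ℝ) : cyc (r • c) = r • cyc c := by
  funext i
  fin_cases i <;> simp [cyc]

def badSet (f : Fin 15 → ℝ) : Set (Fin 15 → ℝ) :=
  (Set.range fun a => bad a + a 13 • f) ∪ (Set.range fun a => cyc (bad a) + a 13 • f) ∪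
    Set.range fun a => cyc (cyc (bad a)) + a 13 • f

theorem badSet_dense (f : Fin 15 → ℝ) : Dense (badSet f)ᶜ := by
  apply dense_compl_of_dimH_lt_finrank
  have hlin : ContDiff ℝ 1 (fun a : Fin 14 → ℝ => a 13 • f) := by fun_prop
  have h1 := (bad_contDiff.add hlin).dimH_range_le
  have h2 := ((cyc_contDiff.comp bad_contDiff).add hlin).dimH_range_le
  have h3 := ((cyc_contDiff.comp (cyc_contDiff.comp bad_contDiff)).add hlin).dimH_range_le
  have h : dimH (badSet f) ≤ (Module.finrank ℝ (Fin 14 → ℝ) : ENNReal) := by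
    rw [badSet, dimH_union, dimH_union]
    exact max_le (max_le h1 h2) h3
  refine h.trans_lt ?_
  simp only [Module.finrank_fin_fun]
  norm_num

def g0 : Fin 15 → ℝ := phi ![![1, 0, 0, 0, 0, 0], ![0, 1, 0, 0, 0, 0], ![0, 0, 1, 0, 0, 0]]

theorem g0_mem : Set.range phi ∈ nhds g0 := by
  apply phi_open
  intro x hx h
  apply hx
  have h0 := h 0
  have h1 := h 1
  have h2 := h 2
  simp [ev2, cx] at h0 h1 h2
  funext i
  fin_cases i <;> assumption

theorem ev4_g0 (x : Fin 3 → ℝ) : ev4 g0 x = x 0 ^ 4 + x 1 ^ 4 + x 2 ^ 4 := by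
  rw [g0, ev4_phi]; simp [ev2]; ring

theorem pos_mem (f : Fin 15 → ℝ) (hf : ∀ x, x ≠ 0 → 0 < ev4 f x) : f ∈ Set.range phi := by
  obtain ⟨g, hgS, hgb⟩ := (badSet_dense f).inter_open_nonempty _ isOpen_interior
    ⟨g0, mem_interior_iff_mem_nhds.2 g0_mem⟩
  let γ : ℝ → (Fin 15 → ℝ) := fun t => (1 - t) • g + t • f
  have hγ : Continuous γ := by fun_prop
  have hg : g ∈ Set.range phi := interior_subset hgS
  have hsub : Set.Icc (0 : ℝ) 1 ⊆ γ ⁻¹' Set.range phi := by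
    apply IsClosed.Icc_subset_of_forall_mem_nhdsWithin
    · exact (phi_closed.preimage hγ).inter isClosed_Icc
    · simpa [γ] using hg
    · rintro t ⟨ht, ht0, ht1⟩
      apply mem_nhdsWithin_of_mem_nhds
      apply hγ.continuousAt.preimage_mem_nhds
      rcases ht0.eq_or_lt with h0 | h0
      · have : γ t = g := by simp [γ, ← h0]
        rw [this]
        exact mem_interior_iff_mem_nhds.1 hgS
      · obtain ⟨p, hp⟩ := ht
        rw [← hp]
        apply phi_open
        intro w hw0 hw
        have hpos : ∀ x, x ≠ 0 → 0 < ev4 (phi p) x := by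
          intro x hx
          obtain ⟨q, hq⟩ := hg
          have hgx : 0 ≤ ev4 g x := by rw [← hq, ev4_phi]; positivity
          rw [hp]
          simp only [γ, ev4_add, ev4_smul]
          have := mul_pos h0 (hf x hx)
          have := mul_nonneg (sub_nonneg.2 ht1.le) hgx
          linarith
        have h1t : (1 - t) ≠ 0 := by linarith
        have hgeq : g = (1 - t)⁻¹ • phi p + (-(t / (1 - t))) • f := by
          rw [hp]
          simp only [γ, smul_add, smul_smul, inv_mul_cancel₀ h1t, one_smul]
          rw [add_assoc, ← add_smul, show (1 - t)⁻¹ * t + -(t / (1 - t)) = 0 by ring, zero_smul,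
            add_zero]
        obtain ⟨a, ha⟩ := bad_of_common_zero p w hw0 hw hpos
        obtain ⟨a', ha', hs⟩ := bad_smul (1 - t)⁻¹ (-(t / (1 - t))) a
        apply hgb
        rcases ha with ha | ha | ha
        · refine Or.inl (Or.inl ⟨a', ?_⟩)
          simp only [hs, ← ha', ← ha, hgeq.symm]
        · refine Or.inl (Or.inr ⟨a', ?_⟩)
          simp only [hs, ← ha', cyc_smul, ← ha, hgeq.symm]
        · refine Or.inr ⟨a', ?_⟩
          simp only [hs, ← ha', cyc_smul, ← ha, hgeq.symm]
  have := hsub (Set.right_mem_Icc.2 zero_le_one)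
  simpa [γ] using this

theorem psd_mem (f : Fin 15 → ℝ) (hf : ∀ x, 0 ≤ ev4 f x) : f ∈ Set.range phi := by
  have hc : Continuous (fun t : ℝ => f + t • g0) := by fun_prop
  have ht : Filter.Tendsto (fun n : ℕ => f + (1 / ((n : ℝ) + 1)) • g0) Filter.atTop (nhds f) := by
    have := (hc.tendsto 0).comp tendsto_one_div_add_atTop_nhds_zero_nat
    simpa [Function.comp_def] using this
  refine phi_closed.mem_of_tendsto ht (Filter.Eventually.of_forall fun n => pos_mem _ fun x hx => ?_)
  rw [ev4_add, ev4_smul, ev4_g0]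
  have h1 : 0 < x 0 ^ 4 + x 1 ^ 4 + x 2 ^ 4 := by
    by_contra h
    apply hx
    have a0 : 0 ≤ x 0 ^ 4 := by positivity
    have a1 : 0 ≤ x 1 ^ 4 := by positivity
    have a2 : 0 ≤ x 2 ^ 4 := by positivity
    have b0 : x 0 ^ 4 = 0 := by linarith
    have b1 : x 1 ^ 4 = 0 := by linarith
    have b2 : x 2 ^ 4 = 0 := by linarith
    funext i
    fin_cases i
    · exact pow_eq_zero_iff (by norm_num) |>.1 b0
    · exact pow_eq_zero_iff (by norm_num) |>.1 b1
    · exact pow_eq_zero_iff (by norm_num) |>.1 b2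
  have h2 : (0 : ℝ) < 1 / ((n : ℝ) + 1) := by positivity
  have := mul_pos h2 h1
  linarith [hf x]

/-! ### Back to polynomials -/

theorem exists_coeffs (f : MvPolynomial (Fin 3) ℝ) (hf : f.IsHomogeneous 4) :
    ∃ c, ∀ x, eval x f = ev4 c x := by
  rw [f.as_sum]
  refine Finset.sum_induction _ (fun g : MvPolynomial (Fin 3) ℝ => ∃ c, ∀ x, eval x g = ev4 c x)
    ?_ ?_ ?_
  · rintro a b ⟨c, hc⟩ ⟨d, hd⟩
    exact ⟨c + d, fun x => by rw [map_add, hc, hd, ev4_add]⟩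
  · exact ⟨0, fun x => by simp [ev4]⟩
  · intro d hd
    have hdeg : d 0 + d 1 + d 2 = 4 := by
      have := hf (mem_support_iff.1 hd)
      simp [Finsupp.weight_apply, Finsupp.sum_fintype, Fin.sum_univ_three] at this
      exact this
    generalize coeff d f = r
    have he : ∀ x, eval x (monomial d r) = r * (x 0 ^ d 0 * x 1 ^ d 1 * x 2 ^ d 2) := fun x => by
      rw [eval_monomial, Finsupp.prod_fintype _ _ (by simp), Fin.prod_univ_three]
    simp only [he]
    generalize d 0 = i at *
    generalize d 1 = j at *
    generalize d 2 = k at *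
    have hk : k = 4 - i - j := by omega
    have hi : i ≤ 4 := by omega
    have hj : j ≤ 4 - i := by omega
    subst hk
    interval_cases i <;> interval_cases j
    · exact ⟨Pi.single 2 r, fun x => by simp [ev4]⟩
    · exact ⟨Pi.single 8 r, fun x => by simp [ev4]; left; ring⟩
    · exact ⟨Pi.single 11 r, fun x => by simp [ev4]⟩
    · exact ⟨Pi.single 6 r, fun x => by simp [ev4]⟩
    · exact ⟨Pi.single 1 r, fun x => by simp [ev4]⟩
    · exact ⟨Pi.single 7 r, fun x => by simp [ev4]; left; ring⟩
    · exact ⟨Pi.single 14 r, fun x => by simp [ev4]⟩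
    · exact ⟨Pi.single 13 r, fun x => by simp [ev4]⟩
    · exact ⟨Pi.single 5 r, fun x => by simp [ev4]; left; ring⟩
    · exact ⟨Pi.single 10 r, fun x => by simp [ev4]⟩
    · exact ⟨Pi.single 12 r, fun x => by simp [ev4]⟩
    · exact ⟨Pi.single 9 r, fun x => by simp [ev4]⟩
    · exact ⟨Pi.single 4 r, fun x => by simp [ev4]⟩
    · exact ⟨Pi.single 3 r, fun x => by simp [ev4]⟩
    · exact ⟨Pi.single 0 r, fun x => by simp [ev4]⟩

theorem exists_poly2 (p : Fin 6 → ℝ) :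
    ∃ P : MvPolynomial (Fin 3) ℝ, P.IsHomogeneous 2 ∧ ∀ x, eval x P = ev2 p x := by
  have h : ∀ (c : ℝ) (i j : Fin 3), (C c * (X i * X j) : MvPolynomial (Fin 3) ℝ).IsHomogeneous 2 :=
    fun c i j => by
      have := (isHomogeneous_C (Fin 3) c).mul ((isHomogeneous_X ℝ i).mul (isHomogeneous_X ℝ j))
      simpa using this
  refine ⟨_, (((((h (p 0) 0 0).add (h (p 1) 1 1)).add (h (p 2) 2 2)).add (h (p 3) 0 1)).add
    (h (p 4) 0 2)).add (h (p 5) 1 2), fun x => ?_⟩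
  simp [ev2]
  ring

end Hilbert3

/-- **Hilbert (1888).** Every psd ternary quartic is a sum of three squares of
quadratic forms. -/
theorem psd_ternary_quartic_is_sum_of_three_squares
    (f : MvPolynomial (Fin 3) ℝ) (hhom : f.IsHomogeneous 4)
    (hpsd : ∀ a : Fin 3 → ℝ, 0 ≤ eval a f) :
    ∃ p₁ p₂ p₃ : MvPolynomial (Fin 3) ℝ,
      p₁.IsHomogeneous 2 ∧ p₂.IsHomogeneous 2 ∧ p₃.IsHomogeneous 2 ∧
      f = p₁ ^ 2 + p₂ ^ 2 + p₃ ^ 2 := by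
  obtain ⟨c, hc⟩ := Hilbert3.exists_coeffs f hhom
  obtain ⟨p, hp⟩ := Hilbert3.psd_mem c (fun x => by rw [← hc]; exact hpsd x)
  obtain ⟨P, hP, eP⟩ := Hilbert3.exists_poly2 (p 0)
  obtain ⟨Q, hQ, eQ⟩ := Hilbert3.exists_poly2 (p 1)
  obtain ⟨R, hR, eR⟩ := Hilbert3.exists_poly2 (p 2)
  refine ⟨P, Q, R, hP, hQ, hR, MvPolynomial.funext fun x => ?_⟩
  rw [hc, ← hp, Hilbert3.ev4_phi]
  simp [eP, eQ, eR]
end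

section
/- If f ∈ ℝ[x,y,z] is a smooth ternary quartic, then f has exactly 28 different bitangents: the set of one-dimensional subspaces ℂ·l of the space ℂ[x,y,z]₁ of linear forms that are spanned by a bitangent of f has exactly 28 elements. -/
open MvPolynomial

/-- `f` is smooth: no nonzero complex point at which all partial derivatives of the
complexification of `f` vanish. -/
def IsSmooth (f : MvPolynomial (Fin 3) ℝ) : Prop :=
  ∀ a : Fin 3 → ℂ,
    (∀ i, eval a (pderiv i (map (algebraMap ℝ ℂ) f)) = 0) → a = 0

/-- A bitangent of `f`: a nonzero complex linear form `l` such that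
`f = q² + h·l` for some forms `q` of degree 2 and `h` of degree 3. -/
def IsBitangent (f : MvPolynomial (Fin 3) ℝ) (l : MvPolynomial (Fin 3) ℂ) : Prop :=
  l ≠ 0 ∧ l.IsHomogeneous 1 ∧ ∃ q h : MvPolynomial (Fin 3) ℂ,
    q.IsHomogeneous 2 ∧ h.IsHomogeneous 3 ∧
    map (algebraMap ℝ ℂ) f = q ^ 2 + h * l

namespace Bit

section

abbrev V := Fin 3 → ℂ

/-- Restriction of `F` to the line `l = 0` is a square. -/
def Sq (F : MvPolynomial (Fin 3) ℂ) (l : V) : Prop :=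
  ∃ Q : MvPolynomial (Fin 3) ℂ, Q.IsHomogeneous 2 ∧
    ∀ p : V, l ⬝ᵥ p = 0 → eval p F = (eval p Q) ^ 2

def Sm (F : MvPolynomial (Fin 3) ℂ) : Prop :=
  ∀ a : V, (∀ i, eval a (pderiv i F) = 0) → a = 0

/-- directional derivative -/
noncomputable def Dv (F : MvPolynomial (Fin 3) ℂ) (v p : V) : ℂ :=
  ∑ i, v i * eval p (pderiv i F)

lemma line_poly {F : MvPolynomial (Fin 3) ℂ} {n : ℕ} (hF : F.IsHomogeneous n) (p v : V) :
    ∃ P : Polynomial ℂ, P.natDegree ≤ n ∧ ∀ s : ℂ, eval (p + s • v) F = P.eval s := by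
  refine ⟨aeval (fun i => Polynomial.C (p i) + Polynomial.C (v i) * Polynomial.X) F, ?_, ?_⟩
  · have := MvPolynomial.aeval_natDegree_le (m := n) (n := 1) F hF.totalDegree_le
      (fun i => Polynomial.C (p i) + Polynomial.C (v i) * Polynomial.X)
      (fun i => by rw [add_comm]; exact Polynomial.natDegree_linear_le)
    simpa using this
  · intro s
    clear hF
    induction F using MvPolynomial.induction_on with
    | C a => simp
    | add a b ha hb => simp only [map_add, ha, hb, Polynomial.eval_add]
    | mul_X a i ha =>
      simp only [map_mul, ha, eval_X, aeval_X, Polynomial.eval_mul, Polynomial.eval_add,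
        Polynomial.eval_C, Polynomial.eval_X, Pi.add_apply, Pi.smul_apply, smul_eq_mul]
      ring

lemma eval_smul_hom {F : MvPolynomial (Fin 3) ℂ} {n : ℕ} (hF : F.IsHomogeneous n) (c : ℂ) (p : V) :
    eval (c • p) F = c ^ n * eval p F := by
  rw [eval_eq, eval_eq, Finset.mul_sum]
  refine Finset.sum_congr rfl fun d hd => ?_
  have h := hF (mem_support_iff.mp hd)
  simp only [Pi.smul_apply, smul_eq_mul, mul_pow, Finset.prod_mul_distrib]
  rw [Finset.prod_pow_eq_pow_sum]
  have : ∑ i ∈ d.support, d i = n := by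
    rw [← h, Finsupp.weight_apply]; simp [Finsupp.sum]
  rw [this]; ring

lemma hasDerivAt_eval (F : MvPolynomial (Fin 3) ℂ) {γ : ℂ → V} {γ' : V} {s : ℂ}
    (h : ∀ i, HasDerivAt (fun s => γ s i) (γ' i) s) :
    HasDerivAt (fun s => eval (γ s) F) (Dv F γ' (γ s)) s := by
  unfold Dv
  induction F using MvPolynomial.induction_on with
  | C a => simpa using hasDerivAt_const s a
  | add a b ha hb =>
    have e : (fun s => eval (γ s) (a + b)) = (fun s => eval (γ s) a) + fun s => eval (γ s) b := by
      ext; simp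
    rw [e]
    refine (ha.add hb).congr_deriv ?_
    simp only [map_add, mul_add, Finset.sum_add_distrib]
  | mul_X a i ha =>
    have := ha.mul (h i)
    have e : (fun s => eval (γ s) (a * X i)) = (fun s => eval (γ s) a) * fun s => γ s i := by
      ext; simp
    rw [e]
    refine this.congr_deriv ?_
    symm
    simp only [Derivation.leibniz, pderiv_X, smul_eq_mul, map_add, map_mul, eval_X, mul_add,
      Finset.sum_add_distrib, Finset.sum_mul]
    rw [add_comm]
    congr 1
    · exact Finset.sum_congr rfl fun j _ => by ring
    · rw [Finset.sum_eq_single i]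
      · simp; ring
      · intro j _ hj; simp [Pi.single_apply, hj.symm]
      · simp

lemma contDiff_eval (F : MvPolynomial (Fin 3) ℂ) {E : Type*} [NormedAddCommGroup E]
    [NormedSpace ℂ E] {g : E → V} (hg : ContDiff ℂ 1 g) :
    ContDiff ℂ 1 (fun x => eval (g x) F) := by
  induction F using MvPolynomial.induction_on with
  | C a => simpa using contDiff_const
  | add a b ha hb => simpa using ha.add hb
  | mul_X a i ha => simpa using ha.mul (contDiff_pi.mp hg i)

lemma pderiv_hom {F : MvPolynomial (Fin 3) ℂ} {n : ℕ} (hF : F.IsHomogeneous n) (i : Fin 3) :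
    (pderiv i F).IsHomogeneous (n - 1) := hF.pderiv

lemma Dv_line_poly {F : MvPolynomial (Fin 3) ℂ} {n : ℕ} (hF : F.IsHomogeneous n) (w p v : V) :
    ∃ P : Polynomial ℂ, P.natDegree ≤ n - 1 ∧ ∀ s : ℂ, Dv F w (p + s • v) = P.eval s := by
  have := fun i => line_poly (pderiv_hom hF i) p v
  choose P hP hP' using this
  refine ⟨∑ i, Polynomial.C (w i) * P i, ?_, ?_⟩
  · refine Polynomial.natDegree_sum_le_of_forall_le _ _ fun i _ => ?_
    exact (Polynomial.natDegree_C_mul_le _ _).trans (hP i)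
  · intro s
    simp [Dv, Polynomial.eval_finsetSum, hP']

lemma Dv_smul {F : MvPolynomial (Fin 3) ℂ} {n : ℕ} (hF : F.IsHomogeneous n) (w p : V) (c : ℂ) :
    Dv F w (c • p) = c ^ (n - 1) * Dv F w p := by
  simp only [Dv, eval_smul_hom (pderiv_hom hF _), Finset.mul_sum]
  exact Finset.sum_congr rfl fun j _ => by ring

/-- the five nodes -/
def nd : Fin 5 → ℂ := ![0, 1, -1, 2, -2]

lemma nd_inj : Function.Injective nd := by
  intro i j h
  fin_cases i <;> fin_cases j <;> first | rfl | (exfalso; norm_num [nd, Complex.ext_iff] at h)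

lemma poly_eq_of_nodes {P Q : Polynomial ℂ} (hP : P.natDegree ≤ 4) (hQ : Q.natDegree ≤ 4)
    (h : ∀ k, P.eval (nd k) = Q.eval (nd k)) : P = Q := by
  rw [← sub_eq_zero]
  refine Polynomial.eq_zero_of_natDegree_lt_card_of_eval_eq_zero _ nd_inj (fun k => ?_) ?_
  · simp [h k]
  · have := Polynomial.natDegree_sub_le P Q
    simp only [Fintype.card_fin]
    omega

/-- passage from the affine line to the whole plane -/
lemma all_of_affine {g : ℂ → ℂ → ℂ} (hg : Continuous (fun z : ℂ × ℂ => g z.1 z.2)) {n : ℕ}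
    (hh : ∀ c x y, g (c * x) (c * y) = c ^ n * g x y) (h : ∀ s, g 1 s = 0) (x y : ℂ) :
    g x y = 0 := by
  have h1 : ∀ x, x ≠ 0 → g x y = 0 := fun x hx => by
    have := hh x 1 (y / x)
    rw [h, mul_one, mul_div_cancel₀ _ hx] at this
    simpa using this
  by_cases hx : x = 0
  · subst hx
    have hc : Continuous fun x => g x y := hg.comp (by fun_prop : Continuous fun x : ℂ => (x, y))
    have hd : Dense ({0}ᶜ : Set ℂ) := dense_compl_singleton 0
    have := hc.ext_on hd (continuous_const (y := (0 : ℂ))) (fun x hx => h1 x hx)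
    exact congrFun this 0
  · exact h1 x hx

end

end Bit

namespace Bit

section

structure Frame (l0 : V) where
  e1 : V
  e2 : V
  e3 : V
  x1 : V
  x2 : V
  x3 : V
  h11 : x1 ⬝ᵥ e1 = 1
  h12 : x1 ⬝ᵥ e2 = 0
  h13 : x1 ⬝ᵥ e3 = 0
  h21 : x2 ⬝ᵥ e1 = 0
  h22 : x2 ⬝ᵥ e2 = 1
  h23 : x2 ⬝ᵥ e3 = 0
  h31 : x3 ⬝ᵥ e1 = 0
  h32 : x3 ⬝ᵥ e2 = 0
  h33 : x3 ⬝ᵥ e3 = 1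
  rep : ∀ p : V, p = (x1 ⬝ᵥ p) • e1 + (x2 ⬝ᵥ p) • e2 + (x3 ⬝ᵥ p) • e3
  l1 : l0 ⬝ᵥ e1 = 0
  l2 : l0 ⬝ᵥ e2 = 0
  l3 : l0 ⬝ᵥ e3 ≠ 0

open scoped ComplexOrder in
lemma star_dot_ne {v : V} (hv : v ≠ 0) : v ⬝ᵥ star v ≠ 0 := by
  intro h
  exact hv (dotProduct_self_star_eq_zero.mp h)

open Matrix in
lemma exists_frame {l0 p0 : V} (hl : l0 ≠ 0) (hp : p0 ≠ 0) (h : l0 ⬝ᵥ p0 = 0) :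
    ∃ Φ : Frame l0, Φ.e2 = p0 := by
  set E : Matrix (Fin 3) (Fin 3) ℂ := ![crossProduct (star p0) l0, p0, star l0] with hE
  have hdet : E.det ≠ 0 := by
    have : E.det = (p0 ⬝ᵥ star p0) * (l0 ⬝ᵥ star l0) := by
      rw [hE, ← triple_product_eq_det]
      have h2 := cross_dot_cross (star p0) l0 p0 (star l0)
      rw [h2, h, mul_zero, sub_zero, dotProduct_comm (star p0) p0]
    rw [this]
    exact mul_ne_zero (star_dot_ne hp) (star_dot_ne hl)
  have hu : IsUnit E.det := isUnit_iff_ne_zero.mpr hdet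
  set N := E⁻¹ with hN
  have hEN : E * N = 1 := E.mul_nonsing_inv hu
  have hNE : N * E = 1 := E.nonsing_inv_mul hu
  have key : ∀ i j, (fun k => N k j) ⬝ᵥ E i = if i = j then 1 else 0 := by
    intro i j
    have := congrFun (congrFun hEN i) j
    rw [mul_apply, one_apply] at this
    rw [← this]
    exact Finset.sum_congr rfl fun k _ => mul_comm _ _
  refine ⟨⟨E 0, E 1, E 2, fun k => N k 0, fun k => N k 1, fun k => N k 2,
    by simp [key], by simp [key], by simp [key], by simp [key], by simp [key], by simp [key],
    by simp [key], by simp [key], by simp [key], ?_, ?_, h, star_dot_ne hl⟩, rfl⟩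
  · intro p
    have h1 : (p ᵥ* N) ᵥ* E = p := by rw [vecMul_vecMul, hNE, vecMul_one]
    conv_lhs => rw [← h1]
    ext j
    simp only [vecMul, dotProduct, Fin.sum_univ_three, Pi.add_apply, Pi.smul_apply, smul_eq_mul]
    ring
  · exact dot_cross_self _ _

lemma exists_frame' {l0 : V} (hl : l0 ≠ 0) : Nonempty (Frame l0) := by
  obtain ⟨p, hp, h⟩ : ∃ p : V, p ≠ 0 ∧ l0 ⬝ᵥ p = 0 := by
    by_cases h0 : l0 0 = 0 ∧ l0 1 = 0
    · exact ⟨![1, 0, 0], fun h => by simpa using congrFun h 0, by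
        simp [dotProduct, Fin.sum_univ_three, h0.1]⟩
    · refine ⟨![l0 1, - l0 0, 0], fun h => h0 ⟨by simpa using congrFun h 1,
        by simpa using congrFun h 0⟩, ?_⟩
      simp [dotProduct, Fin.sum_univ_three]; ring
  obtain ⟨Φ, -⟩ := exists_frame hl hp h
  exact ⟨Φ⟩

variable {l0 : V} (Φ : Frame l0)

namespace Frame

/-- points on the line with parameters `a`, `b` -/
def pt (a b s : ℂ) : V := Φ.e1 + s • Φ.e2 + (a + b * s) • Φ.e3

noncomputable def ca (l : V) : ℂ := -(l ⬝ᵥ Φ.e1) / (l ⬝ᵥ Φ.e3)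
noncomputable def cb (l : V) : ℂ := -(l ⬝ᵥ Φ.e2) / (l ⬝ᵥ Φ.e3)

/-- the line with given chart coordinates -/
noncomputable def ln (a b : ℂ) : V := (l0 ⬝ᵥ Φ.e3) • (Φ.x3 - a • Φ.x1 - b • Φ.x2)

lemma ln_e3 (a b : ℂ) : Φ.ln a b ⬝ᵥ Φ.e3 = l0 ⬝ᵥ Φ.e3 := by
  simp [ln, Φ.h13, Φ.h23, Φ.h33]

lemma ca_ln (a b : ℂ) : Φ.ca (Φ.ln a b) = a := by
  rw [ca, ln_e3]
  simp [ln, Φ.h11, Φ.h21, Φ.h31]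
  field_simp [Φ.l3]

lemma cb_ln (a b : ℂ) : Φ.cb (Φ.ln a b) = b := by
  rw [cb, ln_e3]
  simp [ln, Φ.h12, Φ.h22, Φ.h32]
  field_simp [Φ.l3]

lemma dot_rep (l p : V) : l ⬝ᵥ p =
    (Φ.x1 ⬝ᵥ p) * (l ⬝ᵥ Φ.e1) + (Φ.x2 ⬝ᵥ p) * (l ⬝ᵥ Φ.e2) + (Φ.x3 ⬝ᵥ p) * (l ⬝ᵥ Φ.e3) := by
  conv_lhs => rw [Φ.rep p]
  simp [dotProduct_add]

lemma eq_smul_ln {l : V} (h : l ⬝ᵥ Φ.e3 ≠ 0) :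
    l = ((l ⬝ᵥ Φ.e3) / (l0 ⬝ᵥ Φ.e3)) • Φ.ln (Φ.ca l) (Φ.cb l) := by
  have h3 := Φ.l3
  apply dotProduct_eq
  intro p
  rw [Φ.dot_rep l p, ln, smul_smul, div_mul_cancel₀ _ h3]
  simp only [smul_dotProduct, sub_dotProduct, smul_eq_mul, ca, cb]
  field_simp
  ring

lemma ln_zero : Φ.ln 0 0 = l0 := by
  have := Φ.eq_smul_ln Φ.l3
  rw [div_self Φ.l3, one_smul] at this
  simpa [ca, cb, Φ.l1, Φ.l2] using this.symm

lemma continuous_ln : Continuous fun z : ℂ × ℂ => Φ.ln z.1 z.2 := by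
  unfold ln; fun_prop

lemma pt_eq (a b s : ℂ) : Φ.pt a b s = (Φ.e1 + a • Φ.e3) + s • (Φ.e2 + b • Φ.e3) := by
  unfold pt; module

lemma dot_pt {l : V} (h : l ⬝ᵥ Φ.e3 ≠ 0) (s : ℂ) : l ⬝ᵥ Φ.pt (Φ.ca l) (Φ.cb l) s = 0 := by
  simp only [pt, dotProduct_add, dotProduct_smul, smul_eq_mul, ca, cb]
  field_simp
  ring

lemma mem_ker {l : V} (h : l ⬝ᵥ Φ.e3 ≠ 0) {p : V} (hp : l ⬝ᵥ p = 0) :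
    p = (Φ.x1 ⬝ᵥ p) • (Φ.e1 + Φ.ca l • Φ.e3) + (Φ.x2 ⬝ᵥ p) • (Φ.e2 + Φ.cb l • Φ.e3) := by
  have h3 : Φ.x3 ⬝ᵥ p = (Φ.x1 ⬝ᵥ p) * Φ.ca l + (Φ.x2 ⬝ᵥ p) * Φ.cb l := by
    rw [Φ.dot_rep] at hp
    simp only [ca, cb]
    field_simp
    linear_combination hp
  conv_lhs => rw [Φ.rep p, h3]
  module

end Frame

/-- value of the quadratic polynomial -/
def qv (u v w s : ℂ) : ℂ := u + v * s + w * s ^ 2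

noncomputable def qp (u v w : ℂ) : Polynomial ℂ :=
  Polynomial.C u + Polynomial.C v * Polynomial.X + Polynomial.C w * Polynomial.X ^ 2

lemma qp_eval (u v w s : ℂ) : (qp u v w).eval s = qv u v w s := by simp [qp, qv]

lemma qp_deg (u v w : ℂ) : (qp u v w).natDegree ≤ 2 := by
  unfold qp; compute_degree

lemma all_affine_of_nodes {F : MvPolynomial (Fin 3) ℂ} (hF : F.IsHomogeneous 4) {a b u v w : ℂ}
    (h : ∀ k, eval (Φ.pt a b (nd k)) F = (qv u v w (nd k)) ^ 2) (s : ℂ) :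
    eval (Φ.pt a b s) F = (qv u v w s) ^ 2 := by
  obtain ⟨P, hP, hP'⟩ := line_poly hF (Φ.e1 + a • Φ.e3) (Φ.e2 + b • Φ.e3)
  have := poly_eq_of_nodes (Q := qp u v w ^ 2) hP
    ((Polynomial.natDegree_pow_le).trans (by have := qp_deg u v w; omega)) (fun k => by
      rw [← hP', ← Φ.pt_eq, h, Polynomial.eval_pow, qp_eval])
  rw [Φ.pt_eq, hP', this, Polynomial.eval_pow, qp_eval]

lemma hom_all {F : MvPolynomial (Fin 3) ℂ} (hF : F.IsHomogeneous 4) {p r : V} {u v w : ℂ}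
    (h : ∀ s : ℂ, eval (p + s • r) F = (qv u v w s) ^ 2) (x y : ℂ) :
    eval (x • p + y • r) F = (u * x ^ 2 + v * x * y + w * y ^ 2) ^ 2 := by
  have := all_of_affine (n := 4)
    (g := fun x y => eval (x • p + y • r) F - (u * x ^ 2 + v * x * y + w * y ^ 2) ^ 2)
    ?_ ?_ ?_ x y
  · exact sub_eq_zero.mp this
  · refine Continuous.sub ?_ (by fun_prop)
    have := MvPolynomial.continuous_eval F
    exact this.comp (by fun_prop : Continuous fun z : ℂ × ℂ => z.1 • p + z.2 • r)
  · intro c x y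
    rw [mul_smul, mul_smul, ← smul_add, eval_smul_hom hF]
    ring
  · intro s
    simp only [one_smul, h, qv]
    ring

/-- linear form attached to a vector -/
noncomputable def lf (l : V) : MvPolynomial (Fin 3) ℂ := ∑ i, C (l i) * X i

lemma lf_eval (l p : V) : eval p (lf l) = l ⬝ᵥ p := by simp [lf, dotProduct]

lemma lf_hom (l : V) : (lf l).IsHomogeneous 1 := by
  refine IsHomogeneous.sum _ _ _ fun i _ => ?_
  simpa using (isHomogeneous_C _ (l i)).mul (isHomogeneous_X ℂ i)

lemma Sq_iff {F : MvPolynomial (Fin 3) ℂ} (hF : F.IsHomogeneous 4) {l : V}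
    (hl : l ⬝ᵥ Φ.e3 ≠ 0) :
    Sq F l ↔ ∃ u v w : ℂ, ∀ k, eval (Φ.pt (Φ.ca l) (Φ.cb l) (nd k)) F = (qv u v w (nd k)) ^ 2 := by
  constructor
  · rintro ⟨Q, hQ, h⟩
    obtain ⟨P, hP, hP'⟩ := line_poly hQ (Φ.e1 + Φ.ca l • Φ.e3) (Φ.e2 + Φ.cb l • Φ.e3)
    refine ⟨P.coeff 0, P.coeff 1, P.coeff 2, fun k => ?_⟩
    rw [h _ (Φ.dot_pt hl _), Φ.pt_eq, hP', Polynomial.eval_eq_sum_range' (n := 3) (by omega)]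
    simp [Finset.sum_range_succ, qv]
  · rintro ⟨u, v, w, h⟩
    have h1 := all_affine_of_nodes Φ hF h
    have h2 := hom_all hF (p := Φ.e1 + Φ.ca l • Φ.e3) (r := Φ.e2 + Φ.cb l • Φ.e3) (u := u) (v := v)
      (w := w) (fun s => by rw [← Φ.pt_eq, h1])
    refine ⟨C u * lf Φ.x1 ^ 2 + C v * (lf Φ.x1 * lf Φ.x2) + C w * lf Φ.x2 ^ 2, ?_, ?_⟩
    · have hc : ∀ c : ℂ, (C c : MvPolynomial (Fin 3) ℂ).IsHomogeneous 0 := isHomogeneous_C _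
      refine ((?_ : IsHomogeneous _ 2).add ?_).add ?_
      · simpa using (hc u).mul ((lf_hom Φ.x1).pow 2)
      · simpa using (hc v).mul ((lf_hom Φ.x1).mul (lf_hom Φ.x2))
      · simpa using (hc w).mul ((lf_hom Φ.x2).pow 2)
    · intro p hp
      conv_lhs => rw [Φ.mem_ker hl hp]
      rw [h2]
      simp [lf_eval]
      ring

end

end Bit

namespace Bit

section

lemma Dv_add (F : MvPolynomial (Fin 3) ℂ) (v w p : V) : Dv F (v + w) p = Dv F v p + Dv F w p := by
  simp [Dv, add_mul, Finset.sum_add_distrib]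

lemma Dv_smul' (F : MvPolynomial (Fin 3) ℂ) (c : ℂ) (v p : V) : Dv F (c • v) p = c * Dv F v p := by
  simp [Dv, mul_assoc, Finset.mul_sum]

lemma Dv_single (F : MvPolynomial (Fin 3) ℂ) (i : Fin 3) (p : V) :
    Dv F (Pi.single i 1) p = eval p (pderiv i F) := by
  simp [Dv, Pi.single_apply]

lemma eq_zero_of_Dv {F : MvPolynomial (Fin 3) ℂ} (hs : Sm F) {l0 : V} (Φ : Frame l0) {p : V}
    (h1 : Dv F Φ.e1 p = 0) (h2 : Dv F Φ.e2 p = 0) (h3 : Dv F Φ.e3 p = 0) : p = 0 := by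
  refine hs p fun i => ?_
  rw [← Dv_single, Φ.rep (Pi.single i 1)]
  simp [Dv_add, Dv_smul', h1, h2, h3]

lemma e2_ne {l0 : V} (Φ : Frame l0) : Φ.e2 ≠ 0 := fun h => by
  have := Φ.h22
  rw [h] at this; simp at this

lemma e12_ne {l0 : V} (Φ : Frame l0) (s : ℂ) : Φ.e1 + s • Φ.e2 ≠ 0 := fun h => by
  have := congrArg (fun v => Φ.x1 ⬝ᵥ v) h
  simp [Φ.h11, Φ.h12] at this

lemma Dv_eq_of_hasDeriv {F : MvPolynomial (Fin 3) ℂ} {p v : V} {g : ℂ → ℂ} {g' : ℂ}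
    (hg : HasDerivAt g g' 0) (h : ∀ s : ℂ, eval (p + s • v) F = g s) : Dv F v p = g' := by
  have h1 : HasDerivAt (fun s : ℂ => eval (p + s • v) F) (Dv F v (p + (0 : ℂ) • v)) 0 := by
    refine hasDerivAt_eval F fun i => ?_
    simp only [Pi.add_apply, Pi.smul_apply, smul_eq_mul]
    simpa using ((hasDerivAt_id (0 : ℂ)).mul_const (v i)).const_add (p i)
  have h2 : (fun s : ℂ => eval (p + s • v) F) = g := funext h
  rw [h2] at h1
  simpa using h1.unique hg

lemma exists_ne {F : MvPolynomial (Fin 3) ℂ} (hF : F.IsHomogeneous 4) (hs : Sm F) {l0 : V}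
    (hl : l0 ≠ 0) : ∃ p : V, p ≠ 0 ∧ l0 ⬝ᵥ p = 0 ∧ eval p F ≠ 0 := by
  by_contra! hcon
  obtain ⟨Φ⟩ := exists_frame' hl
  have hz : ∀ p : V, l0 ⬝ᵥ p = 0 → eval p F = 0 := fun p hp => by
    by_cases h : p = 0
    · subst h
      have := eval_smul_hom hF 0 (0 : V)
      simpa using this
    · exact hcon p h hp
  have hD : ∀ p v : V, l0 ⬝ᵥ p = 0 → l0 ⬝ᵥ v = 0 → Dv F v p = 0 := fun p v hp hv =>
    Dv_eq_of_hasDeriv (hasDerivAt_const 0 (0 : ℂ)) fun s => hz _ (by simp [hp, hv])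
  obtain ⟨P, hP, hP'⟩ := Dv_line_poly hF Φ.e3 Φ.e1 Φ.e2
  by_cases hd : P.degree = 0
  · obtain ⟨c, hc⟩ : ∃ c, P = Polynomial.C c := ⟨_, Polynomial.eq_C_of_degree_eq_zero hd⟩
    have := all_of_affine (n := 3) (g := fun x y => Dv F Φ.e3 (x • Φ.e1 + y • Φ.e2) - x ^ 3 * c)
      ?_ ?_ ?_ 0 1
    · refine e2_ne Φ (eq_zero_of_Dv hs Φ (hD _ _ Φ.l2 Φ.l1) (hD _ _ Φ.l2 Φ.l2) ?_)
      simpa using this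
    · refine Continuous.sub ?_ (by fun_prop)
      unfold Dv
      refine continuous_finsetSum _ fun i _ => continuous_const.mul ?_
      exact (MvPolynomial.continuous_eval _).comp
        (by fun_prop : Continuous fun z : ℂ × ℂ => z.1 • Φ.e1 + z.2 • Φ.e2)
    · intro c x y
      rw [mul_smul, mul_smul, ← smul_add, Dv_smul hF]
      ring
    · intro s
      simp [hP', hc]
  · obtain ⟨r, hr⟩ := IsAlgClosed.exists_root P hd
    have hk : l0 ⬝ᵥ (Φ.e1 + r • Φ.e2) = 0 := by simp [Φ.l1, Φ.l2]
    refine e12_ne Φ r (eq_zero_of_Dv hs Φ (hD _ _ hk Φ.l1) (hD _ _ hk Φ.l2) ?_)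
    rw [hP']; exact hr

lemma qp_inj {u v w u' v' w' : ℂ} (h : qp u v w = qp u' v' w') : u = u' ∧ v = v' ∧ w = w' := by
  have h0 := congrArg (fun P => Polynomial.coeff P 0) h
  have h1 := congrArg (fun P => Polynomial.coeff P 1) h
  have h2 := congrArg (fun P => Polynomial.coeff P 2) h
  simp [qp, Polynomial.coeff_X, Polynomial.coeff_C] at h0 h1 h2
  exact ⟨h0, h1, h2⟩

lemma deriv_inj {F : MvPolynomial (Fin 3) ℂ} (hF : F.IsHomogeneous 4) (hs : Sm F) {l0 : V}
    (Φ : Frame l0) (h2 : eval Φ.e2 F ≠ 0) {u v w : ℂ}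
    (h : ∀ k, eval (Φ.pt 0 0 (nd k)) F = (qv u v w (nd k)) ^ 2) {α β u' v' w' : ℂ}
    (hk : ∀ k, (α + β * nd k) * Dv F Φ.e3 (Φ.pt 0 0 (nd k)) =
      2 * qv u v w (nd k) * qv u' v' w' (nd k)) :
    α = 0 ∧ β = 0 ∧ u' = 0 ∧ v' = 0 ∧ w' = 0 := by
  have hpt : ∀ s, Φ.pt 0 0 s = Φ.e1 + s • Φ.e2 := fun s => by simp [Frame.pt]
  have hall := hom_all hF (p := Φ.e1) (r := Φ.e2) (u := u) (v := v) (w := w) fun s => by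
    rw [← hpt]; exact all_affine_of_nodes Φ hF h s
  have hw : w ≠ 0 := by
    rintro rfl
    have := hall 0 1
    simp at this
    exact h2 this
  obtain ⟨P, hP, hP'⟩ := Dv_line_poly hF Φ.e3 Φ.e1 Φ.e2
  have hroot : ∀ r, qv u v w r = 0 → P.eval r ≠ 0 := by
    intro r hr hPr
    rw [← hP'] at hPr
    refine e12_ne Φ r (eq_zero_of_Dv hs Φ ?_ ?_ hPr)
    · refine Dv_eq_of_hasDeriv (g := fun s => (u * (1 + s) ^ 2 + v * (1 + s) * r + w * r ^ 2) ^ 2)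
        ?_ fun s => ?_
      · have h1 : HasDerivAt (fun s : ℂ => u * (1 + s) ^ 2 + v * (1 + s) * r + w * r ^ 2)
            (2 * u + v * r) 0 := by
          have hd : HasDerivAt (fun s : ℂ => 1 + s) 1 0 := (hasDerivAt_id _).const_add 1
          refine ((((hd.pow 2).const_mul u).add ((hd.const_mul v).mul_const r)).add_const
            (w * r ^ 2)).congr_deriv ?_
          simp; ring
        refine (h1.pow 2).congr_deriv ?_
        have : u * (1 + 0) ^ 2 + v * (1 + 0) * r + w * r ^ 2 = 0 := by
          have hr2 := hr; rw [qv] at hr2; linear_combination hr2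
        rw [this]; simp
      · rw [← hall]; congr 2; module
    · refine Dv_eq_of_hasDeriv (g := fun s => (u * 1 ^ 2 + v * 1 * (r + s) + w * (r + s) ^ 2) ^ 2)
        ?_ fun s => ?_
      · have h1 : HasDerivAt (fun s : ℂ => u * 1 ^ 2 + v * 1 * (r + s) + w * (r + s) ^ 2)
            (v + 2 * w * r) 0 := by
          have hd : HasDerivAt (fun s : ℂ => r + s) 1 0 := (hasDerivAt_id _).const_add r
          refine (((hd.const_mul (v * 1)).const_add (u * 1 ^ 2)).add
            ((hd.pow 2).const_mul w)).congr_deriv ?_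
          simp; ring
        refine (h1.pow 2).congr_deriv ?_
        have : u * 1 ^ 2 + v * 1 * (r + 0) + w * (r + 0) ^ 2 = 0 := by
          have hr2 := hr; rw [qv] at hr2; linear_combination hr2
        rw [this]; simp
      · rw [← hall]; congr 2; module
  have hcop : IsCoprime (qp u v w) P := by
    rw [Polynomial.isCoprime_iff_aeval_ne_zero_of_isAlgClosed (K := ℂ) ℂ]
    intro a
    by_cases ha : qv u v w a = 0
    · right; simpa [Polynomial.coe_aeval_eq_eval] using hroot a ha
    · left; simpa [Polynomial.coe_aeval_eq_eval, qp_eval] using ha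
  have hmdeg : (Polynomial.C β * Polynomial.X + Polynomial.C α).natDegree ≤ 1 :=
    Polynomial.natDegree_linear_le
  have heq : (Polynomial.C β * Polynomial.X + Polynomial.C α) * P =
      qp u v w * (Polynomial.C 2 * qp u' v' w') := by
    refine poly_eq_of_nodes ?_ ?_ fun k => ?_
    · refine Polynomial.natDegree_mul_le.trans ?_
      omega
    · refine Polynomial.natDegree_mul_le.trans ?_
      have h1 := qp_deg u v w
      have h2 := (Polynomial.natDegree_C_mul_le 2 (qp u' v' w')).trans (qp_deg u' v' w')
      omega
    · have := hk k
      rw [hpt, hP'] at this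
      simp only [Polynomial.eval_mul, Polynomial.eval_add, Polynomial.eval_C, Polynomial.eval_X,
        qp_eval]
      linear_combination this
  have hdvd : qp u v w ∣ Polynomial.C β * Polynomial.X + Polynomial.C α :=
    hcop.dvd_of_dvd_mul_right ⟨_, heq⟩
  have hm : Polynomial.C β * Polynomial.X + Polynomial.C α = 0 := by
    by_contra hne
    have := Polynomial.natDegree_le_of_dvd hdvd hne
    have h3 : (qp u v w).natDegree = 2 := by
      unfold qp; compute_degree!
    omega
  have hq0 : qp u v w ≠ 0 := by
    intro h0
    have : qp u v w = qp 0 0 0 := by rw [h0]; simp [qp]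
    exact hw (qp_inj this).2.2
  have hq' : qp u' v' w' = qp 0 0 0 := by
    rw [hm, zero_mul] at heq
    rcases mul_eq_zero.mp heq.symm with h' | h'
    · exact absurd h' hq0
    · rcases mul_eq_zero.mp h' with h'' | h''
      · simp at h''
      · rw [h'']; simp [qp]
  have hab : qp α β 0 = qp 0 0 0 := by
    rw [show qp 0 0 0 = 0 by simp [qp], ← hm]; simp [qp]; ring
  obtain ⟨a1, a2, -⟩ := qp_inj hab
  obtain ⟨a3, a4, a5⟩ := qp_inj hq'
  exact ⟨a1, a2, a3, a4, a5⟩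

end

end Bit

namespace Bit

section

open Topology Filter

/-- values of the squared quadratic polynomial at the nodes -/
def sqv (q : ℂ × ℂ × ℂ) : Fin 5 → ℂ := fun k => (qv q.1 q.2.1 q.2.2 (nd k)) ^ 2

lemma continuous_sqv : Continuous sqv := by
  unfold sqv qv; fun_prop

lemma sqv_bound (q : ℂ × ℂ × ℂ) {M : ℝ} (hM : ‖sqv q‖ ≤ M ^ 2) (h0 : 0 ≤ M) : ‖q‖ ≤ 2 * M := by
  have h : ∀ k, ‖qv q.1 q.2.1 q.2.2 (nd k)‖ ≤ M := fun k => by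
    have := (norm_le_pi_norm (sqv q) k).trans hM
    rw [sqv, norm_pow] at this
    exact (pow_le_pow_iff_left₀ (norm_nonneg _) h0 two_ne_zero).mp this
  have e0 : q.1 = qv q.1 q.2.1 q.2.2 (nd 0) := by simp [qv, nd]
  have e1 : q.2.1 = (1 / 2) * (qv q.1 q.2.1 q.2.2 (nd 1) - qv q.1 q.2.1 q.2.2 (nd 2)) := by
    simp [qv, nd]; ring
  have e2 : q.2.2 = (1 / 2) * (qv q.1 q.2.1 q.2.2 (nd 1) + qv q.1 q.2.1 q.2.2 (nd 2))
      - qv q.1 q.2.1 q.2.2 (nd 0) := by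
    simp [qv, nd]; ring
  have n12 : ‖(1 / 2 : ℂ)‖ = 1 / 2 := by norm_num
  have a0 := h 0
  have a1 := h 1
  have a2 := h 2
  rw [Prod.norm_def, Prod.norm_def]
  refine max_le ?_ (max_le ?_ ?_)
  · rw [e0]; linarith
  · rw [e1, norm_mul, n12]
    have := norm_sub_le (qv q.1 q.2.1 q.2.2 (nd 1)) (qv q.1 q.2.1 q.2.2 (nd 2))
    linarith
  · rw [e2]
    have b1 := norm_sub_le ((1 / 2) * (qv q.1 q.2.1 q.2.2 (nd 1) + qv q.1 q.2.1 q.2.2 (nd 2)))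
      (qv q.1 q.2.1 q.2.2 (nd 0))
    have b2 := norm_add_le (qv q.1 q.2.1 q.2.2 (nd 1)) (qv q.1 q.2.1 q.2.2 (nd 2))
    rw [norm_mul, n12] at b1
    linarith

lemma isClosedMap_sqv : IsClosedMap sqv := by
  have : IsProperMap sqv := by
    rw [isProperMap_iff_tendsto_cocompact]
    refine ⟨continuous_sqv, ?_⟩
    refine tendsto_cocompact_of_tendsto_dist_comp_atTop 0 ?_
    simp only [dist_zero_right]
    rw [tendsto_atTop]
    intro b
    have h2 := (tendsto_norm_cocompact_atTop (E := ℂ × ℂ × ℂ)).eventually_gt_atTop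
      (2 * (|b| + 1))
    filter_upwards [h2] with q hq
    by_contra hlt
    push Not at hlt
    have h0 := abs_nonneg b
    have h3 := le_abs_self b
    have := sqv_bound q (M := |b| + 1) (by nlinarith) (by linarith)
    linarith
  exact this.isClosedMap

lemma sqv_fiber {q q' : ℂ × ℂ × ℂ} (h : sqv q = sqv q') : q = q' ∨ q = -q' := by
  have hd : ∀ u v w, (qp u v w ^ 2).natDegree ≤ 4 := fun u v w =>
    (Polynomial.natDegree_pow_le).trans (by have := qp_deg u v w; omega)
  have := poly_eq_of_nodes (hd q.1 q.2.1 q.2.2) (hd q'.1 q'.2.1 q'.2.2) fun k => by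
    simp only [Polynomial.eval_pow, qp_eval]; exact congrFun h k
  rcases sq_eq_sq_iff_eq_or_eq_neg.mp this with h | h
  · left
    obtain ⟨h1, h2, h3⟩ := qp_inj h
    exact Prod.ext h1 (Prod.ext h2 h3)
  · right
    have : qp q.1 q.2.1 q.2.2 = qp (-q'.1) (-q'.2.1) (-q'.2.2) := by
      rw [h]; simp [qp]; ring
    obtain ⟨h1, h2, h3⟩ := qp_inj this
    exact Prod.ext h1 (Prod.ext h2 h3)

lemma sqv_neg (q : ℂ × ℂ × ℂ) : sqv (-q) = sqv q := by
  ext k; simp only [sqv, qv, Prod.fst_neg, Prod.snd_neg]; ring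

/-- pencil -/
noncomputable def fam (F H : MvPolynomial (Fin 3) ℂ) (t : ℂ) : MvPolynomial (Fin 3) ℂ := F + C t * H

lemma fam_hom {F H : MvPolynomial (Fin 3) ℂ} (hF : F.IsHomogeneous 4) (hH : H.IsHomogeneous 4)
    (t : ℂ) : (fam F H t).IsHomogeneous 4 := by
  refine hF.add ?_
  simpa using (isHomogeneous_C _ t).mul hH

lemma fam_eval (F H : MvPolynomial (Fin 3) ℂ) (t : ℂ) (p : V) :
    eval p (fam F H t) = eval p F + t * eval p H := by simp [fam]

variable {F H : MvPolynomial (Fin 3) ℂ} {l0 : V}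

noncomputable def Th (F H : MvPolynomial (Fin 3) ℂ) (Φ : Frame l0) (z : ℂ × V) : Fin 5 → ℂ :=
  fun k => eval (Φ.pt (Φ.ca z.2) (Φ.cb z.2) (nd k)) (fam F H z.1)

lemma continuousAt_ca (Φ : Frame l0) : ContinuousAt Φ.ca l0 := by
  unfold Frame.ca
  refine ContinuousAt.div ?_ ?_ Φ.l3
  · exact Continuous.continuousAt (by fun_prop)
  · exact Continuous.continuousAt (by fun_prop)

lemma continuousAt_cb (Φ : Frame l0) : ContinuousAt Φ.cb l0 := by
  unfold Frame.cb
  refine ContinuousAt.div ?_ ?_ Φ.l3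
  · exact Continuous.continuousAt (by fun_prop)
  · exact Continuous.continuousAt (by fun_prop)

lemma continuous_pt (Φ : Frame l0) (s : ℂ) : Continuous fun z : ℂ × ℂ => Φ.pt z.1 z.2 s := by
  unfold Frame.pt; fun_prop

lemma tendsto_eval_pt (Φ : Frame l0) (t0 s : ℂ) (G : MvPolynomial (Fin 3) ℂ) :
    Tendsto (fun z : ℂ × V => eval (Φ.pt (Φ.ca z.2) (Φ.cb z.2) s) G) (𝓝 (t0, l0))
      (𝓝 (eval (Φ.pt (Φ.ca l0) (Φ.cb l0) s) G)) := by
  have hs : Tendsto (fun z : ℂ × V => z.2) (𝓝 (t0, l0)) (𝓝 l0) := continuous_snd.tendsto _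
  have ha := (continuousAt_ca Φ).tendsto.comp hs
  have hb := (continuousAt_cb Φ).tendsto.comp hs
  have hp := ((continuous_pt Φ s).tendsto (Φ.ca l0, Φ.cb l0)).comp (ha.prodMk_nhds hb)
  exact ((MvPolynomial.continuous_eval G).tendsto _).comp hp

lemma continuousAt_Th (Φ : Frame l0) (t0 : ℂ) : ContinuousAt (Th F H Φ) (t0, l0) := by
  unfold ContinuousAt
  rw [tendsto_pi_nhds]
  intro k
  unfold Th
  generalize nd k = s
  simp only [fam_eval]
  have hf : Tendsto (fun z : ℂ × V => z.1) (𝓝 (t0, l0)) (𝓝 t0) := continuous_fst.tendsto _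
  exact (tendsto_eval_pt Φ t0 s F).add (hf.mul (tendsto_eval_pt Φ t0 s H))

lemma eventually_e3 (Φ : Frame l0) (t0 : ℂ) : ∀ᶠ z : ℂ × V in 𝓝 (t0, l0), z.2 ⬝ᵥ Φ.e3 ≠ 0 := by
  have : Continuous fun z : ℂ × V => z.2 ⬝ᵥ Φ.e3 := by fun_prop
  exact this.continuousAt.eventually_ne Φ.l3

lemma Sq_iff_Th (hF : F.IsHomogeneous 4) (hH : H.IsHomogeneous 4) (Φ : Frame l0) {z : ℂ × V}
    (hz : z.2 ⬝ᵥ Φ.e3 ≠ 0) : Sq (fam F H z.1) z.2 ↔ ∃ q, sqv q = Th F H Φ z := by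
  rw [Sq_iff Φ (fam_hom hF hH _) hz]
  constructor
  · rintro ⟨u, v, w, h⟩
    exact ⟨(u, v, w), funext fun k => (h k).symm⟩
  · rintro ⟨q, h⟩
    exact ⟨q.1, q.2.1, q.2.2, fun k => (congrFun h k).symm⟩

lemma closed_Sq (hF : F.IsHomogeneous 4) (hH : H.IsHomogeneous 4) (hl : l0 ≠ 0) {t0 : ℂ}
    (h : ¬ Sq (fam F H t0) l0) : ∀ᶠ z : ℂ × V in 𝓝 (t0, l0), ¬ Sq (fam F H z.1) z.2 := by
  obtain ⟨Φ⟩ := exists_frame' hl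
  have hc : IsClosed (Set.range sqv) := isClosedMap_sqv.isClosed_range
  have h0 : Th F H Φ (t0, l0) ∈ (Set.range sqv)ᶜ := fun hm =>
    h ((Sq_iff_Th (z := (t0, l0)) hF hH Φ Φ.l3).mpr hm)
  filter_upwards [eventually_e3 Φ t0, (continuousAt_Th Φ t0).eventually (hc.isOpen_compl.mem_nhds h0)]
    with z h1 h2 h3
  exact h2 ((Sq_iff_Th hF hH Φ h1).mp h3)

end

end Bit

namespace Bit

section

open Topology Filter

variable {F H : MvPolynomial (Fin 3) ℂ} {l0 : V}

abbrev W5 := ℂ × (Fin 5 → ℂ)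

/-- second component of the map for the inverse function theorem -/
noncomputable def ps (F H : MvPolynomial (Fin 3) ℂ) (Φ : Frame l0) (s : ℂ) (z : W5) : ℂ :=
  eval (Φ.pt (z.2 0) (z.2 1) s) F + z.1 * eval (Φ.pt (z.2 0) (z.2 1) s) H
    - (qv (z.2 2) (z.2 3) (z.2 4) s) ^ 2

noncomputable def Psi (F H : MvPolynomial (Fin 3) ℂ) (Φ : Frame l0) (z : W5) : W5 :=
  (z.1, fun k => ps F H Φ (nd k) z)

lemma contDiff_pt (Φ : Frame l0) (s : ℂ) :
    ContDiff ℂ 1 (fun z : W5 => Φ.pt (z.2 0) (z.2 1) s) := by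
  unfold Frame.pt; fun_prop

lemma contDiff_ps (Φ : Frame l0) (s : ℂ) : ContDiff ℂ 1 (ps F H Φ s) := by
  unfold ps
  have h1 := contDiff_eval F (contDiff_pt Φ s)
  have h2 := contDiff_eval H (contDiff_pt Φ s)
  have h3 : ContDiff ℂ 1 (fun z : W5 => qv (z.2 2) (z.2 3) (z.2 4) s) := by unfold qv; fun_prop
  exact (h1.add (contDiff_fst.mul h2)).sub (h3.pow 2)

lemma contDiff_Psi (Φ : Frame l0) : ContDiff ℂ 1 (Psi F H Φ) :=
  contDiff_fst.prodMk (contDiff_pi.mpr fun k => contDiff_ps Φ (nd k))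

lemma ps_eq (F H : MvPolynomial (Fin 3) ℂ) (Φ : Frame l0) (s : ℂ) (z : W5) :
    ps F H Φ s z = eval (Φ.pt (z.2 0) (z.2 1) s) (fam F H z.1)
      - (qv (z.2 2) (z.2 3) (z.2 4) s) ^ 2 := by
  rw [fam_eval, ps]

lemma deriv_ps (Φ : Frame l0) (s t0 u v w : ℂ) (ν : Fin 5 → ℂ) :
    HasDerivAt (fun r : ℂ => ps F H Φ s (t0, ![0, 0, u, v, w] + r • ν))
      ((ν 0 + ν 1 * s) * Dv (fam F H t0) Φ.e3 (Φ.pt 0 0 s)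
        - 2 * qv u v w s * qv (ν 2) (ν 3) (ν 4) s) 0 := by
  have h1 : HasDerivAt (fun r : ℂ => eval (Φ.pt (r * ν 0) (r * ν 1) s) (fam F H t0))
      (Dv (fam F H t0) ((ν 0 + ν 1 * s) • Φ.e3) (Φ.pt (0 * ν 0) (0 * ν 1) s)) 0 := by
    refine hasDerivAt_eval _ fun i => ?_
    simp only [Frame.pt, Pi.add_apply, Pi.smul_apply, smul_eq_mul]
    have hd : ∀ c : ℂ, HasDerivAt (fun r : ℂ => r * c) c 0 := fun c => by
      simpa using (hasDerivAt_id (0 : ℂ)).mul_const c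
    refine ((((hd (ν 0)).add ((hd (ν 1)).mul_const s)).mul_const (Φ.e3 i)).const_add
      (Φ.e1 i + s * Φ.e2 i))
  have h2 : HasDerivAt (fun r : ℂ => qv (u + r * ν 2) (v + r * ν 3) (w + r * ν 4) s)
      (qv (ν 2) (ν 3) (ν 4) s) 0 := by
    have hd : ∀ x c : ℂ, HasDerivAt (fun r : ℂ => x + r * c) c 0 := fun x c => by
      simpa using ((hasDerivAt_id (0 : ℂ)).mul_const c).const_add x
    exact ((hd u (ν 2)).add ((hd v (ν 3)).mul_const s)).add ((hd w (ν 4)).mul_const (s ^ 2))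
  have h3 := h1.sub (h2.pow 2)
  have e : (fun r : ℂ => ps F H Φ s (t0, ![0, 0, u, v, w] + r • ν)) =
      (fun r : ℂ => eval (Φ.pt (r * ν 0) (r * ν 1) s) (fam F H t0)) -
      (fun r : ℂ => qv (u + r * ν 2) (v + r * ν 3) (w + r * ν 4) s) ^ 2 := by
    ext r
    rw [ps_eq]
    simp
  rw [e]
  refine h3.congr_deriv ?_
  rw [Dv_smul']
  simp

lemma Psi_equiv (hF : F.IsHomogeneous 4) (hH : H.IsHomogeneous 4) {t0 : ℂ}
    (hs : Sm (fam F H t0)) (Φ : Frame l0) (h2 : eval Φ.e2 (fam F H t0) ≠ 0) {u v w : ℂ}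
    (h : ∀ k, eval (Φ.pt 0 0 (nd k)) (fam F H t0) = (qv u v w (nd k)) ^ 2) :
    ∃ D : W5 ≃L[ℂ] W5, HasStrictFDerivAt (Psi F H Φ) (D : W5 →L[ℂ] W5)
      (t0, ![0, 0, u, v, w]) := by
  set z0 : W5 := (t0, ![0, 0, u, v, w]) with hz0
  have hD := (contDiff_Psi (F := F) (H := H) Φ).contDiffAt (x := z0) |>.hasStrictFDerivAt one_ne_zero
  set D := fderiv ℂ (Psi F H Φ) z0 with hDdef
  have hinj : Function.Injective D.toLinearMap := by
    rw [← LinearMap.ker_eq_bot, LinearMap.ker_eq_bot']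
    rintro ⟨τ, ν⟩ hd
    have hd' : D (τ, ν) = 0 := hd
    have hcurve : HasDerivAt (fun r : ℂ => z0 + r • ((τ, ν) : W5)) (τ, ν) 0 := by
      simpa using ((hasDerivAt_id (0 : ℂ)).smul_const ((τ, ν) : W5)).const_add z0
    have hfd : HasFDerivAt (Psi F H Φ) D (z0 + (0 : ℂ) • ((τ, ν) : W5)) := by
      simpa using hD.hasFDerivAt
    have hcomp := hfd.comp_hasDerivAt (0 : ℂ) hcurve
    rw [hd'] at hcomp
    have hfst : HasDerivAt (fun r : ℂ => t0 + r * τ) 0 0 := hcomp.fst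
    have hfst' : HasDerivAt (fun r : ℂ => t0 + r * τ) τ 0 := by
      simpa using ((hasDerivAt_id (0 : ℂ)).mul_const τ).const_add t0
    have hτ : τ = 0 := hfst'.unique hfst
    subst hτ
    have hk : ∀ k, (ν 0 + ν 1 * nd k) * Dv (fam F H t0) Φ.e3 (Φ.pt 0 0 (nd k))
        = 2 * qv u v w (nd k) * qv (ν 2) (ν 3) (ν 4) (nd k) := by
      intro k
      have hsnd := (hasDerivAt_pi.mp hcomp.snd) k
      have e : (fun r : ℂ => (Psi F H Φ (z0 + r • (((0 : ℂ), ν) : W5))).2 k) =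
          fun r : ℂ => ps F H Φ (nd k) (t0, ![0, 0, u, v, w] + r • ν) := by
        ext r
        simp [Psi, hz0]
      have hsnd' : HasDerivAt (fun r : ℂ => ps F H Φ (nd k) (t0, ![0, 0, u, v, w] + r • ν)) 0 0 := by
        rw [← e]; exact hsnd
      have := (deriv_ps (F := F) (H := H) Φ (nd k) t0 u v w ν).unique hsnd'
      linear_combination this
    obtain ⟨a0, a1, a2, a3, a4⟩ := deriv_inj (fam_hom hF hH t0) hs Φ h2 h hk
    have : ν = 0 := by
      ext i; fin_cases i <;> assumption
    rw [this]; rfl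
  refine ⟨(LinearEquiv.ofInjectiveEndo D.toLinearMap hinj).toContinuousLinearEquiv, ?_⟩
  have he : ((LinearEquiv.ofInjectiveEndo D.toLinearMap hinj).toContinuousLinearEquiv : W5 →L[ℂ] W5)
      = D := ContinuousLinearMap.ext fun x => rfl
  rw [he]
  exact hD

/-- data of a bitangent at a smooth parameter -/
lemma local_data (hF : F.IsHomogeneous 4) (hH : H.IsHomogeneous 4) {t0 : ℂ}
    (hs : Sm (fam F H t0)) (hl : l0 ≠ 0) (hB : Sq (fam F H t0) l0) :
    ∃ (Φ : Frame l0) (u v w : ℂ),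
      (∀ k, eval (Φ.pt 0 0 (nd k)) (fam F H t0) = (qv u v w (nd k)) ^ 2) ∧
      ∃ D : W5 ≃L[ℂ] W5, HasStrictFDerivAt (Psi F H Φ) (D : W5 →L[ℂ] W5)
        (t0, ![0, 0, u, v, w]) := by
  obtain ⟨p, hp, hlp, hne⟩ := exists_ne (fam_hom hF hH t0) hs hl
  obtain ⟨Φ, rfl⟩ := exists_frame hl hp hlp
  obtain ⟨u, v, w, h⟩ := (Sq_iff Φ (fam_hom hF hH t0) Φ.l3).mp hB
  have ha : Φ.ca l0 = 0 := by simp [Frame.ca, Φ.l1]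
  have hb : Φ.cb l0 = 0 := by simp [Frame.cb, Φ.l2]
  rw [ha, hb] at h
  exact ⟨Φ, u, v, w, h, Psi_equiv hF hH hs Φ hne h⟩

lemma Psi_z0 {Φ : Frame l0} {t0 u v w : ℂ}
    (h : ∀ k, eval (Φ.pt 0 0 (nd k)) (fam F H t0) = (qv u v w (nd k)) ^ 2) :
    Psi F H Φ (t0, ![0, 0, u, v, w]) = (t0, 0) := by
  refine Prod.ext rfl (funext fun k => ?_)
  have := h k
  simp [Psi, ps_eq, this]

lemma local_exists (hF : F.IsHomogeneous 4) (hH : H.IsHomogeneous 4) {t0 : ℂ}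
    (hs : Sm (fam F H t0)) (hl : l0 ≠ 0) (hB : Sq (fam F H t0) l0) {W : Set V} (hW : W ∈ 𝓝 l0) :
    ∀ᶠ t in 𝓝 t0, ∃ l ∈ W, Sq (fam F H t) l := by
  obtain ⟨Φ, u, v, w, h, D, hD⟩ := local_data hF hH hs hl hB
  have hmap := hD.map_nhds_eq_of_equiv
  rw [Psi_z0 h] at hmap
  have hc : Continuous fun z : W5 => Φ.ln (z.2 0) (z.2 1) :=
    Φ.continuous_ln.comp (by fun_prop : Continuous fun z : W5 => (z.2 0, z.2 1))
  have hW' : (fun z : W5 => Φ.ln (z.2 0) (z.2 1)) ⁻¹' W ∩ {z | Φ.ln (z.2 0) (z.2 1) ⬝ᵥ Φ.e3 ≠ 0}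
      ∈ 𝓝 ((t0, ![0, 0, u, v, w]) : W5) := by
    refine inter_mem (hc.continuousAt ?_) (Filter.univ_mem' fun z => ?_)
    · simpa [Φ.ln_zero] using hW
    · simpa [Φ.ln_e3] using Φ.l3
  have him := image_mem_map (m := Psi F H Φ) hW'
  rw [hmap] at him
  have ht : Tendsto (fun t : ℂ => ((t, 0) : W5)) (𝓝 t0) (𝓝 (t0, 0)) :=
    Continuous.tendsto (by fun_prop) t0
  filter_upwards [ht him] with t ⟨z, ⟨hz1, hz3⟩, hz2⟩
  have e1 : z.1 = t := congrArg Prod.fst hz2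
  refine ⟨_, hz1, (Sq_iff Φ (fam_hom hF hH t) hz3).mpr ⟨z.2 2, z.2 3, z.2 4, fun k => ?_⟩⟩
  have e2 : ps F H Φ (nd k) z = 0 := congrFun (congrArg Prod.snd hz2) k
  rw [ps_eq, e1] at e2
  rw [Φ.ca_ln, Φ.cb_ln]
  exact sub_eq_zero.mp e2

lemma span_eq_of_smul {l m : V} {c d : ℂ} (hl : l = c • m) {l' : V} (hl' : l' = d • m)
    (h : l ≠ 0) (h' : l' ≠ 0) : Submodule.span ℂ {l} = Submodule.span ℂ {l'} := by
  have hc : c ≠ 0 := fun h0 => h (by rw [hl, h0, zero_smul])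
  have hd : d ≠ 0 := fun h0 => h' (by rw [hl', h0, zero_smul])
  rw [hl, hl', Submodule.span_singleton_smul_eq (isUnit_iff_ne_zero.mpr hc),
    Submodule.span_singleton_smul_eq (isUnit_iff_ne_zero.mpr hd)]

lemma local_unique (hF : F.IsHomogeneous 4) (hH : H.IsHomogeneous 4) {t0 : ℂ}
    (hs : Sm (fam F H t0)) (hl : l0 ≠ 0) (hB : Sq (fam F H t0) l0) :
    ∃ S ∈ 𝓝 (t0, l0), ∀ t l l', (t, l) ∈ S → (t, l') ∈ S → Sq (fam F H t) l →
      Sq (fam F H t) l' → Submodule.span ℂ {l} = Submodule.span ℂ {l'} := by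
  obtain ⟨Φ, u, v, w, h, D, hD⟩ := local_data hF hH hs hl hB
  have hinj := hD.eventually_left_inverse
  have ha : Φ.ca l0 = 0 := by simp [Frame.ca, Φ.l1]
  have hb : Φ.cb l0 = 0 := by simp [Frame.cb, Φ.l2]
  -- coordinates map
  have hc : Tendsto (fun y : (ℂ × V) × (ℂ × ℂ × ℂ) =>
      ((y.1.1, ![Φ.ca y.1.2, Φ.cb y.1.2, y.2.1, y.2.2.1, y.2.2.2]) : W5))
      (𝓝 (t0, l0) ×ˢ 𝓝 (u, v, w)) (𝓝 (t0, ![0, 0, u, v, w])) := by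
    rw [← nhds_prod_eq]
    have hs : Tendsto (fun y : (ℂ × V) × (ℂ × ℂ × ℂ) => y.1.2) (𝓝 ((t0, l0), (u, v, w)))
        (𝓝 l0) := Continuous.tendsto (by fun_prop) ((t0, l0), (u, v, w))
    have hca := (continuousAt_ca Φ).tendsto.comp hs
    have hcb := (continuousAt_cb Φ).tendsto.comp hs
    rw [ha] at hca
    rw [hb] at hcb
    refine Tendsto.prodMk_nhds (Continuous.tendsto (by fun_prop) ((t0, l0), (u, v, w))) ?_
    rw [tendsto_pi_nhds]
    intro i
    fin_cases i
    · exact hca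
    · exact hcb
    · exact Continuous.tendsto (by fun_prop : Continuous fun y : (ℂ × V) × (ℂ × ℂ × ℂ) => y.2.1)
        ((t0, l0), (u, v, w))
    · exact Continuous.tendsto (by fun_prop : Continuous fun y : (ℂ × V) × (ℂ × ℂ × ℂ) => y.2.2.1)
        ((t0, l0), (u, v, w))
    · exact Continuous.tendsto (by fun_prop : Continuous fun y : (ℂ × V) × (ℂ × ℂ × ℂ) => y.2.2.2)
        ((t0, l0), (u, v, w))
  obtain ⟨pa, hpa, pb, hpb, hpab⟩ := eventually_prod_iff.mp (hc.eventually hinj)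
  -- sign choice
  have hTh0 : Th F H Φ (t0, l0) = sqv (u, v, w) := by
    ext k
    simp only [Th, ha, hb, sqv]
    exact h k
  have hfib : ∀ᶠ y in 𝓝 (Th F H Φ (t0, l0)), ∀ q ∈ sqv ⁻¹' {y}, pb q ∨ pb (-q) := by
    refine isClosedMap_sqv.eventually_nhds_fiber _ fun q hq => ?_
    have hq' : sqv q = sqv (u, v, w) := by rw [← hTh0]; exact hq
    rcases sqv_fiber hq' with rfl | rfl
    · exact hpb.mono fun q hq => Or.inl hq
    · have : Tendsto (fun q : ℂ × ℂ × ℂ => -q) (𝓝 (-(u, v, w))) (𝓝 (u, v, w)) := by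
        simpa using (continuous_neg (G := ℂ × ℂ × ℂ)).tendsto (-(u, v, w))
      exact (this.eventually hpb).mono fun q hq => Or.inr hq
  have hS := hpa.and ((eventually_e3 Φ t0).and ((continuousAt_Th (F := F) (H := H) Φ t0).eventually hfib))
  -- every nearby bitangent has good coordinates
  have hgood : ∀ z : ℂ × V, (pa z ∧ z.2 ⬝ᵥ Φ.e3 ≠ 0 ∧
      ∀ q ∈ sqv ⁻¹' {Th F H Φ z}, pb q ∨ pb (-q)) → Sq (fam F H z.1) z.2 →
      ∃ q : ℂ × ℂ × ℂ, hD.localInverse (Psi F H Φ) D _ (z.1, 0) =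
        ((z.1, ![Φ.ca z.2, Φ.cb z.2, q.1, q.2.1, q.2.2]) : W5) := by
    rintro z ⟨hz1, hz2, hz3⟩ hz
    obtain ⟨q, hq, hqb⟩ : ∃ q, sqv q = Th F H Φ z ∧ pb q := by
      obtain ⟨q, hq⟩ := (Sq_iff_Th hF hH Φ hz2).mp hz
      rcases hz3 q hq with h' | h'
      · exact ⟨q, hq, h'⟩
      · exact ⟨-q, by rw [sqv_neg, hq], h'⟩
    refine ⟨q, ?_⟩
    have := hpab hz1 hqb
    rw [← this]
    congr 1
    refine Prod.ext rfl (funext fun k => ?_)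
    have := congrFun hq k
    simp only [sqv, Th] at this
    simp [Psi, ps_eq, this]
  refine ⟨_, hS, fun t l l' h1 h2 hs1 hs2 => ?_⟩
  obtain ⟨q, hq⟩ := hgood (t, l) h1 hs1
  obtain ⟨q', hq'⟩ := hgood (t, l') h2 hs2
  have hv := congrArg Prod.snd (hq.symm.trans hq')
  have hca : Φ.ca l = Φ.ca l' := by simpa using congrFun hv 0
  have hcb : Φ.cb l = Φ.cb l' := by simpa using congrFun hv 1
  have g1 : l ⬝ᵥ Φ.e3 ≠ 0 := h1.2.1
  have g2 : l' ⬝ᵥ Φ.e3 ≠ 0 := h2.2.1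
  have e1 := Φ.eq_smul_ln g1
  have e2 := Φ.eq_smul_ln g2
  rw [← hca, ← hcb] at e2
  exact span_eq_of_smul e1 e2 (fun h0 => g1 (by simp [h0])) (fun h0 => g2 (by simp [h0]))

end

end Bit

namespace Bit

section

open Topology Filter

/-- the set of lines spanned by nonzero vectors with property `B` -/
def Ls (B : V → Prop) : Set (Submodule ℂ V) := {L | ∃ l, l ≠ 0 ∧ B l ∧ L = Submodule.span ℂ {l}}

lemma Sq_smul {F : MvPolynomial (Fin 3) ℂ} {l : V} {c : ℂ} (hc : c ≠ 0) (h : Sq F l) :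
    Sq F (c • l) := by
  obtain ⟨Q, hQ, h⟩ := h
  refine ⟨Q, hQ, fun p hp => h p ?_⟩
  rw [smul_dotProduct, smul_eq_mul] at hp
  exact (mul_eq_zero.mp hp).resolve_left hc

lemma li_of_span_ne {k k' : V} (hk : k ≠ 0) (hk' : k' ≠ 0)
    (h : Submodule.span ℂ {k} ≠ Submodule.span ℂ {k'}) : LinearIndependent ℂ ![k, k'] := by
  rw [LinearIndependent.pair_iff' hk]
  rintro a ha
  exact h (span_eq_of_smul (one_smul ℂ k).symm ha.symm hk hk')

lemma span_ne_of_li {k k' : V} (h : LinearIndependent ℂ ![k, k']) :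
    Submodule.span ℂ {k} ≠ Submodule.span ℂ {k'} := by
  intro he
  have hk : k ≠ 0 := h.ne_zero 0
  have : k' ∈ Submodule.span ℂ {k} := he ▸ Submodule.mem_span_singleton_self k'
  obtain ⟨a, ha⟩ := Submodule.mem_span_singleton.mp this
  exact (LinearIndependent.pair_iff' hk).mp h a ha

lemma Ls_rep {B : V → Prop} (hsc : ∀ l (c : ℂ), c ≠ 0 → B l → B (c • l))
    {L : Submodule ℂ V} (hL : L ∈ Ls B) :
    ∃ l ∈ Metric.sphere (0 : V) 1, B l ∧ L = Submodule.span ℂ {l} := by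
  obtain ⟨l, h0, hB, rfl⟩ := hL
  have hn : ((‖l‖ : ℂ))⁻¹ ≠ 0 := by simpa using h0
  refine ⟨((‖l‖ : ℂ))⁻¹ • l, ?_, hsc _ _ hn hB, ?_⟩
  · have : ‖l‖ ≠ 0 := by simpa using h0
    simp [norm_smul, this]
  · rw [Submodule.span_singleton_smul_eq (isUnit_iff_ne_zero.mpr hn)]

lemma sphere_ne {l : V} (h : l ∈ Metric.sphere (0 : V) 1) : l ≠ 0 := by
  rintro rfl; simp at h

lemma finite_Ls {B : V → Prop} (hsc : ∀ l (c : ℂ), c ≠ 0 → B l → B (c • l))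
    (hloc : ∀ l0 : V, l0 ≠ 0 → ∃ S ∈ 𝓝 l0, ∀ l ∈ S, ∀ l' ∈ S, B l → B l' →
      Submodule.span ℂ {l} = Submodule.span ℂ {l'}) : (Ls B).Finite := by
  choose! S hS hS' using hloc
  obtain ⟨T, hT, hcov⟩ := (isCompact_sphere (0 : V) 1).elim_nhds_subcover S
    fun x hx => hS x (sphere_ne hx)
  refine Set.Finite.subset (T.finite_toSet.biUnion (t := fun x =>
    {L | ∃ l ∈ S x, B l ∧ L = Submodule.span ℂ {l}}) fun x hx => Set.Subsingleton.finite ?_) ?_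
  · rintro _ ⟨l, h1, h2, rfl⟩ _ ⟨l', h1', h2', rfl⟩
    exact hS' x (sphere_ne (hT x hx)) l h1 l' h1' h2 h2'
  · intro L hL
    obtain ⟨l, hl, hB, rfl⟩ := Ls_rep hsc hL
    obtain ⟨x, hx, hlx⟩ := Set.mem_iUnion₂.mp (hcov hl)
    exact Set.mem_iUnion₂.mpr ⟨x, hx, l, hlx, hB, rfl⟩

lemma count_const {B : ℂ → V → Prop} (hsc : ∀ t l (c : ℂ), c ≠ 0 → B t l → B t (c • l)) {t0 : ℂ}
    (hcl : ∀ l0 : V, l0 ≠ 0 → ¬ B t0 l0 → ∀ᶠ z : ℂ × V in 𝓝 (t0, l0), ¬ B z.1 z.2)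
    (hex : ∀ l0 : V, l0 ≠ 0 → B t0 l0 → ∀ W ∈ 𝓝 l0, ∀ᶠ t in 𝓝 t0, ∃ l ∈ W, B t l)
    (hun : ∀ l0 : V, l0 ≠ 0 → B t0 l0 → ∃ S ∈ 𝓝 (t0, l0), ∀ t l l', (t, l) ∈ S → (t, l') ∈ S →
      B t l → B t l' → Submodule.span ℂ {l} = Submodule.span ℂ {l'}) :
    ∀ᶠ t in 𝓝 t0, (Ls (B t)).ncard = (Ls (B t0)).ncard := by
  have hfin : (Ls (B t0)).Finite := by
    refine finite_Ls (hsc t0) fun l0 h0 => ?_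
    have hi : Tendsto (fun l : V => (t0, l)) (𝓝 l0) (𝓝 (t0, l0)) :=
      Continuous.tendsto (by fun_prop) l0
    by_cases h : B t0 l0
    · obtain ⟨S, hS, hS'⟩ := hun l0 h0 h
      exact ⟨_, hi hS, fun l hl l' hl' b b' => hS' t0 l l' hl hl' b b'⟩
    · exact ⟨_, hi (hcl l0 h0 h), fun l hl l' hl' b b' => absurd b hl⟩
  have : Fintype (Ls (B t0)) := hfin.fintype
  choose k hk hkB hkL using fun c : Ls (B t0) => Ls_rep (hsc t0) c.2
  choose! S hS hS' using hun
  -- good neighbourhood in the product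
  have hG : {z : ℂ × (Ls (B t0) → V) | (∀ c c', c ≠ c' → LinearIndependent ℂ ![z.2 c, z.2 c']) ∧
      (∀ c, (z.1, z.2 c) ∈ S (k c)) ∧ ∀ c, z.2 c ≠ 0} ∈ 𝓝 (t0, k) := by
    refine inter_mem ?_ (inter_mem ?_ ?_)
    · have : ∀ c c' : Ls (B t0), ∀ᶠ z : ℂ × (Ls (B t0) → V) in 𝓝 (t0, k),
          c ≠ c' → LinearIndependent ℂ ![z.2 c, z.2 c'] := by
        intro c c'
        by_cases h : c = c'
        · simp [h]
        · have hli : LinearIndependent ℂ ![k c, k c'] := by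
            refine li_of_span_ne (sphere_ne (hk c)) (sphere_ne (hk c')) ?_
            rw [← hkL, ← hkL]
            exact fun he => h (Subtype.ext he)
          have hcont : Continuous fun z : ℂ × (Ls (B t0) → V) => ![z.2 c, z.2 c'] := by
            fun_prop
          filter_upwards [hcont.continuousAt.preimage_mem_nhds
            ((isOpen_setOfPred_linearIndependent (𝕜 := ℂ) (E := V) (ι := Fin 2)).mem_nhds hli)] with z hz _
          exact hz
      exact (eventually_all.mpr fun c => eventually_all.mpr fun c' => this c c')
    · refine eventually_all.mpr fun c => ?_
      have hcont : Continuous fun z : ℂ × (Ls (B t0) → V) => (z.1, z.2 c) := by fun_prop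
      exact hcont.continuousAt.preimage_mem_nhds (hS (k c) (sphere_ne (hk c)) (hkB c))
    · refine eventually_all.mpr fun c => ?_
      have hcont : Continuous fun z : ℂ × (Ls (B t0) → V) => z.2 c := by fun_prop
      exact hcont.continuousAt.eventually_ne (sphere_ne (hk c))
  obtain ⟨ε, hε, hball⟩ := Metric.mem_nhds_iff.mp hG
  have hm : ∀ᶠ t in 𝓝 t0, ∃ m : Ls (B t0) → V,
      ((∀ c c', c ≠ c' → LinearIndependent ℂ ![m c, m c']) ∧
      (∀ c, (t, m c) ∈ S (k c)) ∧ ∀ c, m c ≠ 0) ∧ ∀ c, B t (m c) := by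
    have h1 : ∀ᶠ t in 𝓝 t0, ∀ c, ∃ l ∈ Metric.ball (k c) ε, B t l :=
      eventually_all.mpr fun c => hex (k c) (sphere_ne (hk c)) (hkB c) _ (Metric.ball_mem_nhds _ hε)
    filter_upwards [h1, Metric.ball_mem_nhds t0 hε] with t ht htb
    choose m hm hmB using ht
    have hmem : (t, m) ∈ Metric.ball (t0, k) ε := by
      rw [Metric.mem_ball, Prod.dist_eq]
      exact max_lt htb ((dist_pi_lt_iff hε).mpr hm)
    have h2 := hball hmem
    simp only [Set.mem_ofPred_eq] at h2
    exact ⟨m, h2, hmB⟩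
  -- every bitangent nearby lies in one of the neighbourhoods
  have hcov : ∀ᶠ t in 𝓝 t0, ∀ l ∈ Metric.sphere (0 : V) 1, B t l →
      ∃ c : Ls (B t0), ∃ a : ℂ, a ≠ 0 ∧ (t, a • l) ∈ S (k c) := by
    refine (isCompact_sphere (0 : V) 1).eventually_forall_of_forall_eventually fun l0 hl0 => ?_
    by_cases h : B t0 l0
    · let c : Ls (B t0) := ⟨_, l0, sphere_ne hl0, h, rfl⟩
      have : k c ∈ Submodule.span ℂ {l0} := by
        have := hkL c
        change Submodule.span ℂ {l0} = _ at this
        rw [this]; exact Submodule.mem_span_singleton_self _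
      obtain ⟨a, ha⟩ := Submodule.mem_span_singleton.mp this
      have ha0 : a ≠ 0 := by
        rintro rfl
        exact sphere_ne (hk c) (by rw [← ha, zero_smul])
      have hcont : Continuous fun z : ℂ × V => (z.1, a • z.2) := by fun_prop
      have := hcont.continuousAt.preimage_mem_nhds (x := (t0, l0)) (t := S (k c))
        (by simpa [ha] using hS (k c) (sphere_ne (hk c)) (hkB c))
      filter_upwards [this] with z hz _
      exact ⟨c, a, ha0, hz⟩
    · filter_upwards [hcl l0 (sphere_ne hl0) h] with z hz hz'
      exact absurd hz' hz
  filter_upwards [hm, hcov] with t ⟨m, ⟨hm1, hm2, hm3⟩, hmB⟩ hct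
  have hinj : Function.Injective fun c => Submodule.span ℂ {m c} := by
    intro c c' he
    by_contra hne
    exact span_ne_of_li (hm1 c c' hne) he
  have hrange : Ls (B t) = Set.range fun c => Submodule.span ℂ {m c} := by
    ext L
    constructor
    · intro hL
      obtain ⟨l, hl, hB, rfl⟩ := Ls_rep (hsc t) hL
      obtain ⟨c, a, ha, hS1⟩ := hct l hl hB
      refine ⟨c, ?_⟩
      have := hS' (k c) (sphere_ne (hk c)) (hkB c) t (m c) (a • l) (hm2 c) hS1 (hmB c)
        (hsc t l a ha hB)
      rw [Submodule.span_singleton_smul_eq (isUnit_iff_ne_zero.mpr ha)] at this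
      exact this
    · rintro ⟨c, rfl⟩
      exact ⟨m c, hm3 c, hmB c, rfl⟩
  rw [hrange, ← Set.image_univ, Set.ncard_image_of_injective _ hinj, Set.ncard_univ,
    Nat.card_coe_set_eq]

lemma count_fam {F H : MvPolynomial (Fin 3) ℂ} (hF : F.IsHomogeneous 4) (hH : H.IsHomogeneous 4)
    {t0 : ℂ} (hs : Sm (fam F H t0)) :
    ∀ᶠ t in 𝓝 t0, (Ls (Sq (fam F H t))).ncard = (Ls (Sq (fam F H t0))).ncard :=
  count_const (B := fun t => Sq (fam F H t)) (fun t l c hc h => Sq_smul hc h)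
    (fun l0 h0 h => closed_Sq hF hH h0 h)
    (fun l0 h0 h W hW => local_exists hF hH hs h0 h hW)
    (fun l0 h0 h => local_unique hF hH hs h0 h)

end

end Bit

namespace Bit

section

open Topology Filter

/-- the Fermat quartic -/
noncomputable def Fm : MvPolynomial (Fin 3) ℂ := ∑ i, X i ^ 4

lemma Fm_hom : Fm.IsHomogeneous 4 :=
  IsHomogeneous.sum _ _ _ fun i _ => by simpa using (isHomogeneous_X ℂ i).pow 4

lemma Fm_eval (a : V) : eval a Fm = a 0 ^ 4 + a 1 ^ 4 + a 2 ^ 4 := by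
  simp [Fm, Fin.sum_univ_three]

lemma Fm_pderiv (a : V) (i : Fin 3) : eval a (pderiv i Fm) = 4 * a i ^ 3 := by
  fin_cases i <;> simp [Fm, Fin.sum_univ_three, pderiv_X, Derivation.leibniz_pow]

/-- exponents of degree seven -/
noncomputable def I7 : Finset (Fin 3 →₀ ℕ) := (Finsupp.finite_of_degree_eq (σ := Fin 3) 7).toFinset

lemma mem_I7 {n : Fin 3 →₀ ℕ} : n ∈ I7 ↔ n.degree = 7 := by simp [I7]

lemma eval_I7 {P : MvPolynomial (Fin 3) ℂ} (hP : P.IsHomogeneous 7) (a : V) :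
    eval a P = ∑ n : I7, coeff n.1 P * ∏ j, a j ^ (n.1 j) := by
  rw [eval_eq', Finset.sum_coe_sort I7 (fun n => coeff n P * ∏ j, a j ^ (n j))]
  refine Finset.sum_subset (fun n hn => ?_) fun n _ hn => ?_
  · rw [mem_I7]
    have := hP (mem_support_iff.mp hn)
    rw [Finsupp.degree_eq_weight_one]
    exact this
  · rw [notMem_support_iff.mp hn, zero_mul]

lemma exists_three (n : I7) : ∃ i, 3 ≤ n.1 i := by
  have h := mem_I7.mp n.2
  rw [Finsupp.degree_eq_sum, Fin.sum_univ_three] at h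
  by_contra! hc
  have h0 := hc 0
  have h1 := hc 1
  have h2 := hc 2
  omega

noncomputable def ix (n : I7) : Fin 3 := (exists_three n).choose
lemma ix_spec (n : I7) : 3 ≤ n.1 (ix n) := (exists_three n).choose_spec

noncomputable def Pm (H : MvPolynomial (Fin 3) ℂ) (n : I7) : MvPolynomial (Fin 3) ℂ :=
  monomial (n.1 - Finsupp.single (ix n) 3) 1 * pderiv (ix n) H

lemma split_n (n : I7) : n.1 = (n.1 - Finsupp.single (ix n) 3) + Finsupp.single (ix n) 3 := by
  rw [tsub_add_cancel_of_le]
  simpa using ix_spec n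

lemma Pm_hom {H : MvPolynomial (Fin 3) ℂ} (hH : H.IsHomogeneous 4) (n : I7) :
    (Pm H n).IsHomogeneous 7 := by
  have h1 : (n.1 - Finsupp.single (ix n) 3).degree = 4 := by
    have h := mem_I7.mp n.2
    rw [split_n n, map_add, Finsupp.degree_single] at h
    omega
  exact (isHomogeneous_monomial (1 : ℂ) h1).mul (hH.pderiv (i := ix n))

noncomputable def Nm (H : MvPolynomial (Fin 3) ℂ) : Module.End ℂ (I7 → ℂ) :=
  Matrix.toLin' (Matrix.of fun m n : I7 => coeff n.1 (Pm H m))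

lemma singular_eigen {H : MvPolynomial (Fin 3) ℂ} (hH : H.IsHomogeneous 4) {t : ℂ}
    (hs : ¬ Sm (fam Fm H t)) : t ≠ 0 ∧ (Nm H).HasEigenvalue (-4 / t) := by
  unfold Sm at hs
  push Not at hs
  obtain ⟨a, ha, ha0⟩ := hs
  have ha' : ∀ i, 4 * a i ^ 3 + t * eval a (pderiv i H) = 0 := by
    intro i
    have := ha i
    simpa [fam, Fm_pderiv] using this
  have ht : t ≠ 0 := by
    rintro rfl
    refine ha0 (funext fun i => ?_)
    simpa using ha' i
  refine ⟨ht, Module.End.hasEigenvalue_of_hasEigenvector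
    (x := fun n : I7 => ∏ j, a j ^ (n.1 j)) ⟨?_, ?_⟩⟩
  · rw [Module.End.mem_eigenspace_iff]
    ext m
    have e1 : (Nm H) (fun n : I7 => ∏ j, a j ^ (n.1 j)) m = eval a (Pm H m) := by
      rw [eval_I7 (Pm_hom hH m)]
      simp [Nm, Matrix.mulVec, dotProduct]
    have e2 : ∏ j, a j ^ (m.1 j) = eval a (monomial (m.1 - Finsupp.single (ix m) 3) 1)
        * a (ix m) ^ 3 := by
      have : ∏ j, a j ^ (m.1 j) = eval a (monomial m.1 (1 : ℂ)) := by
        simp [eval_monomial, Finsupp.prod_fintype]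
      rw [this]
      conv_lhs => rw [split_n m, ← mul_one (1 : ℂ), ← monomial_mul, map_mul]
      congr 1
      simp [eval_monomial]
    rw [e1, Pm, map_mul]
    simp only [Pi.smul_apply, smul_eq_mul]
    rw [e2]
    have := ha' (ix m)
    field_simp
    linear_combination (eval a (monomial (m.1 - Finsupp.single (ix m) 3) 1)) * this
  · obtain ⟨j, hj⟩ := Function.ne_iff.mp ha0
    intro h0
    have := congrFun h0 ⟨Finsupp.single j 7, mem_I7.mpr (by simp)⟩
    simp only [Pi.zero_apply] at this
    rw [Finset.prod_eq_zero_iff] at this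
    obtain ⟨i, -, hi⟩ := this
    by_cases hij : j = i
    · subst hij
      simp at hi
      exact hj hi
    · simp [Finsupp.single_apply, hij] at hi

lemma singular_finite {H : MvPolynomial (Fin 3) ℂ} (hH : H.IsHomogeneous 4) :
    {t | ¬ Sm (fam Fm H t)}.Finite := by
  refine Set.Finite.of_finite_image (f := fun t : ℂ => -4 / t)
    ((Module.End.finite_hasEigenvalue (Nm H)).subset ?_) ?_
  · rintro _ ⟨t, ht, rfl⟩
    exact (singular_eigen hH ht).2
  · intro t ht t' ht' h
    have h1 := (singular_eigen hH ht).1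
    have h2 := (singular_eigen hH ht').1
    simp only at h
    rw [div_eq_div_iff h1 h2] at h
    linear_combination h / 4

lemma count_eq {H : MvPolynomial (Fin 3) ℂ} (hH : H.IsHomogeneous 4) (hs : Sm (fam Fm H 1)) :
    (Ls (Sq (fam Fm H 1))).ncard = (Ls (Sq (fam Fm H 0))).ncard := by
  have hconn : IsPreconnected {t | ¬ Sm (fam Fm H t)}ᶜ :=
    ((singular_finite hH).countable.isConnected_compl_of_one_lt_rank
      (by rw [Complex.rank_real_complex]; norm_num)).isPreconnected
  refine hconn.constant (f := fun t => (Ls (Sq (fam Fm H t))).ncard) ?_ (x := 1) (y := 0) ?_ ?_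
  · intro t ht
    have ht' : Sm (fam Fm H t) := by simpa using ht
    have := count_fam Fm_hom hH ht'
    refine ContinuousAt.continuousWithinAt ?_
    refine tendsto_nhds_of_eventually_eq ?_
    exact this
  · simpa using hs
  · intro h
    exact (singular_eigen hH h).1 rfl

end

end Bit

namespace Bit

section

open Topology Filter

def cond (a b : ℂ) : Prop := (a = 0 ∧ b ^ 4 = -1) ∨ (b = 0 ∧ a ^ 4 = -1) ∨ (a ^ 4 = 1 ∧ b ^ 4 = 1)

lemma cond_of_eqs {a b u v w : ℂ} (h0 : 1 + a ^ 4 = u ^ 2) (h1 : 4 * a ^ 3 * b = 2 * u * v)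
    (h2 : 6 * a ^ 2 * b ^ 2 = v ^ 2 + 2 * u * w) (h3 : 4 * a * b ^ 3 = 2 * v * w)
    (h4 : 1 + b ^ 4 = w ^ 2) : cond a b := by
  by_cases ha : a = 0
  · subst ha
    have hu : u ≠ 0 := by rintro rfl; norm_num at h0
    have hv : v = 0 := by
      have : u * v = 0 := by linear_combination -h1 / 2
      exact (mul_eq_zero.mp this).resolve_left hu
    subst hv
    have hw : w = 0 := by
      have : u * w = 0 := by linear_combination -h2 / 2
      exact (mul_eq_zero.mp this).resolve_left hu
    subst hw
    exact Or.inl ⟨rfl, by linear_combination h4⟩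
  by_cases hb : b = 0
  · subst hb
    have hw : w ≠ 0 := by rintro rfl; norm_num at h4
    have hv : v = 0 := by
      have : v * w = 0 := by linear_combination -h3 / 2
      exact (mul_eq_zero.mp this).resolve_right hw
    subst hv
    have hu : u = 0 := by
      have : u * w = 0 := by linear_combination -h2 / 2
      exact (mul_eq_zero.mp this).resolve_right hw
    subst hu
    exact Or.inr (Or.inl ⟨rfl, by linear_combination h0⟩)
  right; right
  have key : (v ^ 2 - 2 * (a * b) ^ 2) * (v ^ 2 - 4 * (a * b) ^ 2) = 0 := by
    linear_combination (-v ^ 2) * h2 + (1 / 2) * (4 * a * b ^ 3) * h1 + (1 / 2) * (2 * u * v) * h3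
  have hab : (a * b) ^ 2 ≠ 0 := pow_ne_zero _ (mul_ne_zero ha hb)
  have g1 : 4 * a ^ 4 * (a * b) ^ 2 = u ^ 2 * v ^ 2 := by
    linear_combination (1 / 4) * (4 * a ^ 3 * b + 2 * u * v) * h1
  have g2 : 4 * b ^ 4 * (a * b) ^ 2 = w ^ 2 * v ^ 2 := by
    linear_combination (1 / 4) * (4 * a * b ^ 3 + 2 * v * w) * h3
  rcases mul_eq_zero.mp key with hk | hk
  · constructor
    · have : (a ^ 4 - 1) * (a * b) ^ 2 = 0 := by
        linear_combination g1 / 2 - (a * b) ^ 2 * h0 + u ^ 2 / 2 * hk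
      exact sub_eq_zero.mp ((mul_eq_zero.mp this).resolve_right hab)
    · have : (b ^ 4 - 1) * (a * b) ^ 2 = 0 := by
        linear_combination g2 / 2 - (a * b) ^ 2 * h4 + w ^ 2 / 2 * hk
      exact sub_eq_zero.mp ((mul_eq_zero.mp this).resolve_right hab)
  · exfalso
    apply hab
    linear_combination (a * b) ^ 2 * h0 - g1 / 4 - u ^ 2 / 4 * hk

lemma exists_of_cond {a b : ℂ} (h : cond a b) :
    ∃ u v w : ℂ, ∀ s, 1 + s ^ 4 + (a + b * s) ^ 4 = (qv u v w s) ^ 2 := by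
  rcases h with ⟨rfl, h⟩ | ⟨rfl, h⟩ | ⟨h, h'⟩
  · exact ⟨1, 0, 0, fun s => by simp only [qv]; linear_combination s ^ 4 * h⟩
  · exact ⟨0, 0, 1, fun s => by simp only [qv]; linear_combination h⟩
  · obtain ⟨r, hr⟩ := IsAlgClosed.exists_pow_nat_eq (2 : ℂ) (n := 2) (by norm_num)
    refine ⟨r * a ^ 2, r * (a * b), r * b ^ 2, fun s => ?_⟩
    simp only [qv]
    linear_combination (-(a ^ 2 + a * b * s + b ^ 2 * s ^ 2) ^ 2) * hr - h - s ^ 4 * h'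

lemma cond_iff {a b : ℂ} : (∃ u v w : ℂ, ∀ k, 1 + nd k ^ 4 + (a + b * nd k) ^ 4 =
    (qv u v w (nd k)) ^ 2) ↔ cond a b := by
  constructor
  · rintro ⟨u, v, w, h⟩
    have p0 := h 0
    have p1 := h 1
    have p2 := h 2
    have p3 := h 3
    have p4 := h 4
    simp [nd, qv] at p0 p1 p2 p3 p4
    refine cond_of_eqs (u := u) (v := v) (w := w) p0 ?_ ?_ ?_ ?_
    · linear_combination (8 * (p1 - p2) - (p3 - p4)) / 12
    · linear_combination (16 * (p1 + p2) - (p3 + p4)) / 24 - 30 / 24 * p0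
    · linear_combination ((p3 - p4) - 2 * (p1 - p2)) / 12
    · linear_combination ((p3 + p4) - 4 * (p1 + p2)) / 24 + 6 / 24 * p0
  · intro h
    obtain ⟨u, v, w, h⟩ := exists_of_cond h
    exact ⟨u, v, w, fun k => h _⟩

def frZ : Frame ![0, 0, 1] where
  e1 := ![1, 0, 0]
  e2 := ![0, 1, 0]
  e3 := ![0, 0, 1]
  x1 := ![1, 0, 0]
  x2 := ![0, 1, 0]
  x3 := ![0, 0, 1]
  h11 := by simp
  h12 := by simp
  h13 := by simp
  h21 := by simp
  h22 := by simp
  h23 := by simp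
  h31 := by simp
  h32 := by simp
  h33 := by simp
  rep := fun p => by ext i; fin_cases i <;> simp [dotProduct, Fin.sum_univ_three]
  l1 := by simp
  l2 := by simp
  l3 := by simp

def frY : Frame ![0, 1, 0] where
  e1 := ![1, 0, 0]
  e2 := ![0, 0, 1]
  e3 := ![0, 1, 0]
  x1 := ![1, 0, 0]
  x2 := ![0, 0, 1]
  x3 := ![0, 1, 0]
  h11 := by simp
  h12 := by simp
  h13 := by simp
  h21 := by simp
  h22 := by simp
  h23 := by simp
  h31 := by simp
  h32 := by simp
  h33 := by simp
  rep := fun p => by ext i; fin_cases i <;> simp [dotProduct, Fin.sum_univ_three]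
  l1 := by simp
  l2 := by simp
  l3 := by simp

def frX : Frame ![1, 0, 0] where
  e1 := ![0, 1, 0]
  e2 := ![0, 0, 1]
  e3 := ![1, 0, 0]
  x1 := ![0, 1, 0]
  x2 := ![0, 0, 1]
  x3 := ![1, 0, 0]
  h11 := by simp
  h12 := by simp
  h13 := by simp
  h21 := by simp
  h22 := by simp
  h23 := by simp
  h31 := by simp
  h32 := by simp
  h33 := by simp
  rep := fun p => by ext i; fin_cases i <;> simp [dotProduct, Fin.sum_univ_three]
  l1 := by simp
  l2 := by simp
  l3 := by simp

lemma cond_neg {a b : ℂ} : cond (-a) (-b) ↔ cond a b := by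
  have h (x : ℂ) : (-x) ^ 4 = x ^ 4 := by ring
  simp only [cond, h, neg_eq_zero]

lemma SqZ (a b : ℂ) : Sq Fm ![a, b, 1] ↔ cond a b := by
  rw [Sq_iff frZ Fm_hom (by simp [frZ]), ← cond_neg, ← cond_iff]
  simp only [Fm_eval]
  simp [Frame.pt, Frame.ca, Frame.cb, frZ]

lemma SqY (a : ℂ) : Sq Fm ![a, 1, 0] ↔ a ^ 4 = -1 := by
  have : a ^ 4 = -1 ↔ cond a 0 := by simp [cond]
  rw [Sq_iff frY Fm_hom (by simp [frY]), this, ← cond_neg, ← cond_iff]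
  simp only [Fm_eval]
  simp [Frame.pt, Frame.ca, Frame.cb, frY]
  simp only [add_right_comm]

lemma SqX : ¬ Sq Fm ![1, 0, 0] := by
  have : ¬ cond 0 0 := by simp [cond]
  rw [Sq_iff frX Fm_hom (by simp [frX])]
  rw [← cond_iff] at this
  simp only [Fm_eval]
  simpa [Frame.pt, Frame.ca, Frame.cb, frX] using this

lemma Sq_smul_iff {F : MvPolynomial (Fin 3) ℂ} {l : V} {c : ℂ} (hc : c ≠ 0) :
    Sq F (c • l) ↔ Sq F l := by
  refine ⟨fun h => ?_, Sq_smul hc⟩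
  have := Sq_smul (inv_ne_zero hc) h
  rwa [smul_smul, inv_mul_cancel₀ hc, one_smul] at this

noncomputable def R1 : Finset ℂ := {1, -1, Complex.I, -Complex.I}

lemma card_R1 : R1.card = 4 := by
  unfold R1
  rw [Finset.card_insert_of_notMem, Finset.card_insert_of_notMem, Finset.card_insert_of_notMem,
    Finset.card_singleton] <;> norm_num [Complex.ext_iff]

lemma mem_R1 {x : ℂ} : x ∈ R1 ↔ x ^ 4 = 1 := by
  have : x ^ 4 = 1 ↔ (x - 1) * ((x + 1) * ((x - Complex.I) * (x + Complex.I))) = 0 := by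
    have hI := Complex.I_sq
    constructor <;> intro h
    · linear_combination h - (x ^ 2 - 1) * hI
    · linear_combination h + (x ^ 2 - 1) * hI
  rw [this]
  simp [R1, sub_eq_zero, add_eq_zero_iff_eq_neg]

lemma exists_Rm : ∃ R : Finset ℂ, R.card = 4 ∧ ∀ x, x ∈ R ↔ x ^ 4 = -1 := by
  obtain ⟨r, hr⟩ := IsAlgClosed.exists_pow_nat_eq (-1 : ℂ) (n := 4) (by norm_num)
  have hr0 : r ≠ 0 := by rintro rfl; norm_num at hr
  refine ⟨R1.image (r * ·), ?_, fun x => ?_⟩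
  · rw [Finset.card_image_of_injective _ (mul_right_injective₀ hr0), card_R1]
  · rw [Finset.mem_image]
    constructor
    · rintro ⟨y, hy, rfl⟩
      rw [mem_R1] at hy
      rw [mul_pow, hr, hy, mul_one]
    · intro hx
      exact ⟨x / r, mem_R1.mpr (by rw [div_pow, hr, hx]; norm_num), by field_simp⟩

lemma span_eq_iff {k k' : V} (h : Submodule.span ℂ {k} = Submodule.span ℂ {k'}) :
    ∃ a : ℂ, a • k = k' := by
  have : k' ∈ Submodule.span ℂ {k} := h ▸ Submodule.mem_span_singleton_self k'
  exact Submodule.mem_span_singleton.mp this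

lemma fermat_count : (Ls (Sq Fm)).ncard = 28 := by
  classical
  obtain ⟨R, hR, hRm⟩ := exists_Rm
  let T1 : Finset (ℂ × ℂ) := ({0} ×ˢ R) ∪ ((R ×ˢ {0}) ∪ (R1 ×ˢ R1))
  have hT1 : ∀ z, z ∈ T1 ↔ cond z.1 z.2 := by
    rintro ⟨a, b⟩
    simp only [T1, Finset.mem_union, Finset.mem_product, Finset.mem_singleton, hRm, mem_R1, cond]
    tauto
  have hcT1 : T1.card = 24 := by
    have n0 : (0 : ℂ) ∉ R := by rw [hRm]; norm_num
    have n1 : (0 : ℂ) ∉ R1 := by rw [mem_R1]; norm_num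
    rw [Finset.card_union_of_disjoint, Finset.card_union_of_disjoint]
    · simp [hR, card_R1]
    · rw [Finset.disjoint_left]
      rintro ⟨a, b⟩ h1 h2
      simp only [Finset.mem_product, Finset.mem_singleton] at h1 h2
      exact n1 (h1.2 ▸ h2.2)
    · rw [Finset.disjoint_left]
      rintro ⟨a, b⟩ h1 h2
      simp only [Finset.mem_union, Finset.mem_product, Finset.mem_singleton] at h1 h2
      rcases h2 with h2 | h2
      · exact n0 (h1.1 ▸ h2.1)
      · exact n1 (h1.1 ▸ h2.1)
  let f1 : ℂ × ℂ → Submodule ℂ V := fun z => Submodule.span ℂ {![z.1, z.2, 1]}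
  let f2 : ℂ → Submodule ℂ V := fun a => Submodule.span ℂ {![a, 1, 0]}
  have hf1 : Function.Injective f1 := by
    rintro ⟨a, b⟩ ⟨a', b'⟩ h
    obtain ⟨c, hc⟩ := span_eq_iff h
    have c0 := congrFun hc 0
    have c1 := congrFun hc 1
    have c2 := congrFun hc 2
    simp at c0 c1 c2
    subst c2
    simp at c0 c1
    rw [c0, c1]
  have hf2 : Function.Injective f2 := by
    rintro a a' h
    obtain ⟨c, hc⟩ := span_eq_iff h
    have c0 := congrFun hc 0
    have c1 := congrFun hc 1
    simp at c0 c1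
    subst c1
    simpa using c0
  have hset : Ls (Sq Fm) = ((T1.image f1 ∪ R.image f2 : Finset (Submodule ℂ V)) : Set _) := by
    ext L
    simp only [Finset.coe_union, Finset.coe_image, Set.mem_union, Set.mem_image, Finset.mem_coe, hT1, hRm]
    constructor
    · rintro ⟨l, hl, hS, rfl⟩
      by_cases h2 : l 2 = 0
      · by_cases h1 : l 1 = 0
        · exfalso
          have h0 : l 0 ≠ 0 := fun h0 => hl (by ext i; fin_cases i <;> assumption)
          have e : l = l 0 • ![1, 0, 0] := by ext i; fin_cases i <;> simp [h1, h2]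
          rw [e, Sq_smul_iff h0] at hS
          exact SqX hS
        · right
          have e : l = l 1 • ![l 0 / l 1, 1, 0] := by
            ext i; fin_cases i <;> simp [h2]
            field_simp
          rw [e, Sq_smul_iff h1, SqY] at hS
          refine ⟨_, hS, ?_⟩
          conv_rhs => rw [e, Submodule.span_singleton_smul_eq (isUnit_iff_ne_zero.mpr h1)]
      · left
        have e : l = l 2 • ![l 0 / l 2, l 1 / l 2, 1] := by
          ext i; fin_cases i <;> simp <;> field_simp
        rw [e, Sq_smul_iff h2, SqZ] at hS
        refine ⟨(_, _), hS, ?_⟩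
        conv_rhs => rw [e, Submodule.span_singleton_smul_eq (isUnit_iff_ne_zero.mpr h2)]
    · rintro (⟨⟨a, b⟩, h, rfl⟩ | ⟨a, h, rfl⟩)
      · exact ⟨_, fun h0 => by simpa using congrFun h0 2, (SqZ a b).mpr h, rfl⟩
      · exact ⟨_, fun h0 => by simpa using congrFun h0 1, (SqY a).mpr h, rfl⟩
  rw [hset, Set.ncard_coe_finset, Finset.card_union_of_disjoint,
    Finset.card_image_of_injective _ hf1, Finset.card_image_of_injective _ hf2, hcT1, hR]
  rw [Finset.disjoint_left]
  intro L h1 h2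
  obtain ⟨z, -, rfl⟩ := Finset.mem_image.mp h1
  obtain ⟨a, -, h⟩ := Finset.mem_image.mp h2
  obtain ⟨c, hc⟩ := span_eq_iff h
  simpa using congrFun hc 2

end

end Bit

namespace Bit

section

open Topology Filter

lemma lf_coeff (c : V) (i : Fin 3) : coeff (Finsupp.single i 1) (lf c) = c i := by
  classical
  simp [lf, coeff_sum, coeff_C_mul, coeff_X, Finsupp.single_left_inj]

lemma lf_surj {l : MvPolynomial (Fin 3) ℂ} (hl : l.IsHomogeneous 1) : ∃ c : V, l = lf c := by
  refine ⟨fun i => coeff (Finsupp.single i 1) l, ?_⟩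
  ext d
  by_cases hd : d.degree = 1
  · have : d ∈ Set.range (fun a : Fin 3 => Finsupp.single a 1) := by
      rw [Finsupp.range_single_one]; exact hd
    obtain ⟨i, rfl⟩ := this
    simp only [lf_coeff]
  · rw [hl.coeff_eq_zero hd, (lf_hom _).coeff_eq_zero hd]

/-- the linear map sending a vector to its linear form -/
noncomputable def lfm : V →ₗ[ℂ] MvPolynomial (Fin 3) ℂ where
  toFun := lf
  map_add' a b := by simp [lf, add_mul, Finset.sum_add_distrib]
  map_smul' a b := by simp [lf, smul_eq_C_mul, Finset.mul_sum, mul_assoc]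

lemma lfm_inj : Function.Injective lfm := by
  intro a b h
  ext i
  rw [← lf_coeff a, ← lf_coeff b]
  exact congrArg _ h

lemma lf_dvd {c : V} (hc : c ≠ 0) {P : MvPolynomial (Fin 3) ℂ}
    (h : ∀ p, c ⬝ᵥ p = 0 → eval p P = 0) : lf c ∣ P := by
  obtain ⟨i, hi⟩ := Function.ne_iff.mp hc
  have hi' : c i ≠ 0 := hi
  let e : V := Pi.single i (c i)⁻¹
  have he : c ⬝ᵥ e = 1 := by simp [e, hi']
  let σ : MvPolynomial (Fin 3) ℂ →ₐ[ℂ] MvPolynomial (Fin 3) ℂ := aeval fun j => X j - C (e j) * lf c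
  have h1 : σ P = 0 := by
    apply MvPolynomial.funext
    intro p
    have : eval p (σ P) = eval (p - (c ⬝ᵥ p) • e) P := by
      have hh : ((aeval p).comp σ : MvPolynomial (Fin 3) ℂ →ₐ[ℂ] ℂ) = aeval (p - (c ⬝ᵥ p) • e) := by
        apply MvPolynomial.algHom_ext
        intro j
        simp [σ, lf_eval, coe_aeval_eq_eval, mul_comm]
      have := DFunLike.congr_fun hh P
      simpa [coe_aeval_eq_eval] using this
    rw [this, map_zero]
    apply h
    rw [dotProduct_sub, dotProduct_smul, he]
    simp
  have h2 : (Ideal.Quotient.mkₐ ℂ (Ideal.span {lf c})).comp σ =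
      Ideal.Quotient.mkₐ ℂ (Ideal.span {lf c}) := by
    apply MvPolynomial.algHom_ext
    intro j
    simp only [AlgHom.comp_apply, σ, aeval_X, Ideal.Quotient.mkₐ_eq_mk]
    rw [Ideal.Quotient.eq]
    have : X j - C (e j) * lf c - X j = -C (e j) * lf c := by ring
    rw [this]
    exact Ideal.mul_mem_left _ _ (Ideal.mem_span_singleton_self _)
  have h3 := DFunLike.congr_fun h2 P
  rw [AlgHom.comp_apply, h1, map_zero, Ideal.Quotient.mkₐ_eq_mk] at h3
  exact Ideal.mem_span_singleton.mp (Ideal.Quotient.eq_zero_iff_mem.mp h3.symm)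

lemma lf_dvd_hom {c : V} {P : MvPolynomial (Fin 3) ℂ} (hP : P.IsHomogeneous 4)
    (h : lf c ∣ P) : ∃ g : MvPolynomial (Fin 3) ℂ, g.IsHomogeneous 3 ∧ P = g * lf c := by
  classical
  obtain ⟨g, rfl⟩ := h
  letI := MvPolynomial.gradedAlgebra (σ := Fin 3) (R := ℂ)
  have h1 := DirectSum.coe_decompose_mul_add_of_left_mem (homogeneousSubmodule (Fin 3) ℂ)
    (i := 1) (j := 3) (a := lf c) (b := g) (lf_hom c)
  have h2 := DirectSum.decompose_of_mem_same (homogeneousSubmodule (Fin 3) ℂ) (i := 4) hP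
  refine ⟨_, ((DirectSum.decompose (homogeneousSubmodule (Fin 3) ℂ) g) 3).2, ?_⟩
  rw [mul_comm _ (lf c), ← h1]
  exact h2.symm

lemma isBitangent_iff {f : MvPolynomial (Fin 3) ℝ} (hf : f.IsHomogeneous 4)
    {l : MvPolynomial (Fin 3) ℂ} :
    IsBitangent f l ↔ ∃ c : V, c ≠ 0 ∧ Sq (map (algebraMap ℝ ℂ) f) c ∧ l = lf c := by
  constructor
  · rintro ⟨h0, h1, q, h, hq, hh, he⟩
    obtain ⟨c, rfl⟩ := lf_surj h1
    refine ⟨c, ?_, ⟨q, hq, fun p hp => ?_⟩, rfl⟩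
    · rintro rfl
      exact h0 (map_zero lfm)
    · rw [he, map_add, map_mul, lf_eval, hp, mul_zero, add_zero, map_pow]
  · rintro ⟨c, hc, ⟨Q, hQ, h⟩, rfl⟩
    refine ⟨fun h0 => hc (lfm_inj (h0.trans (map_zero lfm).symm)), lf_hom c, ?_⟩
    have hP : (map (algebraMap ℝ ℂ) f - Q ^ 2).IsHomogeneous 4 :=
      (hf.map _).sub (hQ.pow 2)
    obtain ⟨g, hg, he⟩ := lf_dvd_hom hP (lf_dvd hc fun p hp => by
      rw [map_sub, h p hp, map_pow, sub_self])
    exact ⟨Q, g, hQ, hg, by rw [← he]; ring⟩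

lemma set_eq {f : MvPolynomial (Fin 3) ℝ} (hf : f.IsHomogeneous 4) :
    {L : Submodule ℂ (MvPolynomial (Fin 3) ℂ) |
      ∃ l, IsBitangent f l ∧ L = Submodule.span ℂ {l}} =
    Submodule.map lfm '' Ls (Sq (map (algebraMap ℝ ℂ) f)) := by
  have hspan (c : V) : Submodule.map lfm (Submodule.span ℂ {c}) = Submodule.span ℂ {lf c} := by
    rw [Submodule.map_span, Set.image_singleton]; rfl
  ext L
  constructor
  · rintro ⟨l, hl, rfl⟩
    obtain ⟨c, hc, hS, rfl⟩ := (isBitangent_iff hf).mp hl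
    exact ⟨_, ⟨c, hc, hS, rfl⟩, hspan c⟩
  · rintro ⟨_, ⟨c, hc, hS, rfl⟩, rfl⟩
    exact ⟨lf c, (isBitangent_iff hf).mpr ⟨c, hc, hS, rfl⟩, hspan c⟩

end

end Bit

/-- **Plücker (1834).** Every smooth ternary quartic has exactly 28 bitangents,
counted as lines, i.e. as one-dimensional subspaces of `ℂ[x,y,z]₁` spanned by
bitangents. -/
theorem smooth_quartic_has_28_bitangents
    (f : MvPolynomial (Fin 3) ℝ) (hhom : f.IsHomogeneous 4) (hsm : IsSmooth f) :
    {L : Submodule ℂ (MvPolynomial (Fin 3) ℂ) |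
      ∃ l, IsBitangent f l ∧ L = Submodule.span ℂ {l}}.ncard = 28 := by
  rw [Bit.set_eq hhom, Set.ncard_image_of_injective _
    (Submodule.map_injective_of_injective Bit.lfm_inj)]
  have hF := hhom.map (algebraMap ℝ ℂ)
  have hH : (map (algebraMap ℝ ℂ) f - Bit.Fm).IsHomogeneous 4 := hF.sub Bit.Fm_hom
  have h1 : Bit.fam Bit.Fm (map (algebraMap ℝ ℂ) f - Bit.Fm) 1 = map (algebraMap ℝ ℂ) f := by
    simp [Bit.fam]
  have h0 : Bit.fam Bit.Fm (map (algebraMap ℝ ℂ) f - Bit.Fm) 0 = Bit.Fm := by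
    simp [Bit.fam]
  have hc := Bit.count_eq hH (by rw [h1]; exact hsm)
  rw [h1, h0, Bit.fermat_count] at hc
  exact hc
end
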